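/- arXiv:2403.10270 — 12 statements merged into one kernel-verified Lean document; each statement's English description precedes it below -/
import Mathlib

section
/- Let α, β ∈ ℝ. For every finitely supported function u : ℕ → ℝ with u(0) = 0, one has Σ_{n=1}^∞ |u(n) − u(n−1)|² n^α ≥ Σ_{n=1}^∞ w_{α,β}(n) |u(n)|², where w_{α,β}(n) := n^α [1 + (1+1/n)^α − (1−1/n)^β − (1+1/n)^{α+β}] for n ≥ 2 and w_{α,β}(1) := 1 + 2^α − 2^{α+β}. -/
/-- The weight `w_{α,β}(n)` from the discrete weighted Hardy inequality:
`w_{α,β}(n) = n^α [1 + (1+1/n)^α − (1−1/n)^β − (1+1/n)^{α+β}]` for `n ≥ 2`,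
and `w_{α,β}(1) = 1 + 2^α − 2^{α+β}`. -/
noncomputable def hardyWeight (α β : ℝ) (n : ℕ) : ℝ :=
  if n = 1 then 1 + (2 : ℝ) ^ α - (2 : ℝ) ^ (α + β)
  else (n : ℝ) ^ α *
    (1 + (1 + 1 / (n : ℝ)) ^ α - (1 - 1 / (n : ℝ)) ^ β - (1 + 1 / (n : ℝ)) ^ (α + β))

/-- The coefficient with which the `m + 1`-st difference of `u` bounds `u m ^ 2` from below,
for the ground state `n ↦ n ^ β`. -/
noncomputable def forwardCoeff (α β : ℝ) (m : ℕ) : ℝ :=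
  ((m : ℝ) + 1) ^ α * (1 - (1 + 1 / (m : ℝ)) ^ β)

lemma sq_sub_ge_of_pos {x : ℝ} (hx : 0 < x) (a b : ℝ) :
    a ^ 2 * (1 - x) + b ^ 2 * (1 - x⁻¹) ≤ (a - b) ^ 2 := by
  have h : (a - b) ^ 2 - (a ^ 2 * (1 - x) + b ^ 2 * (1 - x⁻¹)) = (a * x - b) ^ 2 * x⁻¹ := by
    field_simp
    ring
  have : 0 ≤ (a * x - b) ^ 2 * x⁻¹ := by positivity
  linarith

lemma rpow_mul_one_add_inv_rpow (α : ℝ) {n : ℕ} (hn : 0 < n) :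
    (n : ℝ) ^ α * (1 + 1 / (n : ℝ)) ^ α = ((n : ℝ) + 1) ^ α := by
  have hn' : (0 : ℝ) < n := by exact_mod_cast hn
  rw [← Real.mul_rpow hn'.le (by positivity)]
  congr 1
  field_simp

lemma hardyWeight_one (α β : ℝ) : hardyWeight α β 1 = 1 + forwardCoeff α β 1 := by
  have h : (2 : ℝ) ^ (α + β) = 2 ^ α * 2 ^ β := Real.rpow_add (by norm_num) _ _
  simp only [hardyWeight, forwardCoeff, if_true, h]
  norm_num
  ring

lemma hardyWeight_of_ne_one (α β : ℝ) {n : ℕ} (hn : 0 < n) (h1 : n ≠ 1) :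
    hardyWeight α β n =
      (n : ℝ) ^ α * (1 - (1 - 1 / (n : ℝ)) ^ β) + forwardCoeff α β n := by
  have h : (1 + 1 / (n : ℝ)) ^ (α + β) = (1 + 1 / (n : ℝ)) ^ α * (1 + 1 / (n : ℝ)) ^ β :=
    Real.rpow_add (by positivity) _ _
  rw [hardyWeight, if_neg h1, forwardCoeff, ← rpow_mul_one_add_inv_rpow α hn, h]
  ring

lemma hardyWeight_mul_sq_le (α β : ℝ) (u : ℕ → ℝ) (h0 : u 0 = 0) (n : ℕ) :
    hardyWeight α β (n + 1) * |u (n + 1)| ^ 2 ≤ |u (n + 1) - u n| ^ 2 * ((n : ℝ) + 1) ^ α +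
      (forwardCoeff α β (n + 1) * u (n + 1) ^ 2 - forwardCoeff α β n * u n ^ 2) := by
  simp only [sq_abs]
  rcases Nat.eq_zero_or_pos n with rfl | hn
  · simp only [zero_add, hardyWeight_one, h0, Nat.cast_zero, Real.one_rpow]
    apply le_of_eq
    ring
  · have hn' : (0 : ℝ) < n := by exact_mod_cast hn
    have hinv : 1 + 1 / (n : ℝ) = (1 - 1 / ((n : ℝ) + 1))⁻¹ := by
      have : 1 - 1 / ((n : ℝ) + 1) = n / (n + 1) := by field_simp; ring
      rw [this]
      field_simp
    have hpos : 0 < 1 - 1 / ((n : ℝ) + 1) := by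
      rw [← inv_pos, ← hinv]
      positivity
    have key := mul_le_mul_of_nonneg_left
      (sq_sub_ge_of_pos (Real.rpow_pos_of_pos hpos β) (u (n + 1)) (u n))
      (Real.rpow_nonneg (by positivity : (0 : ℝ) ≤ (n : ℝ) + 1) α)
    have hc : forwardCoeff α β n =
        ((n : ℝ) + 1) ^ α * (1 - ((1 - 1 / ((n : ℝ) + 1)) ^ β)⁻¹) := by
      rw [forwardCoeff, hinv, Real.inv_rpow hpos.le]
    rw [hardyWeight_of_ne_one α β n.succ_pos (by omega), hc]
    push_cast
    linarith

/-- Two-parameter family of discrete weighted Hardy inequalities on `ℕ`. -/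
theorem discrete_weighted_hardy (α β : ℝ) (u : ℕ → ℝ)
    (hu : (Function.support u).Finite) (h0 : u 0 = 0) :
    ∑' n : ℕ, hardyWeight α β (n + 1) * |u (n + 1)| ^ 2 ≤
      ∑' n : ℕ, |u (n + 1) - u n| ^ 2 * ((n : ℝ) + 1) ^ α := by
  obtain ⟨N, hN⟩ := hu.bddAbove
  have hz : ∀ n, N < n → u n = 0 := fun n hn => by
    by_contra h
    exact absurd (hN h) (not_le.mpr hn)
  rw [tsum_eq_sum (s := Finset.range (N + 1)), tsum_eq_sum (s := Finset.range (N + 1))]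
  · refine (Finset.sum_le_sum fun n _ => hardyWeight_mul_sq_le α β u h0 n).trans_eq ?_
    rw [Finset.sum_add_distrib,
      Finset.sum_range_sub (fun n => forwardCoeff α β n * u n ^ 2), hz (N + 1) (by omega), h0]
    simp
  · intro n hn
    rw [Finset.mem_range] at hn
    simp [hz n (by omega), hz (n + 1) (by omega)]
  · intro n hn
    rw [Finset.mem_range] at hn
    simp [hz (n + 1) (by omega)]
end

section
/- Let α ∈ [0,1) ∪ [5,∞). For every finitely supported function u : ℕ → ℝ with u(0) = 0, one has Σ_{n=1}^∞ |u(n) − u(n−1)|² n^α ≥ ((α−1)²/4) Σ_{n=1}^∞ |u(n)|² n^{α−2}. Moreover the constant (α−1)²/4 is sharp: if C ∈ ℝ is such that Σ_{n=1}^∞ |u(n) − u(n−1)|² n^α ≥ C Σ_{n=1}^∞ |u(n)|² n^{α−2} holds for every finitely supported u : ℕ → ℝ with u(0) = 0, then C ≤ (α−1)²/4. -/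
open Filter Topology

/-- A weighted Hardy inequality follows from a sequence `A` for which every edge satisfies a
telescoping pointwise bound. -/
lemma hardy_of_edge_bound (α D : ℝ) (A : ℕ → ℝ) (hA₁ : -1 ≤ A 1)
    (hedge : ∀ n : ℕ, 1 ≤ n → ∀ x y : ℝ,
      A n * y ^ 2 - A (n + 1) * x ^ 2 + D * (y ^ 2 * (n : ℝ) ^ (α - 2)) ≤
        (x - y) ^ 2 * ((n : ℝ) + 1) ^ α)
    (u : ℕ → ℝ) (hu : (Function.support u).Finite) (hu₀ : u 0 = 0) :
    D * ∑' n : ℕ, |u (n + 1)| ^ 2 * ((n : ℝ) + 1) ^ (α - 2) ≤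
      ∑' n : ℕ, |u (n + 1) - u n| ^ 2 * ((n : ℝ) + 1) ^ α := by
  obtain ⟨N, hN⟩ : ∃ N : ℕ, ∀ n, N ≤ n → u n = 0 := by
    obtain ⟨B, hB⟩ := hu.bddAbove
    refine ⟨B + 1, fun n hn => ?_⟩
    by_contra h
    have := hB (Function.mem_support.2 h)
    omega
  simp only [sq_abs]
  rw [tsum_eq_sum (s := Finset.range N), tsum_eq_sum (s := Finset.range (N + 1))]
  · have hterm : ∀ n : ℕ, A n * u n ^ 2 - A (n + 1) * u (n + 1) ^ 2 +
        D * (u n ^ 2 * (n : ℝ) ^ (α - 2)) ≤ (u (n + 1) - u n) ^ 2 * ((n : ℝ) + 1) ^ α := by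
      intro n
      rcases Nat.eq_zero_or_pos n with rfl | hn
      · simp only [hu₀, Nat.cast_zero, zero_add, Real.one_rpow]
        nlinarith [sq_nonneg (u 1)]
      · exact hedge n hn _ _
    have hsum := Finset.sum_le_sum fun n (_ : n ∈ Finset.range (N + 1)) => hterm n
    rw [Finset.sum_add_distrib, Finset.sum_range_sub' (fun n => A n * u n ^ 2),
      ← Finset.mul_sum, Finset.sum_range_succ' (fun n : ℕ => u n ^ 2 * (n : ℝ) ^ (α - 2)),
      hN (N + 1) (by omega), hu₀] at hsum
    simpa using hsum
  · intro n hn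
    have : N ≤ n := by simp at hn; omega
    simp [hN n this, hN (n + 1) (by omega)]
  · intro n hn
    have : N ≤ n := by simpa using hn
    simp [hN (n + 1) (by omega)]

lemma sq_sub_ge_of_pos_s1 {t : ℝ} (ht : 0 < t) (x y : ℝ) :
    (1 - t) * x ^ 2 + (1 - t⁻¹) * y ^ 2 ≤ (x - y) ^ 2 := by
  have h : (x - y) ^ 2 - ((1 - t) * x ^ 2 + (1 - t⁻¹) * y ^ 2) = t⁻¹ * (t * x - y) ^ 2 := by
    field_simp
    ring
  have : 0 ≤ t⁻¹ * (t * x - y) ^ 2 := by positivity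
  linarith

/-- The edge bound for `A n = c * n ^ α / (n - κ)`, reduced to a one-variable inequality. -/
lemma edge_bound_of_ratio (α c κ : ℝ) (n : ℕ) (hn : 1 ≤ n) (hκ : 0 < (n : ℝ) - κ)
    (ht : 0 < (n : ℝ) + 1 - κ + c)
    (hratio : 0 ≤ c * ((1 + 1 / (n : ℝ)) ^ α / (n + 1 - κ + c) - 1 / (n - κ) - c / (n : ℝ) ^ 2))
    (x y : ℝ) :
    c * (n : ℝ) ^ α / (n - κ) * y ^ 2
        - c * ((n + 1 : ℕ) : ℝ) ^ α / ((n + 1 : ℕ) - κ) * x ^ 2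
        + c ^ 2 * (y ^ 2 * (n : ℝ) ^ (α - 2)) ≤ (x - y) ^ 2 * ((n : ℝ) + 1) ^ α := by
  have hn' : (0 : ℝ) < n := by exact_mod_cast hn
  have hκ' : 0 < (n : ℝ) + 1 - κ := by linarith
  have hsq := mul_le_mul_of_nonneg_right
    (sq_sub_ge_of_pos_s1 (t := ((n : ℝ) + 1 - κ + c) / (n + 1 - κ)) (by positivity) x y)
    (by positivity : 0 ≤ ((n : ℝ) + 1) ^ α)
  have hpow : ((n : ℝ) + 1) ^ α = (n : ℝ) ^ α * (1 + 1 / (n : ℝ)) ^ α := by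
    rw [← Real.mul_rpow (by positivity) (by positivity)]
    congr 1
    field_simp
  have hpow₂ : (n : ℝ) ^ (α - 2) = (n : ℝ) ^ α / (n : ℝ) ^ 2 := by
    rw [Real.rpow_sub hn', Real.rpow_two]
  have hmain := mul_nonneg (mul_nonneg hratio (by positivity : 0 ≤ (n : ℝ) ^ α)) (sq_nonneg y)
  have hid : ((1 - ((n : ℝ) + 1 - κ + c) / (n + 1 - κ)) * x ^ 2 +
      (1 - (((n : ℝ) + 1 - κ + c) / (n + 1 - κ))⁻¹) * y ^ 2) * ((n : ℝ) + 1) ^ α -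
      (c * (n : ℝ) ^ α / (n - κ) * y ^ 2
        - c * ((n : ℝ) + 1) ^ α / ((n : ℝ) + 1 - κ) * x ^ 2
        + c ^ 2 * (y ^ 2 * (n : ℝ) ^ (α - 2))) =
      c * ((1 + 1 / (n : ℝ)) ^ α / (n + 1 - κ + c) - 1 / (n - κ) - c / (n : ℝ) ^ 2) *
        (n : ℝ) ^ α * y ^ 2 := by
    rw [hpow₂, hpow]
    generalize (1 + 1 / (n : ℝ)) ^ α = q
    generalize (n : ℝ) ^ α = p
    field_simp
    ring
  push_cast
  linarith

lemma hardy_of_lt_one {α : ℝ} (h₀ : 0 ≤ α) (h₁ : α < 1)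
    (u : ℕ → ℝ) (hu : (Function.support u).Finite) (hu₀ : u 0 = 0) :
    (α - 1) ^ 2 / 4 * ∑' n : ℕ, |u (n + 1)| ^ 2 * ((n : ℝ) + 1) ^ (α - 2) ≤
      ∑' n : ℕ, |u (n + 1) - u n| ^ 2 * ((n : ℝ) + 1) ^ α := by
  obtain ⟨b, rfl⟩ : ∃ b, α = 1 - 2 * b := ⟨(1 - α) / 2, by ring⟩
  have hb₀ : 0 < b := by linarith
  have hb₁ : b ≤ 1 / 2 := by linarith
  have hκ₁ : 0 < 1 - b * (1 - b) := by nlinarith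
  have hD : (1 - 2 * b - 1) ^ 2 / 4 = (-b) ^ 2 := by ring
  rw [hD]
  refine hardy_of_edge_bound _ _
    (fun n => -b * (n : ℝ) ^ (1 - 2 * b) / (n - b * (1 - b))) ?_ (fun n hn => ?_) u hu hu₀
  · simp only [Nat.cast_one, Real.one_rpow]
    rw [le_div_iff₀ hκ₁]
    nlinarith
  · have hn₁ : (1 : ℝ) ≤ n := by exact_mod_cast hn
    have hκ : 0 < (n : ℝ) - b * (1 - b) := by linarith
    have ht : 0 < (n : ℝ) + 1 - b * (1 - b) + -b := by nlinarith
    refine edge_bound_of_ratio _ _ _ n hn hκ ht ?_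
    have hn₀ : (0 : ℝ) < n := by linarith
    have hbern := rpow_one_add_le_one_add_mul_self (s := 1 / (n : ℝ)) (p := 1 - 2 * b)
      (by have : 0 ≤ 1 / (n : ℝ) := by positivity
          linarith) (by linarith) (by linarith)
    have hle : (1 + 1 / (n : ℝ)) ^ (1 - 2 * b) / (n + 1 - b * (1 - b) + -b) ≤
        1 / (n - b * (1 - b)) - b / (n : ℝ) ^ 2 := by
      rw [div_le_iff₀ ht]
      refine hbern.trans ?_
      have hid : (1 / ((n : ℝ) - b * (1 - b)) - b / (n : ℝ) ^ 2) * (n + 1 - b * (1 - b) + -b)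
          - (1 + (1 - 2 * b) * (1 / (n : ℝ))) =
          (1 - b) ^ 2 * b * (b * (1 - b)) / ((n : ℝ) ^ 2 * (n - b * (1 - b))) := by
        field_simp
        ring
      have : 0 ≤ (1 - b) ^ 2 * b * (b * (1 - b)) / ((n : ℝ) ^ 2 * (n - b * (1 - b))) := by
        have : 0 < 1 - b := by linarith
        positivity
      linarith
    have hneg : (1 + 1 / (n : ℝ)) ^ (1 - 2 * b) / (n + 1 - b * (1 - b) + -b) -
        1 / (n - b * (1 - b)) - -b / (n : ℝ) ^ 2 ≤ 0 := by
      rw [neg_div]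
      linarith
    exact mul_nonneg_of_nonpos_of_nonpos (by linarith) hneg

lemma hardy_of_three_le {α : ℝ} (hα : 3 ≤ α)
    (u : ℕ → ℝ) (hu : (Function.support u).Finite) (hu₀ : u 0 = 0) :
    (α - 1) ^ 2 / 4 * ∑' n : ℕ, |u (n + 1)| ^ 2 * ((n : ℝ) + 1) ^ (α - 2) ≤
      ∑' n : ℕ, |u (n + 1) - u n| ^ 2 * ((n : ℝ) + 1) ^ α := by
  obtain ⟨c, rfl⟩ : ∃ c, α = 1 + 2 * c := ⟨(α - 1) / 2, by ring⟩
  have hc : 1 ≤ c := by linarith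
  have hD : (1 + 2 * c - 1) ^ 2 / 4 = c ^ 2 := by ring
  rw [hD]
  refine hardy_of_edge_bound _ _
    (fun n => c * (n : ℝ) ^ (1 + 2 * c) / (n - 0)) ?_ (fun n hn => ?_) u hu hu₀
  · simp only [Nat.cast_one, Real.one_rpow]
    linarith
  · have hn₀ : (0 : ℝ) < n := by exact_mod_cast hn
    refine edge_bound_of_ratio _ _ _ n hn (by linarith) (by linarith) ?_
    have hx : 0 ≤ 1 / (n : ℝ) := by positivity
    have hbern₁ := one_add_mul_self_le_rpow_one_add (s := 1 / (n : ℝ)) (by linarith) hc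
    have hbern₂ := one_add_mul_self_le_rpow_one_add (s := 1 / (n : ℝ)) (p := 1 + c)
      (by linarith) (by linarith)
    have hmul := mul_le_mul hbern₁ hbern₂ (by positivity) (by positivity)
    rw [← Real.rpow_add (by positivity), show c + (1 + c) = 1 + 2 * c by ring] at hmul
    have hle : 1 / ((n : ℝ) - 0) + c / (n : ℝ) ^ 2 ≤
        (1 + 1 / (n : ℝ)) ^ (1 + 2 * c) / (n + 1 - 0 + c) := by
      rw [sub_zero, sub_zero, le_div_iff₀ (by linarith)]
      refine le_trans (le_of_eq ?_) hmul
      field_simp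
      ring
    exact mul_nonneg (by linarith) (by linarith)

lemma tendsto_succ_mul_one_sub_rpow (γ : ℝ) :
    Tendsto (fun n : ℕ => ((n : ℝ) + 1) * (1 - ((n : ℝ) / (n + 1)) ^ γ)) atTop (𝓝 γ) := by
  have hder : HasDerivAt (fun x : ℝ => x ^ γ) γ 1 := by
    simpa using Real.hasDerivAt_rpow_const (x := 1) (p := γ) (Or.inl one_ne_zero)
  have hlim : Tendsto (fun n : ℕ => -(1 / ((n : ℝ) + 1))) atTop (𝓝[≠] 0) := by
    refine tendsto_nhdsWithin_iff.2 ⟨?_, Eventually.of_forall fun n => ?_⟩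
    · simpa using (tendsto_one_div_add_atTop_nhds_zero_nat (𝕜 := ℝ)).neg
    · have : (0 : ℝ) < (n : ℝ) + 1 := by positivity
      simp [this.ne']
  refine (hder.tendsto_slope_zero.comp hlim).congr fun n => ?_
  have hn : ((n : ℝ) + 1) ≠ 0 := by positivity
  have hr : 1 + -(1 / ((n : ℝ) + 1)) = n / (n + 1) := by
    field_simp
    ring
  simp only [Function.comp_apply, hr, Real.one_rpow, smul_eq_mul]
  field_simp
  ring

lemma tendsto_div_succ_rpow_mul (γ : ℝ) :
    Tendsto (fun n : ℕ => ((n : ℝ) / (n + 1)) ^ γ * (((n : ℝ) + 1) / n)) atTop (𝓝 1) := by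
  have hr : Tendsto (fun n : ℕ => (n : ℝ) / (n + 1)) atTop (𝓝 1) :=
    tendsto_natCast_div_add_atTop 1
  have h₁ := hr.rpow_const (p := γ) (Or.inl one_ne_zero)
  have h₂ := hr.inv₀ one_ne_zero
  simpa using h₁.mul h₂

/-- Asymptotic upper bound for one edge of the energy of `n ^ γ` times a slowly varying factor. -/
lemma exists_edge_upper_bound (γ : ℝ) {ε : ℝ} (hε : 0 < ε) :
    ∃ K : ℝ, 0 ≤ K ∧ ∃ n₀ : ℕ, 1 ≤ n₀ ∧ ∀ n : ℕ, n₀ ≤ n → ∀ s : ℝ,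
      (((n : ℝ) + 1) ^ γ * s - (n : ℝ) ^ γ * (s + 1 / n)) ^ 2 * ((n : ℝ) + 1) ^ (1 - 2 * γ) ≤
        ((γ ^ 2 + ε) * s ^ 2 + K) / (n + 1) := by
  have hP := ((tendsto_succ_mul_one_sub_rpow γ).pow 2).eventually_le_const
    (show γ ^ 2 < γ ^ 2 + ε / 2 by linarith)
  have hQ := ((tendsto_div_succ_rpow_mul γ).pow 2).eventually_le_const
    (show (1 : ℝ) ^ 2 < 4 by norm_num)
  obtain ⟨m, hm⟩ := eventually_atTop.1 (hP.and hQ)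
  refine ⟨2 / ε * ((γ ^ 2 + ε / 2) * 4) + 4, by positivity, max m 1, le_max_right _ _,
    fun n hn s => ?_⟩
  obtain ⟨hPn, hQn⟩ := hm n ((le_max_left _ _).trans hn)
  have hn₀ : (0 : ℝ) < n := by exact_mod_cast (le_max_right _ _).trans hn
  have hn₁ : (0 : ℝ) < (n : ℝ) + 1 := by positivity
  have hr : (n : ℝ) ^ γ = ((n : ℝ) + 1) ^ γ * ((n : ℝ) / (n + 1)) ^ γ := by
    rw [← Real.mul_rpow (by positivity) (by positivity)]
    congr 1
    field_simp
  have hw : (((n : ℝ) + 1) ^ γ) ^ 2 * ((n : ℝ) + 1) ^ (1 - 2 * γ) = n + 1 := by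
    rw [← Real.rpow_natCast, ← Real.rpow_mul hn₁.le, ← Real.rpow_add hn₁]
    norm_num
    rw [show γ * 2 + (1 - 2 * γ) = 1 by ring, Real.rpow_one]
  set P := ((n : ℝ) + 1) * (1 - ((n : ℝ) / (n + 1)) ^ γ) with hPdef
  set Q := ((n : ℝ) / (n + 1)) ^ γ * (((n : ℝ) + 1) / n) with hQdef
  have heq : (((n : ℝ) + 1) ^ γ * s - (n : ℝ) ^ γ * (s + 1 / n)) ^ 2 *
      ((n : ℝ) + 1) ^ (1 - 2 * γ) = (P * s - Q) ^ 2 / (n + 1) := by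
    have : ((n : ℝ) + 1) ^ γ * s - (n : ℝ) ^ γ * (s + 1 / n) =
        ((n : ℝ) + 1) ^ γ * ((P * s - Q) / (n + 1)) := by
      rw [hr, hPdef, hQdef]
      field_simp
      ring
    rw [this, mul_pow, mul_right_comm, hw]
    field_simp
  rw [heq]
  gcongr
  have hcross : -(2 * (P * s * Q)) ≤ ε / 2 * s ^ 2 + 2 / ε * (P ^ 2 * Q ^ 2) := by
    have hid : ε / 2 * s ^ 2 + 2 / ε * (P ^ 2 * Q ^ 2) + 2 * (P * s * Q) =
        (ε * s + 2 * (P * Q)) ^ 2 / (2 * ε) := by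
      field_simp
      ring
    have : 0 ≤ (ε * s + 2 * (P * Q)) ^ 2 / (2 * ε) := by positivity
    linarith
  have hPQ : P ^ 2 * Q ^ 2 ≤ (γ ^ 2 + ε / 2) * 4 :=
    mul_le_mul hPn hQn (by positivity) (by positivity)
  have hPs := mul_le_mul_of_nonneg_right hPn (sq_nonneg s)
  have hPQ' := mul_le_mul_of_nonneg_left hPQ (by positivity : 0 ≤ 2 / ε)
  nlinarith

/-- The harmonic tail `∑_{n < k ≤ N} 1 / k`, which vanishes for `N ≤ n`. -/
noncomputable def harmonicTail (N n : ℕ) : ℝ := ∑ k ∈ Finset.Ico n N, 1 / ((k : ℝ) + 1)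

lemma harmonicTail_nonneg (N n : ℕ) : 0 ≤ harmonicTail N n :=
  Finset.sum_nonneg fun k _ => by positivity

lemma harmonicTail_eq_zero {N n : ℕ} (h : N ≤ n) : harmonicTail N n = 0 := by
  simp [harmonicTail, Finset.Ico_eq_empty_of_le h]

lemma harmonicTail_eq_add {N n : ℕ} (h : n < N) :
    harmonicTail N n = harmonicTail N (n + 1) + 1 / ((n : ℝ) + 1) := by
  rw [harmonicTail, Finset.sum_eq_sum_Ico_succ_bot h, add_comm, harmonicTail]

lemma harmonicTail_zero (N : ℕ) :
    harmonicTail N 0 = ∑ k ∈ Finset.range N, 1 / ((k : ℝ) + 1) := by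
  rw [harmonicTail, Finset.range_eq_Ico]

lemma harmonicTail_le (N n : ℕ) : harmonicTail N n ≤ harmonicTail N 0 :=
  Finset.sum_le_sum_of_subset_of_nonneg (Finset.Ico_subset_Ico (Nat.zero_le n) le_rfl)
    fun k _ _ => by positivity

lemma harmonicTail_cube_le (N : ℕ) :
    harmonicTail N 0 ^ 3 ≤ 3 * ∑ n ∈ Finset.range N, harmonicTail N n ^ 2 / ((n : ℝ) + 1) := by
  have h : ∀ n ∈ Finset.range N, harmonicTail N n ^ 3 - harmonicTail N (n + 1) ^ 3 ≤
      3 * (harmonicTail N n ^ 2 / ((n : ℝ) + 1)) := by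
    intro n hn
    have hrec := harmonicTail_eq_add (Finset.mem_range.1 hn)
    have hb := harmonicTail_nonneg N (n + 1)
    have hd : 0 ≤ 1 / ((n : ℝ) + 1) := by positivity
    rw [div_eq_mul_one_div, hrec]
    generalize harmonicTail N (n + 1) = b at *
    generalize 1 / ((n : ℝ) + 1) = d at *
    have : 0 ≤ 3 * b * d ^ 2 + 2 * d ^ 3 := by positivity
    nlinarith
  have hsum := Finset.sum_le_sum h
  rw [Finset.sum_range_sub' (fun n => harmonicTail N n ^ 3), ← Finset.mul_sum,
    harmonicTail_eq_zero le_rfl] at hsum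
  simpa using hsum

/-- The compactly supported near-optimizer `n ^ γ * ∑_{n ≤ k ≤ N} 1 / k`. -/
noncomputable def hardyTest (γ : ℝ) (N n : ℕ) : ℝ := (n : ℝ) ^ γ * harmonicTail N (n - 1)

lemma hardyTest_eq_zero (γ : ℝ) {N n : ℕ} (h : N < n) : hardyTest γ N n = 0 := by
  rw [hardyTest, harmonicTail_eq_zero (by omega), mul_zero]

lemma hardyTest_succ (γ : ℝ) (N n : ℕ) :
    hardyTest γ N (n + 1) = ((n : ℝ) + 1) ^ γ * harmonicTail N n := by
  simp [hardyTest]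

lemma hardyTest_mass (γ : ℝ) (N : ℕ) :
    ∑' n : ℕ, |hardyTest γ N (n + 1)| ^ 2 * ((n : ℝ) + 1) ^ (1 - 2 * γ - 2) =
      ∑ n ∈ Finset.range N, harmonicTail N n ^ 2 / ((n : ℝ) + 1) := by
  rw [tsum_eq_sum (s := Finset.range N)]
  · refine Finset.sum_congr rfl fun n _ => ?_
    have hn₁ : (0 : ℝ) < (n : ℝ) + 1 := by positivity
    have hw : (((n : ℝ) + 1) ^ γ) ^ 2 * ((n : ℝ) + 1) ^ (1 - 2 * γ - 2) = ((n : ℝ) + 1)⁻¹ := by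
      rw [← Real.rpow_natCast, ← Real.rpow_mul hn₁.le, ← Real.rpow_add hn₁, ← Real.rpow_neg_one]
      congr 1
      push_cast
      ring
    rw [sq_abs, hardyTest_succ, mul_pow, mul_right_comm, hw]
    ring
  · intro n hn
    have : N ≤ n := by simpa using hn
    simp [hardyTest_eq_zero γ (show N < n + 1 by omega)]

lemma hardyTest_energy_le (γ : ℝ) {ε : ℝ} (hε : 0 < ε) :
    ∃ K M : ℝ, 0 ≤ K ∧ 0 ≤ M ∧ ∀ N : ℕ,
      ∑' n : ℕ, |hardyTest γ N (n + 1) - hardyTest γ N n| ^ 2 * ((n : ℝ) + 1) ^ (1 - 2 * γ) ≤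
        (γ ^ 2 + ε) * ∑ n ∈ Finset.range N, harmonicTail N n ^ 2 / ((n : ℝ) + 1) +
          K * (harmonicTail N 0 + 1) + M * harmonicTail N 0 ^ 2 := by
  obtain ⟨K, hK, n₀, hn₀, hedge⟩ := exists_edge_upper_bound γ hε
  set m : ℕ → ℝ := fun n =>
    (((n : ℝ) + 1) ^ γ + (n : ℝ) ^ γ) ^ 2 * ((n : ℝ) + 1) ^ (1 - 2 * γ) with hm
  have hm₀ : ∀ n, 0 ≤ m n := fun n => by positivity
  refine ⟨K, ∑ n ∈ Finset.range n₀, m n, hK, Finset.sum_nonneg fun n _ => hm₀ n, fun N => ?_⟩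
  set H := harmonicTail N 0
  have hterm : ∀ n ∈ Finset.range (N + 1),
      |hardyTest γ N (n + 1) - hardyTest γ N n| ^ 2 * ((n : ℝ) + 1) ^ (1 - 2 * γ) ≤
        ((γ ^ 2 + ε) * (harmonicTail N n ^ 2 / ((n : ℝ) + 1)) + K * (1 / ((n : ℝ) + 1))) +
          (if n < n₀ then m n * H ^ 2 else 0) := by
    intro n hn
    have hnN : n ≤ N := by simp at hn; omega
    split_ifs with hlt
    · have hH : 0 ≤ H := harmonicTail_nonneg N 0
      have habs : |hardyTest γ N (n + 1) - hardyTest γ N n| ≤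
          (((n : ℝ) + 1) ^ γ + (n : ℝ) ^ γ) * H := by
        have h₁ : 0 ≤ hardyTest γ N (n + 1) :=
          mul_nonneg (by positivity) (harmonicTail_nonneg _ _)
        have h₂ : 0 ≤ hardyTest γ N n := mul_nonneg (by positivity) (harmonicTail_nonneg _ _)
        have h₃ : hardyTest γ N (n + 1) ≤ ((n : ℝ) + 1) ^ γ * H := by
          rw [hardyTest_succ]
          exact mul_le_mul_of_nonneg_left (harmonicTail_le N n) (by positivity)
        have h₄ : hardyTest γ N n ≤ (n : ℝ) ^ γ * H :=
          mul_le_mul_of_nonneg_left (harmonicTail_le N _) (by positivity)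
        rw [abs_le]
        constructor <;> nlinarith
      have hsq := mul_le_mul_of_nonneg_right (pow_le_pow_left₀ (abs_nonneg _) habs 2)
        (by positivity : 0 ≤ ((n : ℝ) + 1) ^ (1 - 2 * γ))
      have hpos : 0 ≤ (γ ^ 2 + ε) * (harmonicTail N n ^ 2 / ((n : ℝ) + 1)) +
          K * (1 / ((n : ℝ) + 1)) := by positivity
      have : m n * H ^ 2 = ((((n : ℝ) + 1) ^ γ + (n : ℝ) ^ γ) * H) ^ 2 *
          ((n : ℝ) + 1) ^ (1 - 2 * γ) := by
        rw [hm]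
        ring
      linarith
    · obtain ⟨k, rfl⟩ : ∃ k, n = k + 1 := ⟨n - 1, by omega⟩
      have h := hedge (k + 1) (by omega) (harmonicTail N (k + 1))
      have hrec := harmonicTail_eq_add (show k < N by omega)
      have hcur : hardyTest γ N (k + 1) = ((k + 1 : ℕ) : ℝ) ^ γ *
          (harmonicTail N (k + 1) + 1 / ((k + 1 : ℕ) : ℝ)) := by
        rw [hardyTest_succ, hrec]
        push_cast
        rfl
      rw [sq_abs, hardyTest_succ γ N (k + 1), hcur]
      refine h.trans (le_of_eq ?_)
      ring
  have hsmall : ∑ n ∈ Finset.range (N + 1), (if n < n₀ then m n * H ^ 2 else 0) ≤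
      (∑ n ∈ Finset.range n₀, m n) * H ^ 2 := by
    rw [← Finset.sum_filter, Finset.sum_mul]
    refine Finset.sum_le_sum_of_subset_of_nonneg (fun n hn => ?_) fun n _ _ =>
      mul_nonneg (hm₀ n) (sq_nonneg H)
    simp at hn ⊢
    exact hn.2
  have hharm : ∑ n ∈ Finset.range (N + 1), 1 / ((n : ℝ) + 1) ≤ H + 1 := by
    rw [Finset.sum_range_succ, ← harmonicTail_zero]
    have : 1 / ((N : ℝ) + 1) ≤ 1 := by
      rw [div_le_one (by positivity)]
      have : (0 : ℝ) ≤ N := by positivity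
      linarith
    linarith
  have hmass : ∑ n ∈ Finset.range (N + 1), harmonicTail N n ^ 2 / ((n : ℝ) + 1) =
      ∑ n ∈ Finset.range N, harmonicTail N n ^ 2 / ((n : ℝ) + 1) := by
    rw [Finset.sum_range_succ, harmonicTail_eq_zero le_rfl]
    simp
  rw [tsum_eq_sum (s := Finset.range (N + 1))]
  · have hsum := Finset.sum_le_sum hterm
    rw [Finset.sum_add_distrib, Finset.sum_add_distrib, ← Finset.mul_sum, ← Finset.mul_sum,
      hmass] at hsum
    have := mul_le_mul_of_nonneg_left hharm hK
    linarith
  · intro n hn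
    have : N < n := by simp at hn; omega
    simp [hardyTest_eq_zero γ this, hardyTest_eq_zero γ (show N < n + 1 by omega)]

lemma hardy_constant_le {α C : ℝ} (hα : α ≠ 1)
    (hC : ∀ u : ℕ → ℝ, (Function.support u).Finite → u 0 = 0 →
      C * ∑' n : ℕ, |u (n + 1)| ^ 2 * ((n : ℝ) + 1) ^ (α - 2) ≤
        ∑' n : ℕ, |u (n + 1) - u n| ^ 2 * ((n : ℝ) + 1) ^ α) :
    C ≤ (α - 1) ^ 2 / 4 := by
  obtain ⟨γ, rfl⟩ : ∃ γ, α = 1 - 2 * γ := ⟨(1 - α) / 2, by ring⟩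
  have hγ : γ ≠ 0 := by
    rintro rfl
    simp at hα
  by_contra! hlt
  obtain ⟨ε, hε, rfl⟩ : ∃ ε, 0 < ε ∧ C = γ ^ 2 + 2 * ε :=
    ⟨(C - γ ^ 2) / 2, by nlinarith, by ring⟩
  obtain ⟨K, M, hK, hM, henergy⟩ := hardyTest_energy_le γ hε
  have hdiv : Tendsto (fun N => harmonicTail N 0) atTop atTop := by
    simpa only [harmonicTail_zero] using Real.tendsto_sum_range_one_div_nat_succ_atTop
  obtain ⟨N, hN₁, hN₂⟩ := ((hdiv.eventually_ge_atTop 1).and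
    (hdiv.eventually_gt_atTop ((3 * (2 * K + M)) / ε))).exists
  have h := hC (hardyTest γ N)
    ((Set.finite_Iic N).subset fun n hn => by
      by_contra hle
      exact hn (hardyTest_eq_zero γ (by simpa using hle)))
    (by simp [hardyTest, Real.zero_rpow hγ])
  rw [hardyTest_mass] at h
  have h' := h.trans (henergy N)
  have hcube := harmonicTail_cube_le N
  generalize (∑ n ∈ Finset.range N, harmonicTail N n ^ 2 / ((n : ℝ) + 1)) = S at *
  generalize harmonicTail N 0 = H at *
  rw [div_lt_iff₀ hε] at hN₂
  have h₁ : ε * S ≤ K * (H + 1) + M * H ^ 2 := by linarith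
  have h₂ : K * (H + 1) ≤ K * (2 * H ^ 2) := mul_le_mul_of_nonneg_left (by nlinarith) hK
  have h₃ := mul_le_mul_of_nonneg_left hcube hε.le
  have h₄ : 3 * (2 * K + M) * H ^ 2 < H * ε * H ^ 2 := by gcongr
  nlinarith


/-- Sharp discrete weighted Hardy inequality with power weights `n^α` on `ℕ`,
for `α ∈ [0,1) ∪ [5,∞)`, together with the sharpness of the constant `(α−1)²/4`. -/
theorem discrete_power_weight_hardy_sharp (α : ℝ) (hα : (0 ≤ α ∧ α < 1) ∨ 5 ≤ α) :
    (∀ u : ℕ → ℝ, (Function.support u).Finite → u 0 = 0 →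
      (α - 1) ^ 2 / 4 * ∑' n : ℕ, |u (n + 1)| ^ 2 * ((n : ℝ) + 1) ^ (α - 2) ≤
        ∑' n : ℕ, |u (n + 1) - u n| ^ 2 * ((n : ℝ) + 1) ^ α) ∧
    ∀ C : ℝ,
      (∀ u : ℕ → ℝ, (Function.support u).Finite → u 0 = 0 →
        C * ∑' n : ℕ, |u (n + 1)| ^ 2 * ((n : ℝ) + 1) ^ (α - 2) ≤
          ∑' n : ℕ, |u (n + 1) - u n| ^ 2 * ((n : ℝ) + 1) ^ α) →
      C ≤ (α - 1) ^ 2 / 4 := by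
 
  refine ⟨fun u hu hu₀ => ?_, fun C hC => hardy_constant_le ?_ hC⟩
  · rcases hα with ⟨h₀, h₁⟩ | h
    · exact hardy_of_lt_one h₀ h₁ u hu hu₀
    · exact hardy_of_three_le (by linarith) u hu hu₀
  · rcases hα with ⟨-, h⟩ | h <;> [exact h.ne; exact ne_of_gt (by linarith)]
end

section
/- Let α ∈ [1/3,1) ∪ {0}. For every finitely supported function u : ℕ → ℝ with u(0) = 0, one has Σ_{n=1}^∞ |u(n) − u(n−1)|² n^α ≥ ((α−1)²/4) Σ_{n=1}^∞ |u(n)|² n^{α−2} + Σ_{k=3}^∞ b_k(α) Σ_{n=2}^∞ |u(n)|² n^{α−k}, where b_k(α) := binom(α,k) − (−1)^k binom((1−α)/2, k) − binom((1+α)/2, k), and all the coefficients b_k(α) (k ≥ 3) are nonnegative. -/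
/-- The generalized binomial coefficient `binom(γ, k) = γ(γ−1)⋯(γ−k+1)/k!`. -/
noncomputable def genBinom (γ : ℝ) (k : ℕ) : ℝ :=
  (∏ i ∈ Finset.range k, (γ - (i : ℝ))) / (Nat.factorial k : ℝ)

/-- The coefficient `b_k(α) = binom(α,k) − (−1)^k binom((1−α)/2,k) − binom((1+α)/2,k)`. -/
noncomputable def bCoeff (α : ℝ) (k : ℕ) : ℝ :=
  genBinom α k - (-1 : ℝ) ^ k * genBinom ((1 - α) / 2) k - genBinom ((1 + α) / 2) k

open Finset Filter Topology

lemma genBinom_add_two (s : ℝ) (k : ℕ) :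
    genBinom s (k + 2) =
      (-1) ^ (k + 1) * (s * (1 - s) * ∏ i ∈ range k, ((i : ℝ) + 2 - s)) /
        (Nat.factorial (k + 2) : ℝ) := by
  unfold genBinom
  congr 1
  induction k with
  | zero => simp [prod_range_succ]; linarith
  | succ k ih =>
    rw [prod_range_succ, ih, prod_range_succ]
    push_cast
    ring

lemma prod_shift_sub_nonneg {s : ℝ} (hs : s ≤ 1) (k : ℕ) :
    0 ≤ ∏ i ∈ range k, ((i : ℝ) + 2 - s) :=
  prod_nonneg fun i _ => by have := Nat.cast_nonneg (α := ℝ) i; linarith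

lemma prod_shift_sub_anti {s t : ℝ} (hst : s ≤ t) (ht : t ≤ 1) (k : ℕ) :
    ∏ i ∈ range k, ((i : ℝ) + 2 - t) ≤ ∏ i ∈ range k, ((i : ℝ) + 2 - s) :=
  prod_le_prod (fun i _ => by have := Nat.cast_nonneg (α := ℝ) i; linarith)
    fun i _ => by linarith

/-- Convexity of `s ↦ ∏ (i + 2 - s)` along the points `β ≤ 1 - 2β ≤ 1 - β`. -/
lemma prod_shift_sub_convex {β : ℝ} (h0 : 0 ≤ β) (h1 : β ≤ 1 / 3) (k : ℕ) :
    (1 - 2 * β) * ∏ i ∈ range k, ((i : ℝ) + 2 - (1 - 2 * β)) ≤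
      β * (∏ i ∈ range k, ((i : ℝ) + 2 - β)) +
        (1 - 3 * β) * ∏ i ∈ range k, ((i : ℝ) + 2 - (1 - β)) := by
  induction k with
  | zero => simp; linarith
  | succ k ih =>
    simp only [prod_range_succ]
    have hanti := prod_shift_sub_anti (s := β) (t := 1 - β) (by linarith) (by linarith) k
    set A := ∏ i ∈ range k, ((i : ℝ) + 2 - (1 - 2 * β))
    set B := ∏ i ∈ range k, ((i : ℝ) + 2 - β)
    set C := ∏ i ∈ range k, ((i : ℝ) + 2 - (1 - β))
    have hk : (0 : ℝ) ≤ (k : ℝ) + 2 - (1 - 2 * β) := by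
      have := Nat.cast_nonneg (α := ℝ) k; linarith
    have hstep := mul_le_mul_of_nonneg_right ih hk
    have hgain : 0 ≤ β * (1 - 3 * β) * (B - C) :=
      mul_nonneg (mul_nonneg h0 (by linarith)) (by linarith)
    linarith

lemma bCoeff_nonneg_s2 {α : ℝ} (hα : (1 / 3 ≤ α ∧ α < 1) ∨ α = 0) {k : ℕ} (hk : 3 ≤ k) :
    0 ≤ bCoeff α k := by
  obtain ⟨m, rfl⟩ : ∃ m, k = m + 2 := ⟨k - 2, by omega⟩
  obtain ⟨β, rfl⟩ : ∃ β, α = 1 - 2 * β := ⟨(1 - α) / 2, by ring⟩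
  unfold bCoeff
  rw [show (1 - (1 - 2 * β)) / 2 = β by ring, show (1 + (1 - 2 * β)) / 2 = 1 - β by ring,
    genBinom_add_two, genBinom_add_two, genBinom_add_two]
  have h0 : 0 ≤ β := by rcases hα with h | h <;> linarith
  have h1 : β ≤ 1 / 2 := by rcases hα with h | h <;> linarith
  have hanti := prod_shift_sub_anti (s := β) (t := 1 - β) (by linarith) (by linarith) m
  have hC := prod_shift_sub_nonneg (s := 1 - β) (by linarith) m
  have hconv : β ≤ 1 / 3 → _ := fun h => prod_shift_sub_convex h0 h m
  have hA := prod_shift_sub_nonneg (s := 1 - 2 * β) (by linarith) m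
  set A := ∏ i ∈ range m, ((i : ℝ) + 2 - (1 - 2 * β))
  set B := ∏ i ∈ range m, ((i : ℝ) + 2 - β)
  set C := ∏ i ∈ range m, ((i : ℝ) + 2 - (1 - β))
  have hββ : 0 ≤ β * (1 - β) := mul_nonneg h0 (by linarith)
  rw [← mul_div_assoc, ← sub_div, ← sub_div]
  apply div_nonneg _ (Nat.cast_nonneg _)
  rcases Nat.even_or_odd m with hm | hm
  · rw [pow_add, pow_add, hm.neg_one_pow]
    have hBC : 0 ≤ β * (1 - β) * (B + C) := mul_nonneg hββ (by linarith)
    rcases hα with ⟨h, -⟩ | h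
    · have hstep := mul_le_mul_of_nonneg_left (hconv (by linarith)) h0
      have hgap : 0 ≤ β * ((1 - 3 * β) * (B - C)) :=
        mul_nonneg h0 (mul_nonneg (by linarith) (by linarith))
      have hββC : 0 ≤ β * β * C := mul_nonneg (mul_nonneg h0 h0) hC
      linarith
    · rw [h]
      linarith
  · rw [pow_add, pow_add, hm.neg_one_pow]
    have hαA : 0 ≤ (1 - 2 * β) * (1 - (1 - 2 * β)) * A :=
      mul_nonneg (mul_nonneg (by linarith) (by linarith)) hA
    have hBC : 0 ≤ β * (1 - β) * (B - C) := mul_nonneg hββ (by linarith)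
    linarith

lemma genBinom_eq_choose (a : ℝ) (k : ℕ) : genBinom a k = Ring.choose a k := by
  have hprod : (descPochhammer ℤ k).smeval a = ∏ i ∈ range k, (a - (i : ℝ)) := by
    induction k with
    | zero => simp
    | succ k ih =>
      simp [descPochhammer_succ_right, Polynomial.smeval_mul, Polynomial.smeval_natCast,
        prod_range_succ, ih]
  rw [Ring.choose_eq_smul, hprod, genBinom, smul_eq_mul, div_eq_inv_mul]

lemma hasSum_genBinom_mul_pow (a : ℝ) {x : ℝ} (hx : |x| < 1) :
    HasSum (fun k => genBinom a k * x ^ k) ((1 + x) ^ a) := by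
  have h := (Real.one_add_rpow_hasFPowerSeriesOnBall_zero (a := a)).hasSum (y := x)
    (by simpa [enorm_eq_nnnorm, ← NNReal.coe_lt_coe] using hx)
  simpa [binomialSeries, genBinom_eq_choose, mul_comm] using h

/-- The generating function of `bCoeff α`. -/
noncomputable def bGen (α x : ℝ) : ℝ :=
  1 - (1 - x) ^ ((1 - α) / 2) + (1 + x) ^ α - (1 + x) ^ ((1 + α) / 2)

lemma hasSum_bCoeff (α : ℝ) {x : ℝ} (hx : |x| < 1) :
    HasSum (fun k => bCoeff α (k + 3) * x ^ (k + 3)) (bGen α x - (α - 1) ^ 2 / 4 * x ^ 2) := by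
  have h1 := hasSum_genBinom_mul_pow α hx
  have h2 := hasSum_genBinom_mul_pow ((1 - α) / 2) (x := -x) (by simpa using hx)
  have h3 := hasSum_genBinom_mul_pow ((1 + α) / 2) hx
  have h := (h1.sub h2).sub h3
  rw [← hasSum_nat_add_iff' 3] at h
  rw [show bGen α x - (α - 1) ^ 2 / 4 * x ^ 2 =
      (1 + x) ^ α - (1 + -x) ^ ((1 - α) / 2) - (1 + x) ^ ((1 + α) / 2) -
        ∑ i ∈ range 3, (genBinom α i * x ^ i - genBinom ((1 - α) / 2) i * (-x) ^ i -
          genBinom ((1 + α) / 2) i * x ^ i) by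
    simp [sum_range_succ, genBinom, prod_range_succ, bGen, Nat.factorial, ← sub_eq_add_neg]
    ring]
  refine h.congr_fun fun k => ?_
  rw [bCoeff, neg_pow x]
  ring

lemma le_bGen {α : ℝ} (hb : ∀ k : ℕ, 3 ≤ k → 0 ≤ bCoeff α k) {x : ℝ} (h0 : 0 ≤ x)
    (h1 : x < 1) : (α - 1) ^ 2 / 4 * x ^ 2 ≤ bGen α x := by
  have h := (hasSum_bCoeff α (x := x) (by rwa [abs_of_nonneg h0])).nonneg
    fun k => mul_nonneg (hb _ (by omega)) (pow_nonneg h0 _)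
  linarith

lemma le_bGen_one {α : ℝ} (hα : α < 1) (hb : ∀ k : ℕ, 3 ≤ k → 0 ≤ bCoeff α k) :
    (α - 1) ^ 2 / 4 ≤ bGen α 1 := by
  have hcont : ContinuousAt (bGen α) 1 := by
    unfold bGen
    have h2 : ∀ a : ℝ, ContinuousAt (fun x : ℝ => (1 + x) ^ a) 1 := fun a =>
      (by fun_prop : ContinuousAt (fun x : ℝ => 1 + x) 1).rpow_const (Or.inl (by norm_num))
    have h3 : ContinuousAt (fun x : ℝ => (1 - x) ^ ((1 - α) / 2)) 1 :=
      (by fun_prop : ContinuousAt (fun x : ℝ => 1 - x) 1).rpow_const (Or.inr (by linarith))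
    exact ((continuousAt_const.sub h3).add (h2 _)).sub (h2 _)
  have hpoly : ContinuousAt (fun x : ℝ => (α - 1) ^ 2 / 4 * x ^ 2) 1 := by fun_prop
  have h := le_of_tendsto_of_tendsto (hpoly.tendsto.mono_left nhdsWithin_le_nhds)
    (hcont.tendsto.mono_left (nhdsWithin_le_nhds (s := Set.Iio 1)))
    (by
      filter_upwards [Ioo_mem_nhdsLT (zero_lt_one (α := ℝ))] with x hx
      exact le_bGen hb hx.1.le hx.2)
  simpa using h

/-- The supersolution potential associated with `n ↦ n ^ ((1 - α) / 2)`. -/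
lemma potential_eq (α : ℝ) {m : ℝ} (hm : 1 ≤ m) :
    m ^ α * (1 - ((m - 1) / m) ^ ((1 - α) / 2)) +
        (m + 1) ^ α * (1 - ((m + 1) / m) ^ ((1 - α) / 2)) = m ^ α * bGen α (1 / m) := by
  have hm0 : 0 < m := by linarith
  have hx : 0 < 1 + 1 / m := by positivity
  rw [bGen, show (m - 1) / m = 1 - 1 / m by field_simp,
    show (m + 1) / m = 1 + 1 / m by field_simp, show m + 1 = m * (1 + 1 / m) by field_simp,
    Real.mul_rpow hm0.le hx.le, show (1 + α) / 2 = α + (1 - α) / 2 by ring, Real.rpow_add hx]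
  ring

lemma rpow_mul_inv_pow (α : ℝ) {m : ℝ} (hm : 0 < m) (k : ℕ) :
    m ^ α * (1 / m) ^ k = m ^ (α - k) := by
  rw [Real.rpow_sub hm, Real.rpow_natCast, one_div, inv_pow, div_eq_mul_inv]

lemma hasSum_potential (α : ℝ) {m : ℝ} (hm : 1 < m) :
    HasSum (fun k : ℕ => bCoeff α (k + 3) * m ^ (α - ((k : ℝ) + 3)))
      (m ^ α * bGen α (1 / m) - (α - 1) ^ 2 / 4 * m ^ (α - 2)) := by
  have hm0 : 0 < m := by linarith
  have h := (hasSum_bCoeff α (x := 1 / m) (by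
    rw [abs_of_pos (by positivity), div_lt_one hm0]; exact hm)).mul_left (m ^ α)
  rw [mul_sub, mul_left_comm (m ^ α) ((α - 1) ^ 2 / 4), rpow_mul_inv_pow α hm0] at h
  refine h.congr_fun fun k => ?_
  rw [mul_left_comm, rpow_mul_inv_pow α hm0]
  push_cast
  rfl

/-- Weighted arithmetic-geometric estimate for one squared difference. -/
lemma sq_sub_ge_of_mul_eq_one (a b : ℝ) {r s : ℝ} (hr : 0 < r) (hrs : r * s = 1) :
    a ^ 2 * (1 - r) + b ^ 2 * (1 - s) ≤ (a - b) ^ 2 := by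
  have h : 0 ≤ r * (a - s * b) ^ 2 := by positivity
  have h' : r * (a - s * b) ^ 2 = r * a ^ 2 - 2 * (r * s) * a * b + (r * s) * s * b ^ 2 := by
    ring
  rw [h', hrs] at h
  linarith

lemma edge_estimate {α : ℝ} (hα : α < 1) {u : ℕ → ℝ} (hu : u 0 = 0) (n : ℕ) :
    ((n : ℝ) + 1) ^ α * (1 - ((n : ℝ) / (n + 1)) ^ ((1 - α) / 2)) * u (n + 1) ^ 2 +
        ((n : ℝ) + 1) ^ α * (1 - (((n : ℝ) + 1) / n) ^ ((1 - α) / 2)) * u n ^ 2 ≤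
      (u (n + 1) - u n) ^ 2 * ((n : ℝ) + 1) ^ α := by
  rcases Nat.eq_zero_or_pos n with rfl | hn
  · simp [hu, Real.zero_rpow (by linarith : (1 - α) / 2 ≠ 0)]
  · have hn' : (0 : ℝ) < n := by exact_mod_cast hn
    have hrs : ((n : ℝ) / (n + 1)) ^ ((1 - α) / 2) * (((n : ℝ) + 1) / n) ^ ((1 - α) / 2) = 1 := by
      rw [← Real.mul_rpow (by positivity) (by positivity), div_mul_div_cancel₀ (by positivity),
        div_self hn'.ne', Real.one_rpow]
    have h := mul_le_mul_of_nonneg_right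
      (sq_sub_ge_of_mul_eq_one (u (n + 1)) (u n) (by positivity) hrs)
      (by positivity : 0 ≤ ((n : ℝ) + 1) ^ α)
    linarith

lemma sum_potential_le {α : ℝ} (hα : α < 1) {u : ℕ → ℝ} (hu : u 0 = 0) {N : ℕ}
    (hN : u N = 0) :
    ∑ n ∈ range N, ((n : ℝ) + 1) ^ α * bGen α (1 / ((n : ℝ) + 1)) * u (n + 1) ^ 2 ≤
      ∑ n ∈ range N, (u (n + 1) - u n) ^ 2 * ((n : ℝ) + 1) ^ α := by
  refine le_trans (le_of_eq ?_) (sum_le_sum fun n _ => edge_estimate hα hu n)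
  set g : ℕ → ℝ := fun n =>
    ((n : ℝ) + 1) ^ α * (1 - (((n : ℝ) + 1) / n) ^ ((1 - α) / 2)) * u n ^ 2 with hg
  have hshift : ∑ n ∈ range N, g n = ∑ n ∈ range N, g (n + 1) := by
    have h1 := sum_range_succ g N
    rw [sum_range_succ'] at h1
    have h2 : g 0 = 0 := by simp [hg, hu]
    have h3 : g N = 0 := by simp [hg, hN]
    linarith
  rw [sum_add_distrib, hshift, ← sum_add_distrib]
  refine sum_congr rfl fun n _ => ?_
  have h := potential_eq α (m := (n : ℝ) + 1) (by have := Nat.cast_nonneg (α := ℝ) n; linarith)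
  rw [← h, hg]
  push_cast
  rw [add_sub_cancel_right]
  ring

/-- Improved discrete weighted Hardy inequality on `ℕ` for `α ∈ [1/3,1) ∪ {0}`,
with nonnegative remainder coefficients `b_k(α)`. -/
theorem discrete_improved_power_weight_hardy (α : ℝ)
    (hα : (1 / 3 ≤ α ∧ α < 1) ∨ α = 0) :
    (∀ k : ℕ, 3 ≤ k → 0 ≤ bCoeff α k) ∧
    ∀ u : ℕ → ℝ, (Function.support u).Finite → u 0 = 0 →
      (α - 1) ^ 2 / 4 * ∑' n : ℕ, |u (n + 1)| ^ 2 * ((n : ℝ) + 1) ^ (α - 2) +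
          ∑' k : ℕ, bCoeff α (k + 3) *
            ∑' n : ℕ, |u (n + 2)| ^ 2 * ((n : ℝ) + 2) ^ (α - ((k : ℝ) + 3)) ≤
        ∑' n : ℕ, |u (n + 1) - u n| ^ 2 * ((n : ℝ) + 1) ^ α := by
  have hb : ∀ k : ℕ, 3 ≤ k → 0 ≤ bCoeff α k := fun k hk => bCoeff_nonneg_s2 hα hk
  refine ⟨hb, fun u hfin hu => ?_⟩
  have hα1 : α < 1 := by rcases hα with h | h <;> linarith
  obtain ⟨N, hN⟩ : ∃ N, ∀ n, N ≤ n → u n = 0 := by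
    obtain ⟨M, hM⟩ := hfin.bddAbove
    refine ⟨M + 1, fun n hn => ?_⟩
    by_contra h
    have := hM h
    omega
  simp only [sq_abs]
  rw [tsum_eq_sum (s := range (N + 1)) (f := fun n : ℕ => (u (n + 1) - u n) ^ 2 * _)
      (fun n hn => by
        rw [mem_range] at hn
        simp [hN n (by omega), hN (n + 1) (by omega)]),
    tsum_eq_sum (s := range (N + 1)) (f := fun n : ℕ => u (n + 1) ^ 2 * _)
      (fun n hn => by
        rw [mem_range] at hn
        simp [hN (n + 1) (by omega)])]
  have hinner : ∀ k : ℕ, ∑' n : ℕ, u (n + 2) ^ 2 * ((n : ℝ) + 2) ^ (α - ((k : ℝ) + 3)) =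
      ∑ n ∈ range N, u (n + 2) ^ 2 * ((n : ℝ) + 2) ^ (α - ((k : ℝ) + 3)) := fun k =>
    tsum_eq_sum fun n hn => by
      rw [mem_range] at hn
      simp [hN (n + 2) (by omega)]
  have hrem := hasSum_sum (s := range N) fun n _ =>
    (hasSum_potential α (m := (n : ℝ) + 2) (by
      have := Nat.cast_nonneg (α := ℝ) n; linarith)).mul_left (u (n + 2) ^ 2)
  rw [tsum_congr fun k => (by
    rw [hinner, mul_sum]
    exact sum_congr rfl fun n _ => mul_left_comm _ _ _ :
      bCoeff α (k + 3) * ∑' n : ℕ, u (n + 2) ^ 2 * ((n : ℝ) + 2) ^ (α - ((k : ℝ) + 3)) =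
        ∑ n ∈ range N, u (n + 2) ^ 2 *
          (bCoeff α (k + 3) * ((n : ℝ) + 2) ^ (α - ((k : ℝ) + 3)))), hrem.tsum_eq]
  refine le_trans ?_ (sum_potential_le hα1 hu (hN (N + 1) (by omega)))
  rw [sum_range_succ', sum_range_succ', mul_add, mul_sum, add_right_comm, ← sum_add_distrib]
  refine add_le_add (le_of_eq (sum_congr rfl fun n _ => ?_)) ?_
  · push_cast
    rw [show (n : ℝ) + 1 + 1 = n + 2 by ring]
    ring
  · have h := mul_le_mul_of_nonneg_right (le_bGen_one hα1 hb) (sq_nonneg (u 1))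
    simpa using h
end

section
/- Let v, w : ℕ≥1 → ℝ be nonnegative functions and let φ : ℕ → ℝ be nonnegative with φ(n) > 0 for all n ≥ 1. Assume that for every n ≥ 1, (2φ(n) − φ(n−1) − φ(n+1)) v(n) − (φ(n+1) − φ(n))(v(n+1) − v(n)) ≥ w(n) φ(n). Then for every finitely supported function u : ℕ → ℝ with u(0) = 0, Σ_{n=1}^∞ |u(n) − u(n−1)|² v(n) ≥ Σ_{n=1}^∞ w(n) |u(n)|². -/
/-- Discrete Picone inequality. -/
theorem discrete_picone {a b x y : ℝ} (ha : 0 ≤ a) (hb : 0 < b) (hx : a = 0 → x = 0) :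
    (b - a) * (y ^ 2 / b - x ^ 2 / a) ≤ (y - x) ^ 2 := by
  rcases ha.eq_or_lt with rfl | ha
  · rw [hx rfl]
    field_simp
    simp
  · have key : (y - x) ^ 2 - (b - a) * (y ^ 2 / b - x ^ 2 / a) =
        (a * y - b * x) ^ 2 / (a * b) := by
      field_simp
      ring
    have : 0 ≤ (a * y - b * x) ^ 2 / (a * b) := by positivity
    linarith


/-- The discrete supersolution method on `ℕ`: if a positive function `φ` is a
supersolution in the sense of the stated pointwise inequality, then the
corresponding weighted Hardy inequality holds for all finitely supported
functions vanishing at `0`. -/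
theorem discrete_supersolution_method (v w φ : ℕ → ℝ)
    (hv : ∀ n : ℕ, 0 ≤ v (n + 1)) (hw : ∀ n : ℕ, 0 ≤ w (n + 1))
    (hφ0 : 0 ≤ φ 0) (hφ : ∀ n : ℕ, 0 < φ (n + 1))
    (hsuper : ∀ n : ℕ,
      (2 * φ (n + 1) - φ n - φ (n + 2)) * v (n + 1) -
          (φ (n + 2) - φ (n + 1)) * (v (n + 2) - v (n + 1)) ≥
        w (n + 1) * φ (n + 1))
    (u : ℕ → ℝ) (hu : (Function.support u).Finite) (h0 : u 0 = 0) :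
    ∑' n : ℕ, w (n + 1) * |u (n + 1)| ^ 2 ≤
      ∑' n : ℕ, |u (n + 1) - u n| ^ 2 * v (n + 1) := by
  have partial_sum_le : ∀ N : ℕ, ∑ n ∈ Finset.range N, w (n + 1) * |u (n + 1)| ^ 2 ≤
      ∑ n ∈ Finset.range N, |u (n + 1) - u n| ^ 2 * v (n + 1) -
        (φ (N + 1) - φ N) * v (N + 1) * (u N ^ 2 / φ N) := by
    intro N
    induction N with
    | zero => simp [h0]
    | succ N ih =>
      rw [Finset.sum_range_succ, Finset.sum_range_succ, sq_abs, sq_abs]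
      have hpos := hφ N
      have hN : 0 ≤ φ N := by
        cases N with
        | zero => exact hφ0
        | succ k => exact (hφ k).le
      have hzero : φ N = 0 → u N = 0 := by
        cases N with
        | zero => exact fun _ => h0
        | succ k => exact fun h => absurd h (hφ k).ne'
      have picone := mul_le_mul_of_nonneg_right
        (discrete_picone (y := u (N + 1)) hN hpos hzero) (hv N)
      have super := mul_le_mul_of_nonneg_right (hsuper N)
        (by positivity : 0 ≤ u (N + 1) ^ 2 / φ (N + 1))
      have cancel : w (N + 1) * φ (N + 1) * (u (N + 1) ^ 2 / φ (N + 1)) =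
          w (N + 1) * u (N + 1) ^ 2 := by
        field_simp
      rw [cancel] at super
      linarith
  obtain ⟨M, hM⟩ := hu.bddAbove
  have hu_zero : ∀ n, M < n → u n = 0 := fun n hn => by
    by_contra h
    exact absurd (hM h) (not_le.mpr hn)
  have vanish : ∀ n ∉ Finset.range (M + 1), u n = 0 ∧ u (n + 1) = 0 := fun n hn => by
    rw [Finset.mem_range, not_lt] at hn
    exact ⟨hu_zero n (by omega), hu_zero (n + 1) (by omega)⟩
  rw [tsum_eq_sum (s := Finset.range (M + 1)) (fun n hn => by simp [vanish n hn]),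
    tsum_eq_sum (s := Finset.range (M + 1)) (fun n hn => by simp [vanish n hn])]
  simpa [hu_zero (M + 1) (by omega)] using partial_sum_le (M + 1)
end

section
/- For every α ∈ [1/3,1) ∪ {0} and every integer k ≥ 3, the quantity b_k(α) := binom(α,k) − (−1)^k binom((1−α)/2, k) − binom((1+α)/2, k) is nonnegative. -/
/-- The shifted product `(1 + x)(2 + x)⋯(n + x)`. -/
noncomputable def shiftedProd (x : ℝ) (n : ℕ) : ℝ :=
  ∏ j ∈ Finset.range n, ((j : ℝ) + 1 + x)

theorem shiftedProd_zero (x : ℝ) : shiftedProd x 0 = 1 := by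
  simp [shiftedProd]

theorem shiftedProd_succ (x : ℝ) (n : ℕ) :
    shiftedProd x (n + 1) = shiftedProd x n * ((n : ℝ) + 1 + x) := by
  simp [shiftedProd, Finset.prod_range_succ]

theorem shiftedProd_pos {x : ℝ} (hx : -1 < x) (n : ℕ) : 0 < shiftedProd x n :=
  Finset.prod_pos fun j _ => by
    have : (0 : ℝ) ≤ j := j.cast_nonneg
    linarith

theorem shiftedProd_le_of_le {x y : ℝ} (hx : -1 < x) (hxy : x ≤ y) (n : ℕ) :
    shiftedProd x n ≤ shiftedProd y n :=
  Finset.prod_le_prod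
    (fun j _ => by
      have : (0 : ℝ) ≤ j := j.cast_nonneg
      linarith)
    (fun j _ => by linarith)

theorem genBinom_succ_eq (x : ℝ) (n : ℕ) :
    genBinom x (n + 1) = (-1) ^ n * (x * shiftedProd (-x) n) / ((n + 1).factorial : ℝ) := by
  have h : ∏ i ∈ Finset.range (n + 1), (x - (i : ℝ)) = (-1) ^ n * (x * shiftedProd (-x) n) := by
    induction n with
    | zero => simp [shiftedProd_zero]
    | succ n ih =>
      rw [Finset.prod_range_succ, ih, shiftedProd_succ]
      push_cast
      ring
  rw [genBinom, h]

theorem genBinom_one_sub_eq (x : ℝ) (n : ℕ) :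
    genBinom (1 - x) (n + 2) =
      (-1) ^ (n + 1) * (x * ((1 - x) * shiftedProd x n)) / ((n + 2).factorial : ℝ) := by
  have h : ∏ i ∈ Finset.range (n + 2), (1 - x - (i : ℝ)) =
      (-1) ^ (n + 1) * (x * ((1 - x) * shiftedProd x n)) := by
    induction n with
    | zero => simp [shiftedProd_zero, Finset.prod_range_succ]; ring
    | succ n ih =>
      rw [Finset.prod_range_succ, ih, shiftedProd_succ]
      push_cast
      ring
  rw [genBinom, h]

theorem shiftedProd_two_mul_le_neg {a : ℝ} (h₀ : 0 < a) (h₁ : a ≤ 1 / 3) {n : ℕ} (hn : 5 ≤ n) :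
    2 * (1 - 2 * a) * shiftedProd (2 * a) n ≤ shiftedProd (-a) (n + 1) := by
  induction n, hn using Nat.le_induction with
  | base =>
    have hq : 0 ≤ 480 - 940 * a - 804 * a ^ 2 - 907 * a ^ 3 - 306 * a ^ 4 - 43 * a ^ 5 := by
      have h2 : a ^ 2 ≤ (1 / 3) ^ 2 := by gcongr
      have h3 : a ^ 3 ≤ (1 / 3) ^ 3 := by gcongr
      have h4 : a ^ 4 ≤ (1 / 3) ^ 4 := by gcongr
      have h5 : a ^ 5 ≤ (1 / 3) ^ 5 := by gcongr
      norm_num at h2 h3 h4 h5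
      linarith
    have := mul_nonneg (by linarith : (0 : ℝ) ≤ 1 - 3 * a) hq
    simp only [shiftedProd_succ, shiftedProd_zero]
    push_cast
    linarith
  | succ n _ ih =>
    rw [shiftedProd_succ (2 * a), shiftedProd_succ (-a) (n + 1), ← mul_assoc]
    have hn : (0 : ℝ) ≤ n := n.cast_nonneg
    refine mul_le_mul ih ?_ (by linarith) (shiftedProd_pos (by linarith) _).le
    push_cast
    linarith

theorem shiftedProd_two_mul_le_add {a : ℝ} (h₀ : 0 < a) (h₁ : a ≤ 1 / 3) {n : ℕ}
    (hn : Even n) (hn₀ : n ≠ 0) :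
    2 * (1 - 2 * a) * shiftedProd (2 * a) n ≤
      (1 - a) * shiftedProd a n + shiftedProd (-a) (n + 1) := by
  rcases le_or_gt 5 n with h | h
  · have hA := mul_pos (by linarith : 0 < 1 - a) (shiftedProd_pos (by linarith : -1 < a) n)
    linarith [shiftedProd_two_mul_le_neg h₀ h₁ h]
  · obtain rfl | rfl : n = 2 ∨ n = 4 := by
      obtain ⟨m, rfl⟩ := hn
      omega
    · simp only [shiftedProd_succ, shiftedProd_zero]
      push_cast
      nlinarith [sq_nonneg (a - 1 / 3), pow_pos h₀ 3]
    · have h3 := pow_pos h₀ 3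
      have h4 := pow_pos h₀ 4
      have h5 := pow_pos h₀ 5
      simp only [shiftedProd_succ, shiftedProd_zero]
      push_cast
      nlinarith [sq_nonneg (a - 1 / 3)]

theorem one_sub_mul_shiftedProd_le {a : ℝ} (h₀ : 0 < a) (h₁ : a ≤ 1 / 3) (n : ℕ) :
    (1 - a) * shiftedProd a n ≤ 2 * (1 - 2 * a) * shiftedProd (2 * a) n :=
  mul_le_mul (by linarith) (shiftedProd_le_of_le (by linarith) (by linarith) n)
    (shiftedProd_pos (by linarith) n).le (by linarith)

/-- For `α ∈ [1/3,1) ∪ {0}` and every integer `k ≥ 3`, the coefficient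
`b_k(α) = binom(α,k) − (−1)^k binom((1−α)/2,k) − binom((1+α)/2,k)` is nonnegative. -/
theorem bCoeff_nonneg (α : ℝ) (hα : (1 / 3 ≤ α ∧ α < 1) ∨ α = 0) (k : ℕ) (hk : 3 ≤ k) :
    0 ≤ genBinom α k - (-1 : ℝ) ^ k * genBinom ((1 - α) / 2) k - genBinom ((1 + α) / 2) k := by
  obtain ⟨n, rfl⟩ : ∃ n, k = n + 2 := ⟨k - 2, by omega⟩
  obtain ⟨a, rfl⟩ : ∃ a, α = 1 - 2 * a := ⟨(1 - α) / 2, by ring⟩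
  have e₁ : (1 - (1 - 2 * a)) / 2 = a := by ring
  have e₂ : (1 + (1 - 2 * a)) / 2 = 1 - a := by ring
  have hf : (0 : ℝ) < ((n + 2).factorial : ℝ) := by exact_mod_cast Nat.factorial_pos _
  rw [e₁, e₂, genBinom_one_sub_eq, genBinom_one_sub_eq, genBinom_succ_eq, mul_div_assoc',
    ← sub_div, ← sub_div]
  refine div_nonneg ?_ hf.le
  have ha : 0 < a := by rcases hα with h | h <;> linarith
  have hB : 0 < shiftedProd (-a) (n + 1) :=
    shiftedProd_pos (by rcases hα with h | h <;> linarith) _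
  have hA : 0 < (1 - a) * shiftedProd a n :=
    mul_pos (by rcases hα with h | h <;> linarith) (shiftedProd_pos (by linarith) n)
  rcases Nat.even_or_odd n with hn | hn
  · have key : 2 * (1 - 2 * a) * shiftedProd (2 * a) n ≤
        (1 - a) * shiftedProd a n + shiftedProd (-a) (n + 1) := by
      rcases hα with h | h
      · exact shiftedProd_two_mul_le_add ha (by linarith) hn (by omega)
      · rw [h]
        linarith
    simp only [pow_succ, hn.neg_one_pow]
    linarith [mul_le_mul_of_nonneg_left key ha.le]
  · have key : (1 - a) * shiftedProd a n ≤
        2 * (1 - 2 * a) * shiftedProd (2 * a) n + shiftedProd (-a) (n + 1) := by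
      rcases hα with h | h
      · linarith [one_sub_mul_shiftedProd_le ha (by linarith) n]
      · obtain rfl : a = 1 / 2 := by linarith
        have : shiftedProd (-(1 / 2)) (n + 1) = (1 - 1 / 2) * shiftedProd (1 / 2) n := by
          rw [shiftedProd, Finset.prod_range_succ', mul_comm]
          norm_num
          exact Finset.prod_congr rfl fun j _ => by ring
        rw [h, this]
        linarith
    simp only [pow_succ, hn.neg_one_pow]
    linarith [mul_le_mul_of_nonneg_left key ha.le]
end

section
/- Let k ≥ 1 be an integer. For every finitely supported function u : ℤ → ℝ with u(0) = 0, Σ_{n∈ℤ} |u(n) − u(n−1)|² (n − 1/2)^{2k} ≥ Σ_{i=1}^{k} γ_i^k Σ_{n∈ℤ} |u(n)|² n^{2k−2i} + 2^{−2k−2} Σ_{n∈ℤ, n≠0} |u(n)|²/n², where γ_i^k := 4^{−i} (2·C(2k,2i) − 2·C(k,i) + C(k,i−1)) and C(a,b) denotes the usual binomial coefficient of natural numbers. -/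
/-- Splitting a sum over `0, …, 2k` into its even- and odd-indexed terms. -/
theorem sum_range_two_mul_add_one_eq_even_add_odd {M : Type*} [AddCommMonoid M] (f : ℕ → M)
    (k : ℕ) :
    ∑ j ∈ Finset.range (2 * k + 1), f j =
      ∑ i ∈ Finset.range (k + 1), f (2 * i) + ∑ i ∈ Finset.range k, f (2 * i + 1) := by
  induction k with
  | zero => simp
  | succ k ih =>
    rw [show 2 * (k + 1) + 1 = 2 * k + 1 + 1 + 1 by ring, Finset.sum_range_succ,
      Finset.sum_range_succ, ih, Finset.sum_range_succ _ (k + 1),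
      Finset.sum_range_succ (fun i => f (2 * i + 1)) k, show 2 * (k + 1) = 2 * k + 1 + 1 by ring]
    abel

/-- Twice the even part of the binomial expansion of `(x + y) ^ (2 * k)`. -/
theorem add_pow_two_mul_add_sub_pow_two_mul {R : Type*} [CommRing R] (x y : R) (k : ℕ) :
    (x + y) ^ (2 * k) + (x - y) ^ (2 * k) =
      ∑ i ∈ Finset.range (k + 1),
        2 * ((Nat.choose (2 * k) (2 * i) : R) * (y ^ 2) ^ i * x ^ (2 * k - 2 * i)) := by
  rw [add_comm x y, sub_eq_neg_add x y, add_pow, add_pow, ← Finset.sum_add_distrib,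
    sum_range_two_mul_add_one_eq_even_add_odd]
  have hodd : ∀ i ∈ Finset.range k,
      y ^ (2 * i + 1) * x ^ (2 * k - (2 * i + 1)) * (Nat.choose (2 * k) (2 * i + 1) : R) +
        (-y) ^ (2 * i + 1) * x ^ (2 * k - (2 * i + 1)) *
          (Nat.choose (2 * k) (2 * i + 1) : R) = 0 := by
    intro i _
    rw [Odd.neg_pow ⟨i, rfl⟩]
    ring
  rw [Finset.sum_eq_zero hodd, add_zero]
  refine Finset.sum_congr rfl fun i _ => ?_
  rw [Even.neg_pow (even_two_mul i), pow_mul]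
  ring

/-- Closed form of the remainder weight in the improved weighted Hardy inequality. -/
theorem sum_hardy_coeff_mul_pow_add (k : ℕ) {x : ℝ} (hx : x ≠ 0) :
    ∑ i ∈ Finset.Icc 1 k,
        ((4 : ℝ) ^ i)⁻¹ *
          (2 * (Nat.choose (2 * k) (2 * i) : ℝ) - 2 * (Nat.choose k i : ℝ) +
            (Nat.choose k (i - 1) : ℝ)) * x ^ (2 * k - 2 * i) +
      ((2 : ℝ) ^ (2 * k + 2))⁻¹ * (1 / x ^ 2) =
    (x + 1 / 2) ^ (2 * k) + (x - 1 / 2) ^ (2 * k) -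
      (2 - 1 / (4 * x ^ 2)) * (x ^ 2 + 1 / 4) ^ k := by
  have hP : (x ^ 2 + 1 / 4) ^ k =
      ∑ i ∈ Finset.range (k + 1),
        (Nat.choose k i : ℝ) * ((4 : ℝ) ^ i)⁻¹ * x ^ (2 * k - 2 * i) := by
    rw [add_comm, add_pow]
    refine Finset.sum_congr rfl fun i _ => ?_
    rw [← pow_mul, Nat.mul_sub, one_div, inv_pow]
    ring
  have hI : Finset.Icc 1 k = Finset.Ico 1 (k + 1) := by ext; simp
  have hE := add_pow_two_mul_add_sub_pow_two_mul x (1 / 2) k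
  have hQ : 1 / (4 * x ^ 2) * (x ^ 2 + 1 / 4) ^ k =
      ∑ i ∈ Finset.range k,
        ((4 : ℝ) ^ (i + 1))⁻¹ * (Nat.choose k i : ℝ) * x ^ (2 * k - 2 * (i + 1)) +
      ((2 : ℝ) ^ (2 * k + 2))⁻¹ * (1 / x ^ 2) := by
    rw [hP, Finset.sum_range_succ, mul_add, Finset.mul_sum]
    congr 1
    · refine Finset.sum_congr rfl fun i hi => ?_
      have hi' := Finset.mem_range.1 hi
      rw [show 2 * k - 2 * i = 2 * k - 2 * (i + 1) + 2 by omega, pow_add, pow_succ]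
      field_simp
      ring
    · rw [show 2 * k + 2 = 2 * (k + 1) by ring, pow_mul]
      norm_num [pow_succ]
      field_simp
  rw [sub_mul, hQ, hE, hP, hI, Finset.sum_Ico_eq_sum_range, Nat.add_sub_cancel,
    Finset.sum_range_succ', Finset.sum_range_succ', mul_add, Finset.mul_sum]
  have key : ∀ i ∈ Finset.range k,
      ((4 : ℝ) ^ (1 + i))⁻¹ *
          (2 * (Nat.choose (2 * k) (2 * (1 + i)) : ℝ) - 2 * (Nat.choose k (1 + i) : ℝ) +
            (Nat.choose k (1 + i - 1) : ℝ)) * x ^ (2 * k - 2 * (1 + i)) =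
      2 * ((Nat.choose (2 * k) (2 * (i + 1)) : ℝ) * ((1 / 2 : ℝ) ^ 2) ^ (i + 1) *
          x ^ (2 * k - 2 * (i + 1))) -
        2 * ((Nat.choose k (i + 1) : ℝ) * ((4 : ℝ) ^ (i + 1))⁻¹ * x ^ (2 * k - 2 * (i + 1))) +
        ((4 : ℝ) ^ (i + 1))⁻¹ * (Nat.choose k i : ℝ) * x ^ (2 * k - 2 * (i + 1)) := by
    intro i _
    rw [add_comm 1 i, Nat.add_sub_cancel, show ((1 / 2 : ℝ) ^ 2) = 4⁻¹ by norm_num, inv_pow]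
    ring
  rw [Finset.sum_congr rfl key, Finset.sum_add_distrib, Finset.sum_sub_distrib]
  simp
  ring

/-- A quantitative form of the concavity of the square root around `1`. -/
theorem sqrt_one_sub_add_sqrt_one_add_le {x : ℝ} (h1 : -1 ≤ x) (h2 : x ≤ 1) :
    √(1 - x) + √(1 + x) ≤ 2 - x ^ 2 / 4 := by
  have hx : x ^ 2 ≤ 1 := by nlinarith
  have hprod : √(1 - x) * √(1 + x) ≤ 1 - x ^ 2 / 2 := by
    rw [← Real.sqrt_mul (by linarith)]
    apply Real.sqrt_le_iff.2
    constructor <;> nlinarith [sq_nonneg (x ^ 2)]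
  refine le_of_sq_le_sq ?_ ?_
  · have e1 := Real.sq_sqrt (show 0 ≤ 1 - x by linarith)
    have e2 := Real.sq_sqrt (show 0 ≤ 1 + x by linarith)
    nlinarith [sq_nonneg (x ^ 2)]
  · linarith

/-- Weighted arithmetic–geometric mean inequality: if `c² ≤ p q` and `a b = 1`, then
`2 c s t ≤ s² p a + t² q b`. -/
theorem two_mul_mul_mul_le_of_sq_le {s t c p q a b : ℝ} (hp : 0 ≤ p) (hq : 0 ≤ q)
    (ha : 0 ≤ a) (hb : 0 ≤ b) (hab : a * b = 1) (hc : c ^ 2 ≤ p * q) :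
    2 * (c * (s * t)) ≤ s ^ 2 * (p * a) + t ^ 2 * (q * b) := by
  have hX : 0 ≤ s ^ 2 * (p * a) := by positivity
  have hY : 0 ≤ t ^ 2 * (q * b) := by positivity
  have hXY : (c * (s * t)) ^ 2 ≤ s ^ 2 * (p * a) * (t ^ 2 * (q * b)) := by
    calc (c * (s * t)) ^ 2 = c ^ 2 * (s * t) ^ 2 := by ring
      _ ≤ p * q * (s * t) ^ 2 := by gcongr
      _ = s ^ 2 * (p * a) * (t ^ 2 * (q * b)) := by
        linear_combination (-(p * q * (s * t) ^ 2)) * hab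
  refine le_of_sq_le_sq ?_ ?_
  · nlinarith [sq_nonneg (s ^ 2 * (p * a) - t ^ 2 * (q * b))]
  · linarith

/-- Edgewise bound on the cross term of the weighted Dirichlet form. -/
theorem two_mul_hardy_cross_term_le (k : ℕ) (u : ℤ → ℝ) (h0 : u 0 = 0) (n : ℤ) :
    2 * (((n : ℝ) - 1 / 2) ^ (2 * k) * (u n * u (n - 1))) ≤
      u n ^ 2 * (((n : ℝ) ^ 2 + 1 / 4) ^ k * √(1 - 1 / (n : ℝ))) +
      u (n - 1) ^ 2 * ((((n - 1 : ℤ) : ℝ) ^ 2 + 1 / 4) ^ k * √(1 + 1 / ((n - 1 : ℤ) : ℝ))) := by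
  by_cases hn : u n * u (n - 1) = 0
  · rw [hn]
    simp only [mul_zero]
    positivity
  have hn0 : n ≠ 0 := by rintro rfl; simp [h0] at hn
  have hn1 : n - 1 ≠ 0 := by intro h; simp [h, h0] at hn
  have hr0 : (n : ℝ) ≠ 0 := by exact_mod_cast hn0
  have hr1 : (n : ℝ) - 1 ≠ 0 := by exact_mod_cast hn1
  refine two_mul_mul_mul_le_of_sq_le (by positivity) (by positivity) (Real.sqrt_nonneg _)
    (Real.sqrt_nonneg _) ?_ ?_
  · have hpos : 0 ≤ 1 - 1 / (n : ℝ) := by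
      rcases lt_or_gt_of_ne hn0 with h | h
      · have : (n : ℝ) < 0 := by exact_mod_cast h
        have := one_div_neg.2 this
        linarith
      · have : (1 : ℝ) ≤ n := by exact_mod_cast h
        have := (div_le_one (by linarith)).2 this
        linarith
    rw [← Real.sqrt_mul hpos, Real.sqrt_eq_one]
    push_cast
    field_simp
    ring
  · rw [← pow_mul, mul_comm (2 * k) 2, ← mul_assoc, pow_mul, ← mul_pow]
    refine pow_le_pow_left₀ ((even_two_mul 2).pow_nonneg _) ?_ k
    push_cast
    nlinarith


/-- Improved weighted Hardy inequality on `ℤ` with weight `(n − 1/2)^{2k}`,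
with remainder coefficients `γ_i^k = 4^{−i}(2 C(2k,2i) − 2 C(k,i) + C(k,i−1))`. -/
theorem discrete_improved_weighted_hardy_int (k : ℕ) (hk : 1 ≤ k) (u : ℤ → ℝ)
    (hu : (Function.support u).Finite) (h0 : u 0 = 0) :
    ∑ i ∈ Finset.Icc 1 k,
        ((4 : ℝ) ^ i)⁻¹ *
          (2 * (Nat.choose (2 * k) (2 * i) : ℝ) - 2 * (Nat.choose k i : ℝ) +
            (Nat.choose k (i - 1) : ℝ)) *
          ∑' n : ℤ, |u n| ^ 2 * (n : ℝ) ^ (2 * k - 2 * i) +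
      ((2 : ℝ) ^ (2 * k + 2))⁻¹ *
        ∑' n : {m : ℤ // m ≠ 0}, |u (n : ℤ)| ^ 2 / ((n : ℤ) : ℝ) ^ 2 ≤
      ∑' n : ℤ, |u n - u (n - 1)| ^ 2 * ((n : ℝ) - 1 / 2) ^ (2 * k) := by
  set a : ℤ → ℝ := fun n => ((n : ℝ) - 1 / 2) ^ (2 * k) with ha
  set P : ℤ → ℝ := fun n => ((n : ℝ) ^ 2 + 1 / 4) ^ k with hP
  have hs : ∀ w : ℤ → ℝ, Summable fun n => u n ^ 2 * w n := fun w =>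
    summable_of_hasFiniteSupport <| hu.subset fun n hn => by
      rw [Function.mem_support] at hn ⊢
      contrapose! hn
      simp [hn]
  set A : ℤ → ℝ := fun n => u n ^ 2 * (a n - P n * √(1 - 1 / (n : ℝ))) with hA
  set B : ℤ → ℝ := fun n => u n ^ 2 * (a (n + 1) - P n * √(1 + 1 / (n : ℝ))) with hB
  set T : ℤ → ℝ := fun n =>
    u n ^ 2 * (a (n + 1) + a n - (2 - 1 / (4 * (n : ℝ) ^ 2)) * P n) with hT
  have hsA : Summable A := hs _
  have hsB : Summable B := hs _
  have hsB' : Summable fun n => B (n - 1) := (Equiv.subRight (1 : ℤ)).summable_iff.2 hsB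
  have hedge : ∀ n, A n + B (n - 1) ≤ |u n - u (n - 1)| ^ 2 * a n := by
    intro n
    have h := two_mul_hardy_cross_term_le k u h0 n
    simp only [hA, hB, sub_add_cancel, sq_abs]
    simp only [ha, hP]
    linarith
  have hvertex : ∀ n, T n ≤ A n + B n := by
    intro n
    rcases eq_or_ne n 0 with rfl | hn
    · simp [hT, hA, hB, h0]
    have hr : 1 ≤ |(n : ℝ)| := by exact_mod_cast Int.one_le_abs hn
    have hx : |1 / (n : ℝ)| ≤ 1 := by
      rw [abs_div, abs_one]
      exact (div_le_one (by linarith)).2 hr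
    have h := sqrt_one_sub_add_sqrt_one_add_le (abs_le.1 hx).1 (abs_le.1 hx).2
    have hPn : 0 ≤ P n := by positivity
    simp only [hT, hA, hB, ← mul_add]
    refine mul_le_mul_of_nonneg_left ?_ (sq_nonneg _)
    have h' : √(1 - 1 / (n : ℝ)) + √(1 + 1 / (n : ℝ)) ≤ 2 - 1 / (4 * (n : ℝ) ^ 2) := by
      refine h.trans (le_of_eq ?_)
      rw [div_pow, one_pow, div_div, mul_comm]
    nlinarith [mul_le_mul_of_nonneg_left h' hPn]
  have hsE : Summable fun n => |u n - u (n - 1)| ^ 2 * a n := by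
    have hfin : (Function.support u ∪ (fun n => n - 1) ⁻¹' Function.support u).Finite :=
      hu.union (hu.preimage (sub_left_injective.injOn))
    refine summable_of_hasFiniteSupport <| hfin.subset fun n hn => ?_
    contrapose! hn
    simp only [Set.mem_union, Set.mem_preimage, Function.mem_support, not_or, not_not] at hn ⊢
    simp [hn.1, hn.2]
  have hlhs : ∑ i ∈ Finset.Icc 1 k,
        ((4 : ℝ) ^ i)⁻¹ *
          (2 * (Nat.choose (2 * k) (2 * i) : ℝ) - 2 * (Nat.choose k i : ℝ) +
            (Nat.choose k (i - 1) : ℝ)) *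
          ∑' n : ℤ, |u n| ^ 2 * (n : ℝ) ^ (2 * k - 2 * i) +
      ((2 : ℝ) ^ (2 * k + 2))⁻¹ *
        ∑' n : {m : ℤ // m ≠ 0}, |u (n : ℤ)| ^ 2 / ((n : ℤ) : ℝ) ^ 2 = ∑' n, T n := by
    have hsub : ∑' n : {m : ℤ // m ≠ 0}, |u (n : ℤ)| ^ 2 / ((n : ℤ) : ℝ) ^ 2 =
        ∑' n : ℤ, u n ^ 2 * (1 / (n : ℝ) ^ 2) := by
      rw [← tsum_subtype_eq_of_support_subset (s := {m : ℤ | m ≠ 0})]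
      · refine tsum_congr fun n => ?_
        rw [sq_abs, mul_one_div]
      · rintro n hn rfl
        simp [h0] at hn
    simp only [sq_abs] at hsub ⊢
    rw [hsub, ← tsum_mul_left]
    simp only [← tsum_mul_left]
    rw [← Summable.tsum_finsetSum fun i _ => (hs _).mul_left _,
      ← Summable.tsum_add (summable_sum fun i _ => (hs _).mul_left _) ((hs _).mul_left _)]
    refine tsum_congr fun n => ?_
    rcases eq_or_ne n 0 with rfl | hn
    · simp [hT, h0]
    have h := sum_hardy_coeff_mul_pow_add k (x := (n : ℝ)) (by exact_mod_cast hn)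
    have ha1 : a (n + 1) = ((n : ℝ) + 1 / 2) ^ (2 * k) := by
      simp only [ha]
      push_cast
      ring
    simp only [hT, ha1]
    simp only [ha, hP]
    rw [← h, mul_add, Finset.mul_sum]
    congr 1
    · exact Finset.sum_congr rfl fun i _ => by ring
    · ring
  rw [hlhs]
  calc ∑' n, T n ≤ ∑' n, (A n + B n) := Summable.tsum_le_tsum hvertex (hs _) (hsA.add hsB)
    _ = ∑' n, A n + ∑' n, B n := hsA.tsum_add hsB
    _ = ∑' n, A n + ∑' n, B (n - 1) := by rw [← (Equiv.subRight (1 : ℤ)).tsum_eq B]; rfl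
    _ = ∑' n, (A n + B (n - 1)) := (hsA.tsum_add hsB').symm
    _ ≤ _ := Summable.tsum_le_tsum hedge (hsA.add hsB') hsE
end

section
/- Let k ≥ 1 be an integer. For every finitely supported function u : ℤ → ℝ with u(0) = 0, Σ_{n∈ℤ} |u(n) − u(n−1)|² (n − 1/2)^{2k} ≥ ((2k−1)²/4) Σ_{n∈ℤ} |u(n)|² n^{2k−2}. Moreover the constant (2k−1)²/4 is sharp: if C ∈ ℝ is such that Σ_{n∈ℤ} |u(n) − u(n−1)|² (n − 1/2)^{2k} ≥ C Σ_{n∈ℤ} |u(n)|² n^{2k−2} for every finitely supported u : ℤ → ℝ with u(0) = 0, then C ≤ (2k−1)²/4. -/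
theorem two_mul_rpow_le_add {p x h : ℝ} (hp : p ≤ 0 ∨ 1 ≤ p) (h0 : 0 ≤ h) (hx : h < x) :
    2 * x ^ p ≤ (x + h) ^ p + (x - h) ^ p := by
  have h1 : 0 < x + h := by linarith
  have h2 : 0 < x - h := by linarith
  have hx0 : 0 < x := by linarith
  rcases hp with hp | hp
  · have hsq : ∀ y : ℝ, 0 < y → (y ^ (p / 2)) ^ 2 = y ^ p := fun y hy => by
      rw [← Real.rpow_mul_natCast hy.le]; congr 1; push_cast; ring
    have hle : x ^ p ≤ (x + h) ^ (p / 2) * (x - h) ^ (p / 2) := by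
      rw [← Real.mul_rpow h1.le h2.le, ← hsq x hx0, pow_two, ← Real.mul_rpow hx0.le hx0.le]
      exact Real.rpow_le_rpow_of_nonpos (mul_pos h1 h2) (by nlinarith) (by linarith)
    have := two_mul_le_add_sq ((x + h) ^ (p / 2)) ((x - h) ^ (p / 2))
    rw [hsq _ h1, hsq _ h2] at this
    linarith
  · have := (convexOn_rpow hp).2 (Set.mem_Ici.2 h1.le) (Set.mem_Ici.2 h2.le)
      (by norm_num : (0 : ℝ) ≤ 1 / 2) (by norm_num : (0 : ℝ) ≤ 1 / 2) (by norm_num)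
    simp only [smul_eq_mul] at this
    rw [show 1 / 2 * (x + h) + 1 / 2 * (x - h) = x by ring] at this
    linarith

theorem two_mul_mul_sq_mul_rpow_le {r x h : ℝ} (hr : r ≤ 1 ∨ 2 ≤ r) (h0 : 0 ≤ h) (hx : h < x) :
    2 * h * (r ^ 2 * x ^ (r - 1)) ≤ r * ((x + h) ^ r - (x - h) ^ r) := by
  let G : ℝ → ℝ := fun t => r * ((x + t) ^ r - (x - t) ^ r) - 2 * t * (r ^ 2 * x ^ (r - 1))
  have hG : ∀ t ∈ Set.Icc 0 h, HasDerivAt G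
      (r ^ 2 * ((x + t) ^ (r - 1) + (x - t) ^ (r - 1) - 2 * x ^ (r - 1))) t := by
    intro t ht
    have h1 : HasDerivAt (fun t : ℝ => x + t) 1 t := (hasDerivAt_id t).const_add x
    have h2 : HasDerivAt (fun t : ℝ => x - t) (-1) t := (hasDerivAt_id t).const_sub x
    have h3 := h1.rpow_const (p := r) (Or.inl (by linarith [ht.1] : x + t ≠ 0))
    have h4 := h2.rpow_const (p := r) (Or.inl (by linarith [ht.2] : x - t ≠ 0))
    have h5 := ((h3.sub h4).const_mul r).sub
      (((hasDerivAt_id t).const_mul 2).mul_const (r ^ 2 * x ^ (r - 1)))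
    refine h5.congr_deriv ?_
    ring
  have hmono : MonotoneOn G (Set.Icc 0 h) := by
    refine monotoneOn_of_deriv_nonneg (convex_Icc 0 h)
      (fun t ht => (hG t ht).continuousAt.continuousWithinAt)
      (fun t ht => (hG t (interior_subset ht)).differentiableAt.differentiableWithinAt) ?_
    intro t ht
    have ht' := interior_subset ht
    rw [(hG t ht').deriv]
    have := two_mul_rpow_le_add (p := r - 1) (x := x) (h := t)
      (hr.imp (fun _ => by linarith) (fun _ => by linarith)) ht'.1 (by linarith [ht'.2])
    exact mul_nonneg (sq_nonneg r) (by linarith)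
  have := hmono (Set.left_mem_Icc.2 h0) (Set.right_mem_Icc.2 h0) h0
  simp only [G, add_zero, sub_zero, sub_self, mul_zero, zero_mul] at this
  linarith

/-- A positive flux, bounded by `x ^ s` with `s = j + 1 / 2`, whose unit increments dominate
`s * n ^ (s - 1)`. The power itself works when `s ≤ 1` or `2 ≤ s`; for `s = 3 / 2` it needs a
lower order correction. -/
theorem exists_flux (j : ℕ) : ∃ F : ℝ → ℝ,
    (∀ x, 1 / 2 ≤ x → 0 < F x ∧ F x ≤ x ^ ((j : ℝ) + 1 / 2)) ∧
    ∀ n : ℝ, 1 ≤ n →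
      ((j : ℝ) + 1 / 2) * n ^ ((j : ℝ) - 1 / 2) ≤ F (n + 1 / 2) - F (n - 1 / 2) := by
  rcases eq_or_ne j 1 with rfl | hj
  · refine ⟨fun x => x * √x - 1 / 32 / √x, fun x hx => ?_, fun n hn => ?_⟩
    · have hx0 : 0 < x := by linarith
      have hs : 0 < √x := Real.sqrt_pos.2 hx0
      have hss : √x ^ 2 = x := Real.sq_sqrt hx0.le
      beta_reduce
      constructor
      · have : x * √x - 1 / 32 / √x = (x ^ 2 - 1 / 32) / √x := by
          field_simp
          rw [hss]; ring
        rw [this]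
        exact div_pos (by nlinarith) hs
      · have : x ^ (((1 : ℕ) : ℝ) + 1 / 2) = x * √x := by
          rw [Real.rpow_add hx0, Real.sqrt_eq_rpow]; simp
        rw [this]
        have : 0 < 1 / 32 / √x := by positivity
        linarith
    · have hn0 : 0 < n := by linarith
      have e : n ^ (((1 : ℕ) : ℝ) - 1 / 2) = √n := by
        rw [Real.sqrt_eq_rpow]; norm_num
      rw [e]
      obtain ⟨a, ha, ha2⟩ : ∃ a, 0 < a ∧ a ^ 2 = n + 1 / 2 :=
        ⟨√(n + 1 / 2), Real.sqrt_pos.2 (by linarith), Real.sq_sqrt (by linarith)⟩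
      obtain ⟨b, hb, hb2⟩ : ∃ b, 0 < b ∧ b ^ 2 = n - 1 / 2 :=
        ⟨√(n - 1 / 2), Real.sqrt_pos.2 (by linarith), Real.sq_sqrt (by linarith)⟩
      simp only
      rw [← ha2, ← hb2, Real.sqrt_sq ha.le, Real.sqrt_sq hb.le]
      have hab : a - b = 1 / (a + b) := by
        field_simp; nlinarith
      have hP : 0 < a * b := by positivity
      have hPn : a * b ≤ n := by nlinarith [sq_nonneg (a - b)]
      have hP2 : (a * b) ^ 2 = n ^ 2 - 1 / 4 := by
        rw [mul_pow, ha2, hb2]; ring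
      have hS2 : (a + b) ^ 2 = 2 * n + 2 * (a * b) := by nlinarith
      have key : a ^ 2 * a - 1 / 32 / a - (b ^ 2 * b - 1 / 32 / b) =
          (2 * n + a * b + 1 / 32 / (a * b)) / (a + b) := by
        have h1 : a ^ 2 * a - 1 / 32 / a - (b ^ 2 * b - 1 / 32 / b) =
          (a - b) * (a ^ 2 + b ^ 2 + a * b + 1 / 32 / (a * b)) := by
          field_simp; ring
        rw [h1, hab, show a ^ 2 + b ^ 2 = 2 * n by linarith]; ring
      rw [key, le_div_iff₀ (by positivity)]
      refine le_of_sq_le_sq ?_ (by positivity)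
      generalize a * b = P at *
      have : (((1 : ℕ) : ℝ) + 1 / 2) = 3 / 2 := by norm_num
      rw [this, mul_pow, mul_pow, Real.sq_sqrt hn0.le, hS2]
      have hq : n / P ≥ 1 := by rw [ge_iff_le, le_div_iff₀ hP]; linarith
      have h4 : (2 * n + P + 1 / 32 / P) ^ 2 =
          (2 * n + P) ^ 2 + 1 / 8 * (n / P) + 1 / 16 + (1 / 32 / P) ^ 2 := by
        field_simp; ring
      rw [h4]
      have h5 : 0 ≤ (1 / 32 / P) ^ 2 := sq_nonneg _
      have h6 : (n - P) * (P + n / 2) ≤ 3 / 16 := by linarith [sq_nonneg (n - P)]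
      linarith
  · refine ⟨fun x => x ^ ((j : ℝ) + 1 / 2), fun x hx => ⟨by positivity, le_rfl⟩, fun n hn => ?_⟩
    have hr : (j : ℝ) + 1 / 2 ≤ 1 ∨ 2 ≤ (j : ℝ) + 1 / 2 := by
      rcases Nat.eq_zero_or_pos j with rfl | h
      · left; norm_num
      · right
        have : (2 : ℝ) ≤ j := by exact_mod_cast (by omega : 2 ≤ j)
        linarith
    have := two_mul_mul_sq_mul_rpow_le (h := 1 / 2) (x := n) hr (by norm_num) (by linarith)
    have hs : (0 : ℝ) < (j : ℝ) + 1 / 2 := by positivity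
    rw [show (j : ℝ) + 1 / 2 - 1 = (j : ℝ) - 1 / 2 by ring] at this
    refine le_of_mul_le_mul_left ?_ hs
    linarith

theorem rpow_div_le {s x : ℝ} (hs : 0 < s) (hx : 1 / 2 < x) :
    s * x ^ (-s - 1) ≤ (x - 1 / 2) ^ (-s) - (x + 1 / 2) ^ (-s) := by
  have := two_mul_mul_sq_mul_rpow_le (r := -s) (h := 1 / 2) (x := x) (Or.inl (by linarith))
    (by norm_num) hx
  refine le_of_mul_le_mul_left ?_ hs
  linarith

theorem sq_div_le_sq_div_add {a d p q f : ℝ} (hp : 0 < p) (hf : 0 < f) (h : p + f ≤ q) :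
    (a + d) ^ 2 / q ≤ a ^ 2 / p + d ^ 2 / f :=
  calc (a + d) ^ 2 / q ≤ (a + d) ^ 2 / (p + f) := by gcongr
    _ ≤ a ^ 2 / p + d ^ 2 / f := by
      rw [div_add_div _ _ hp.ne' hf.ne', div_le_div_iff₀ (by positivity) (by positivity)]
      nlinarith [mul_nonneg (mul_pos hp hf).le (sq_nonneg (a * f - d * p))]

/-- Weighted Hardy inequality on a half line from a flux `F` and a supersolution `φ`. -/
theorem hardy_of_flux {c : ℝ} {g w F φ u : ℕ → ℝ} (hw : ∀ n, 0 < w n) (hF : ∀ n, 1 ≤ n → 0 < F n)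
    (hφ : ∀ n, 1 ≤ n → 0 < φ n)
    (hFφ : ∀ n, 1 ≤ n → c * g n * φ n ≤ F (n + 1) - F n)
    (hφF : ∀ n, 1 ≤ n → φ (n + 1) + F (n + 1) / w (n + 1) ≤ φ n)
    (l M : ℕ) (hM : 1 ≤ M) (hu : u (M + l) = 0) :
    c * ∑ i ∈ Finset.range l, u (M + i) ^ 2 * g (M + i) + F M * (u M ^ 2 / φ M) ≤
      ∑ i ∈ Finset.range l, (u (M + i + 1) - u (M + i)) ^ 2 * w (M + i + 1) := by
  induction l generalizing M with
  | zero =>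
    rw [add_zero] at hu
    rw [Finset.sum_range_zero, Finset.sum_range_zero, hu]
    exact le_of_eq (by ring)
  | succ l ih =>
    have ih := ih (M + 1) (by omega) (by rw [← hu]; congr 1; omega)
    simp only [Finset.sum_range_succ', add_zero]
    simp only [← Nat.add_assoc]
    simp only [Nat.add_right_comm M 1] at ih
    have hF' := hF (M + 1) (by omega)
    have h1 := sq_div_le_sq_div_add (a := u (M + 1)) (d := -(u (M + 1) - u M))
      (hφ (M + 1) (by omega)) (div_pos hF' (hw (M + 1))) (hφF M hM)
    rw [show u (M + 1) + -(u (M + 1) - u M) = u M by ring, neg_sq] at h1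
    have h2 : F (M + 1) * (u M ^ 2 / φ M) ≤ F (M + 1) * (u (M + 1) ^ 2 / φ (M + 1)) +
        (u (M + 1) - u M) ^ 2 * w (M + 1) := by
      refine (mul_le_mul_of_nonneg_left h1 hF'.le).trans_eq ?_
      rw [mul_add]; congr 1
      have := (hw (M + 1)).ne'
      field_simp
    have h3 : c * (u M ^ 2 * g M) + F M * (u M ^ 2 / φ M) ≤ F (M + 1) * (u M ^ 2 / φ M) := by
      have h4 := mul_le_mul_of_nonneg_right (hFφ M hM)
        (div_nonneg (sq_nonneg (u M)) (hφ M hM).le)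
      have h5 : c * g M * φ M * (u M ^ 2 / φ M) = c * (u M ^ 2 * g M) := by
        have := (hφ M hM).ne'
        field_simp
      linarith
    linarith

theorem hardy_nat (j : ℕ) (u : ℕ → ℝ) (hu : (Function.support u).Finite) :
    ((j : ℝ) + 1 / 2) ^ 2 * ∑' n : ℕ, u (n + 1) ^ 2 * ((n : ℝ) + 1) ^ (2 * j) ≤
      ∑' n : ℕ, (u (n + 1) - u n) ^ 2 * ((n : ℝ) + 1 / 2) ^ (2 * j + 2) := by
  obtain ⟨N, hN⟩ : ∃ N, ∀ n, N ≤ n → u n = 0 := by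
    obtain ⟨N, hN⟩ := hu.bddAbove
    refine ⟨N + 1, fun n hn => ?_⟩
    by_contra h
    have := hN (show n ∈ Function.support u from h)
    omega
  obtain ⟨F, hF, hF'⟩ := exists_flux j
  set s : ℝ := (j : ℝ) + 1 / 2 with hs
  have hs0 : 0 < s := by positivity
  have hl := hardy_of_flux (c := s ^ 2) (g := fun n => (n : ℝ) ^ (2 * j))
    (w := fun n => ((n : ℝ) - 1 / 2) ^ (2 * j + 2)) (F := fun n => F ((n : ℝ) - 1 / 2))
    (φ := fun n => (n : ℝ) ^ (-s) / s) (u := u)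
    (fun n => by
      refine (even_two_mul (j + 1)).pow_pos (sub_ne_zero.2 fun h => ?_)
      have : ((2 * n : ℕ) : ℝ) = (1 : ℕ) := by push_cast; linarith
      have : 2 * n = 1 := by exact_mod_cast this
      omega)
    (fun n hn => (hF _ (by have : (1 : ℝ) ≤ n := by exact_mod_cast hn
                           linarith)).1)
    (fun n hn => by positivity)
    (fun n hn => by
      have h1 : (1 : ℝ) ≤ n := by exact_mod_cast hn
      have h0 : (0 : ℝ) < n := by linarith
      have := hF' n h1
      push_cast
      rw [show (n : ℝ) + 1 - 1 / 2 = n + 1 / 2 by ring]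
      refine le_trans (le_of_eq ?_) this
      rw [← Real.rpow_natCast (n : ℝ), show (j : ℝ) - 1 / 2 = ((2 * j : ℕ) : ℝ) + -s by
        rw [hs]; push_cast; ring, Real.rpow_add h0]
      field_simp)
    (fun n hn => by
      have h1 : (1 : ℝ) ≤ n := by exact_mod_cast hn
      push_cast
      rw [show (n : ℝ) + 1 - 1 / 2 = n + 1 / 2 by ring]
      have hx : (0 : ℝ) < n + 1 / 2 := by linarith
      have h2 := rpow_div_le (x := n + 1 / 2) hs0 (by linarith)
      rw [show (n : ℝ) + 1 / 2 - 1 / 2 = n by ring,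
        show (n : ℝ) + 1 / 2 + 1 / 2 = n + 1 by ring] at h2
      have h3 : F (n + 1 / 2) / ((n : ℝ) + 1 / 2) ^ (2 * j + 2) ≤
          ((n : ℝ) + 1 / 2) ^ (-s - 1) := by
        rw [div_le_iff₀ (by positivity), ← Real.rpow_natCast, ← Real.rpow_add hx]
        refine (hF _ (by linarith)).2.trans_eq ?_
        congr 1
        rw [hs]; push_cast; ring
      have h4 : ((n : ℝ) + 1 / 2) ^ (-s - 1) ≤ ((n : ℝ) ^ (-s) - (n + 1) ^ (-s)) / s := by
        rw [le_div_iff₀ hs0]; linarith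
      rw [sub_div] at h4
      linarith)
    N 1 le_rfl (hN _ (by omega))
  have hpos : 0 ≤ F (((1 : ℕ) : ℝ) - 1 / 2) * (u 1 ^ 2 / (((1 : ℕ) : ℝ) ^ (-s) / s)) :=
    mul_nonneg (hF _ (by norm_num)).1.le (by positivity)
  rw [tsum_eq_sum (s := Finset.range N), tsum_eq_sum (s := Finset.range (N + 1)),
    Finset.sum_range_succ']
  · have h0 : 0 ≤ (u (0 + 1) - u 0) ^ 2 * (((0 : ℕ) : ℝ) + 1 / 2) ^ (2 * j + 2) := by positivity
    have e1 : ∑ n ∈ Finset.range N, u (n + 1) ^ 2 * ((n : ℝ) + 1) ^ (2 * j) =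
        ∑ i ∈ Finset.range N, u (1 + i) ^ 2 * ((1 + i : ℕ) : ℝ) ^ (2 * j) :=
      Finset.sum_congr rfl fun n _ => by rw [add_comm 1 n]; push_cast; rfl
    have e2 : ∑ n ∈ Finset.range N, (u (n + 1 + 1) - u (n + 1)) ^ 2 *
          (((n + 1 : ℕ) : ℝ) + 1 / 2) ^ (2 * j + 2) =
        ∑ i ∈ Finset.range N, (u (1 + i + 1) - u (1 + i)) ^ 2 *
          (((1 + i + 1 : ℕ) : ℝ) - 1 / 2) ^ (2 * j + 2) :=
      Finset.sum_congr rfl fun n _ => by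
        rw [add_comm 1 n]; push_cast; congr 2; ring
    rw [e1, e2]
    linarith
  · intro n hn
    have : N ≤ n := by simp at hn; omega
    rw [hN n this, hN (n + 1) (by omega)]; simp
  · intro n hn
    have : N ≤ n := by simp at hn; omega
    rw [hN (n + 1) (by omega)]; simp

theorem finite_support_sub_mul {u : ℤ → ℝ} (hu : (Function.support u).Finite) (w : ℤ → ℝ) :
    (Function.support fun n => |u n - u (n - 1)| ^ 2 * w n).Finite := by
  refine (hu.union (hu.preimage (f := fun n : ℤ => n - 1)
    (sub_left_injective (b := (1 : ℤ))).injOn)).subset fun n hn => ?_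
  by_contra h
  simp only [Set.mem_union, Set.mem_preimage, Function.mem_support, not_or, not_not] at h
  simp [h.1, h.2] at hn

theorem tsum_sq_mul_int (j : ℕ) {u : ℤ → ℝ} (hu : (Function.support u).Finite) (h0 : u 0 = 0) :
    ∑' n : ℤ, |u n| ^ 2 * (n : ℝ) ^ (2 * j) =
      ∑' n : ℕ, u ((n + 1 : ℕ) : ℤ) ^ 2 * ((n : ℝ) + 1) ^ (2 * j) +
        ∑' n : ℕ, u (-((n + 1 : ℕ) : ℤ)) ^ 2 * ((n : ℝ) + 1) ^ (2 * j) := by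
  let f : ℤ → ℝ := fun n => |u n| ^ 2 * (n : ℝ) ^ (2 * j)
  have hs : Summable f :=
    summable_of_hasFiniteSupport (hu.subset fun n hn h => hn (by simp [f, h]))
  have i1 : Function.Injective fun n : ℕ => (n : ℤ) + 1 := fun a b h => by simpa using h
  have i2 : Function.Injective fun n : ℕ => -((n : ℤ) + 1) := fun a b h => by simpa using h
  have hf0 : f 0 = 0 := by simp [f, h0]
  have h := tsum_of_add_one_of_neg_add_one (f := f) (hs.comp_injective i1) (hs.comp_injective i2)
  rw [hf0, add_zero] at h
  refine h.trans ?_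
  congr 1
  · refine tsum_congr fun n => ?_
    simp only [f]
    rw [sq_abs]
    push_cast
    rfl
  · refine tsum_congr fun n => ?_
    simp only [f]
    rw [sq_abs]
    push_cast
    rw [(even_two_mul j).neg_pow]

theorem tsum_sq_sub_mul_int (j : ℕ) {u : ℤ → ℝ} (hu : (Function.support u).Finite) :
    ∑' n : ℤ, |u n - u (n - 1)| ^ 2 * ((n : ℝ) - 1 / 2) ^ (2 * j + 2) =
      ∑' n : ℕ, (u ((n + 1 : ℕ) : ℤ) - u (n : ℤ)) ^ 2 * ((n : ℝ) + 1 / 2) ^ (2 * j + 2) +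
        ∑' n : ℕ, (u (-((n + 1 : ℕ) : ℤ)) - u (-(n : ℤ))) ^ 2 *
          ((n : ℝ) + 1 / 2) ^ (2 * j + 2) := by
  have hs : Summable fun n : ℤ => |u n - u (n - 1)| ^ 2 * ((n : ℝ) - 1 / 2) ^ (2 * j + 2) :=
    summable_of_hasFiniteSupport
      (finite_support_sub_mul hu fun n => ((n : ℝ) - 1 / 2) ^ (2 * j + 2))
  have hs' := hs.comp_injective (Equiv.addRight (1 : ℤ)).injective
  have i2 : Function.Injective fun n : ℕ => -((n : ℤ) + 1) := fun a b h => by simpa using h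
  rw [← (Equiv.addRight (1 : ℤ)).tsum_eq]
  refine (tsum_of_nat_of_neg_add_one (hs'.comp_injective Nat.cast_injective)
    (hs'.comp_injective i2)).trans ?_
  simp only [Function.comp_apply, Equiv.coe_addRight, sq_abs]
  congr 1
  · refine tsum_congr fun n => ?_
    rw [add_sub_cancel_right]
    push_cast
    congr 2
    ring
  · refine tsum_congr fun n => ?_
    rw [show -((n : ℤ) + 1) + 1 = -n by ring, show -(n : ℤ) - 1 = -((n + 1 : ℕ) : ℤ) by
      push_cast; ring, ← neg_sq (u (-(n : ℤ)) - _), neg_sub,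
      show (((-(n : ℤ) : ℤ) : ℝ) - 1 / 2) = -((n : ℝ) + 1 / 2) by push_cast; ring,
      Even.neg_pow ⟨j + 1, by ring⟩]

theorem hardy_int (j : ℕ) {u : ℤ → ℝ} (hu : (Function.support u).Finite) (h0 : u 0 = 0) :
    ((j : ℝ) + 1 / 2) ^ 2 * ∑' n : ℤ, |u n| ^ 2 * (n : ℝ) ^ (2 * j) ≤
      ∑' n : ℤ, |u n - u (n - 1)| ^ 2 * ((n : ℝ) - 1 / 2) ^ (2 * j + 2) := by
  rw [tsum_sq_mul_int j hu h0, tsum_sq_sub_mul_int j hu, mul_add]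
  exact add_le_add
    (hardy_nat j (fun n => u n) (hu.preimage Nat.cast_injective.injOn))
    (hardy_nat j (fun n => u (-n)) (hu.preimage (neg_injective.comp Nat.cast_injective).injOn))

open Filter Topology in
theorem tendsto_sq_rpow_sub_mul (j : ℕ) :
    Tendsto (fun n : ℕ => ((n : ℝ) + 1) * (((n : ℝ) ^ (-((j : ℝ) + 1 / 2)) -
      ((n : ℝ) + 1) ^ (-((j : ℝ) + 1 / 2))) ^ 2 * ((n : ℝ) + 1 / 2) ^ (2 * j + 2)))
      atTop (𝓝 (((j : ℝ) + 1 / 2) ^ 2)) := by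
  set s : ℝ := (j : ℝ) + 1 / 2 with hs
  have hd : HasDerivAt (fun t : ℝ => (1 - t) ^ (-s)) s 0 := by
    have := ((hasDerivAt_id (0 : ℝ)).const_sub 1).rpow_const (p := -s) (Or.inl (by simp))
    simpa using this
  have ht : Tendsto (fun n : ℕ => 1 / ((n : ℝ) + 1)) atTop (𝓝[≠] 0) :=
    tendsto_nhdsWithin_iff.2 ⟨tendsto_one_div_add_atTop_nhds_zero_nat,
      Eventually.of_forall fun n => (by positivity : 1 / ((n : ℝ) + 1) ≠ 0)⟩
  have h1 := (hasDerivAt_iff_tendsto_slope_zero.1 hd).comp ht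
  have h2 : Tendsto (fun n : ℕ => (1 - 1 / ((n : ℝ) + 1) / 2) ^ (2 * j + 2)) atTop (𝓝 1) := by
    have := ((tendsto_one_div_add_atTop_nhds_zero_nat (𝕜 := ℝ)).div_const 2).const_sub 1
    simpa using this.pow (2 * j + 2)
  have h3 := h2.mul (h1.pow 2)
  rw [one_mul] at h3
  refine h3.congr fun n => ?_
  have hn : (0 : ℝ) < n + 1 := by positivity
  have hn0 : (0 : ℝ) ≤ n := by positivity
  simp only [Function.comp_apply, zero_add, sub_zero, Real.one_rpow, smul_eq_mul]
  have e1 : (1 - 1 / ((n : ℝ) + 1)) = n / (n + 1) := by field_simp; ring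
  have e2 : (1 - 1 / ((n : ℝ) + 1) / 2) = (n + 1 / 2) / (n + 1) := by field_simp; ring
  have e3 : (((n : ℝ) + 1) ^ (-s)) ^ 2 * ((n : ℝ) + 1) ^ (2 * j + 1) = 1 := by
    rw [← Real.rpow_mul_natCast hn.le, ← Real.rpow_natCast, ← Real.rpow_add hn, hs]
    push_cast
    ring_nf
    exact Real.rpow_zero _
  rw [e1, e2, Real.div_rpow hn0 hn.le, div_pow]
  have hp : 0 < ((n : ℝ) + 1) ^ (-s) := by positivity
  generalize ((n : ℝ) + 1) ^ (-s) = p at *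
  generalize (n : ℝ) ^ (-s) = q at *
  have e4 : ((n : ℝ) + 1) ^ (2 * j + 2) = (n + 1) / p ^ 2 := by
    rw [eq_div_iff (by positivity), pow_succ]; linear_combination ((n : ℝ) + 1) * e3
  rw [e4]
  field_simp

theorem sum_range_one_div_sqrt_le (N : ℕ) :
    ∑ n ∈ Finset.range N, 1 / √((n : ℝ) + 1) ≤ 2 * √N := by
  induction N with
  | zero => simp
  | succ N ih =>
    rw [Finset.sum_range_succ]
    push_cast
    have ha : 0 ≤ √(N : ℝ) := Real.sqrt_nonneg _
    have hb : 0 < √((N : ℝ) + 1) := Real.sqrt_pos.2 (by positivity)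
    have ha2 : √(N : ℝ) ^ 2 = N := Real.sq_sqrt (by positivity)
    have hb2 : √((N : ℝ) + 1) ^ 2 = N + 1 := Real.sq_sqrt (by positivity)
    have : 1 / √((N : ℝ) + 1) ≤ 2 * √((N : ℝ) + 1) - 2 * √(N : ℝ) := by
      rw [div_le_iff₀ hb]
      nlinarith [sq_nonneg (√((N : ℝ) + 1) - √(N : ℝ))]
    linarith

theorem one_div_sub_le_sq_mul (j : ℕ) {a N : ℝ} (ha : 0 < a) (haN : a ≤ N) :
    1 / a - 2 * (1 / √a / √N) ≤
      (a ^ (-((j : ℝ) + 1 / 2)) - N ^ (-((j : ℝ) + 1 / 2))) ^ 2 * a ^ (2 * j) := by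
  set s : ℝ := (j : ℝ) + 1 / 2 with hs
  have hN : 0 < N := ha.trans_le haN
  have e1 : (a ^ (-s)) ^ 2 * a ^ (2 * j) = 1 / a := by
    rw [← Real.rpow_mul_natCast ha.le, ← Real.rpow_natCast a (2 * j), ← Real.rpow_add ha, hs,
      one_div]
    push_cast
    ring_nf
    exact Real.rpow_neg_one a
  have e2 : a ^ (-s) * N ^ (-s) * a ^ (2 * j) ≤ 1 / √a / √N := by
    have h1 : a ^ (-s) * a ^ (2 * j) = a ^ j / √a := by
      rw [← Real.rpow_natCast a (2 * j), ← Real.rpow_add ha, ← Real.rpow_natCast a j,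
        Real.sqrt_eq_rpow, ← Real.rpow_sub ha, hs]
      congr 1
      push_cast
      ring
    have h2 : N ^ (-s) = 1 / N ^ j / √N := by
      rw [hs, Real.rpow_neg hN.le, Real.rpow_add hN, Real.sqrt_eq_rpow, Real.rpow_natCast]
      field_simp
    have h3 : a ^ j / N ^ j ≤ 1 := (div_le_one (by positivity)).2 (by gcongr)
    calc a ^ (-s) * N ^ (-s) * a ^ (2 * j) = a ^ (-s) * a ^ (2 * j) * N ^ (-s) := by ring
      _ = a ^ j / N ^ j * (1 / √a / √N) := by rw [h1, h2]; ring
      _ ≤ 1 * (1 / √a / √N) := by gcongr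
      _ = 1 / √a / √N := one_mul _
  have h3 : 0 ≤ (N ^ (-s)) ^ 2 * a ^ (2 * j) := by positivity
  linarith

/-- Sharpness on the half line, tested on truncations of `n ^ (-s) - N ^ (-s)`. -/
theorem le_of_hardy_nat (j : ℕ) {C : ℝ}
    (hC : ∀ v : ℕ → ℝ, (Function.support v).Finite → v 0 = 0 →
      C * ∑' n : ℕ, v (n + 1) ^ 2 * ((n : ℝ) + 1) ^ (2 * j) ≤
        ∑' n : ℕ, (v (n + 1) - v n) ^ 2 * ((n : ℝ) + 1 / 2) ^ (2 * j + 2)) :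
    C ≤ ((j : ℝ) + 1 / 2) ^ 2 := by
  by_contra! hlt
  obtain ⟨B, hsB, hBC⟩ := exists_between hlt
  set s : ℝ := (j : ℝ) + 1 / 2 with hs
  have hs0 : 0 < s := by positivity
  have hC0 : 0 < C := lt_of_le_of_lt (sq_nonneg s) hlt
  let d : ℕ → ℝ := fun n =>
    ((n : ℝ) ^ (-s) - ((n : ℝ) + 1) ^ (-s)) ^ 2 * ((n : ℝ) + 1 / 2) ^ (2 * j + 2)
  have hd0 : ∀ n, 0 ≤ d n := fun n => by positivity
  obtain ⟨m, hm⟩ := Filter.eventually_atTop.1 ((tendsto_sq_rpow_sub_mul j).eventually_le_const hsB)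
  have hdB : ∀ n, m ≤ n → d n ≤ B * (1 / ((n : ℝ) + 1)) := fun n hn => by
    rw [mul_one_div, le_div_iff₀ (by positivity), mul_comm]
    exact hm n hn
  have hsum : ∀ N, m ≤ N → ∑ n ∈ Finset.range N, d n ≤
      ∑ n ∈ Finset.range m, d n + B * ∑ n ∈ Finset.range N, 1 / ((n : ℝ) + 1) := by
    intro N hN
    induction N, hN using Nat.le_induction with
    | base =>
      have : 0 ≤ B * ∑ n ∈ Finset.range m, 1 / ((n : ℝ) + 1) :=
        mul_nonneg ((sq_nonneg s).trans hsB.le) (Finset.sum_nonneg fun n _ => by positivity)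
      linarith
    | succ N hN ih =>
      rw [Finset.sum_range_succ, Finset.sum_range_succ _ N, mul_add]
      linarith [hdB N hN]
  have htest : ∀ N : ℕ, 1 ≤ N →
      C * (∑ n ∈ Finset.range N, 1 / ((n : ℝ) + 1) - 4) ≤ ∑ n ∈ Finset.range N, d n := by
    intro N hN
    have hNpos : (0 : ℝ) < N := by exact_mod_cast hN
    let v : ℕ → ℝ := fun n => if n = 0 ∨ N ≤ n then 0 else (n : ℝ) ^ (-s) - (N : ℝ) ^ (-s)
    have hvN : ∀ n, N ≤ n → v n = 0 := fun n hn => if_pos (Or.inr hn)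
    have hv : ∀ n, n < N → v (n + 1) = ((n : ℝ) + 1) ^ (-s) - (N : ℝ) ^ (-s) := fun n hn => by
      rcases eq_or_ne (n + 1) N with h | h
      · rw [hvN _ h.ge, ← h]; push_cast; ring
      · simp only [v]
        rw [if_neg (by omega)]
        push_cast
        rfl
    have hfin : (Function.support v).Finite :=
      (Set.finite_lt_nat N).subset fun n hn => by
        by_contra h
        exact hn (hvN n (not_lt.1 h))
    have h := hC v hfin (if_pos (Or.inl rfl))
    rw [tsum_eq_sum (s := Finset.range N), tsum_eq_sum (s := Finset.range N)] at h
    · refine le_trans (mul_le_mul_of_nonneg_left ?_ hC0.le)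
        (h.trans (Finset.sum_le_sum fun n hn => ?_))
      · calc ∑ n ∈ Finset.range N, 1 / ((n : ℝ) + 1) - 4
            ≤ ∑ n ∈ Finset.range N, 1 / ((n : ℝ) + 1) -
                2 * ((∑ n ∈ Finset.range N, 1 / √((n : ℝ) + 1)) / √N) := by
              have : (∑ n ∈ Finset.range N, 1 / √((n : ℝ) + 1)) / √N ≤ 2 :=
                (div_le_iff₀ (Real.sqrt_pos.2 hNpos)).2 (sum_range_one_div_sqrt_le N)
              linarith
          _ = ∑ n ∈ Finset.range N, (1 / ((n : ℝ) + 1) - 2 * (1 / √((n : ℝ) + 1) / √N)) := by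
              rw [Finset.sum_sub_distrib, ← Finset.mul_sum, Finset.sum_div]
          _ ≤ _ := Finset.sum_le_sum fun n hn => by
              have hn := Finset.mem_range.1 hn
              rw [hv n hn]
              exact one_div_sub_le_sq_mul j (by positivity) (by exact_mod_cast hn)
      · have hn := Finset.mem_range.1 hn
        refine mul_le_mul_of_nonneg_right ?_ (by positivity)
        rw [hv n hn]
        rcases n with _ | n
        · have h1 : (N : ℝ) ^ (-s) ≤ 1 :=
            Real.rpow_le_one_of_one_le_of_nonpos (by exact_mod_cast hN) (by linarith)
          have h2 : 0 ≤ (N : ℝ) ^ (-s) := by positivity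
          have h3 : v 0 = 0 := if_pos (Or.inl rfl)
          rw [h3, Nat.cast_zero, zero_add, Real.one_rpow, Real.zero_rpow (by linarith)]
          nlinarith
        · rw [hv n (by omega)]
          push_cast
          exact le_of_eq (by ring)
    · intro n hn
      have : N ≤ n := by simpa using hn
      rw [hvN n this, hvN (n + 1) (by omega)]; simp
    · intro n hn
      have : N ≤ n := by simpa using hn
      rw [hvN (n + 1) (by omega)]; simp
  obtain ⟨N, hN1, hN2⟩ := ((Real.tendsto_sum_range_one_div_nat_succ_atTop.eventually_gt_atTop
    ((∑ n ∈ Finset.range m, d n + 4 * C) / (C - B))).and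
      (Filter.eventually_ge_atTop (max m 1))).exists
  rw [div_lt_iff₀ (by linarith)] at hN1
  have h1 := htest N (le_of_max_le_right hN2)
  have h2 := hsum N (le_of_max_le_left hN2)
  linarith

/-- Sharp weighted Hardy inequality on `ℤ` with weight `(n − 1/2)^{2k}`, together
with the sharpness of the constant `(2k−1)²/4`. -/
theorem discrete_weighted_hardy_int_sharp (k : ℕ) (hk : 1 ≤ k) :
    (∀ u : ℤ → ℝ, (Function.support u).Finite → u 0 = 0 →
      (2 * (k : ℝ) - 1) ^ 2 / 4 * ∑' n : ℤ, |u n| ^ 2 * (n : ℝ) ^ (2 * k - 2) ≤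
        ∑' n : ℤ, |u n - u (n - 1)| ^ 2 * ((n : ℝ) - 1 / 2) ^ (2 * k)) ∧
    ∀ C : ℝ,
      (∀ u : ℤ → ℝ, (Function.support u).Finite → u 0 = 0 →
        C * ∑' n : ℤ, |u n| ^ 2 * (n : ℝ) ^ (2 * k - 2) ≤
          ∑' n : ℤ, |u n - u (n - 1)| ^ 2 * ((n : ℝ) - 1 / 2) ^ (2 * k)) →
      C ≤ (2 * (k : ℝ) - 1) ^ 2 / 4 := by
  obtain ⟨j, rfl⟩ : ∃ j, k = j + 1 := ⟨k - 1, by omega⟩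
  rw [show 2 * (j + 1) - 2 = 2 * j by omega, show 2 * (j + 1) = 2 * j + 2 by ring,
    show (2 * ((j + 1 : ℕ) : ℝ) - 1) ^ 2 / 4 = ((j : ℝ) + 1 / 2) ^ 2 by push_cast; ring]
  refine ⟨fun u hu h0 => hardy_int j hu h0, fun C hC => le_of_hardy_nat j fun v hv h0 => ?_⟩
  have hu : (Function.support fun n : ℤ => v n.toNat).Finite := by
    refine (hv.image Nat.cast).subset fun n hn => ⟨n.toNat, hn, Int.toNat_of_nonneg ?_⟩
    by_contra h
    exact hn (by simp [Int.toNat_of_nonpos (not_le.1 h).le, h0])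
  have h := hC (fun n => v n.toNat) hu h0
  rw [tsum_sq_mul_int j hu h0, tsum_sq_sub_mul_int j hu] at h
  have hneg : ∀ n : ℕ, (-(n : ℤ)).toNat = 0 := fun n => Int.toNat_of_nonpos (by omega)
  simpa only [Int.toNat_natCast, hneg, h0, sub_zero, ne_eq, OfNat.ofNat_ne_zero,
    not_false_eq_true, zero_pow, zero_mul, tsum_zero, add_zero] using h
end

section
/- Let m ≥ 1 be an integer. Define, for u : ℕ → ℝ, the operators Du(n) := u(n) − u(n−1) (n ≥ 1), and Δu(n) := 2u(n) − u(n−1) − u(n+1) for n ≥ 1, Δu(0) := u(0) − u(1). Then: (i) for every finitely supported u : ℕ → ℝ with u(i) = 0 for 0 ≤ i ≤ 2m−1, Σ_{n=0}^∞ |Δ^m u(n)|² ≥ 2^{−4m} (∏_{i=0}^{2m−1} (8m − 3 − 4i)) Σ_{n=1}^∞ |u(n)|²/n^{4m}; and (ii) for every finitely supported u : ℕ → ℝ with u(i) = 0 for 0 ≤ i ≤ 2m, Σ_{n=1}^∞ |D(Δ^m u)(n)|² ≥ 2^{−4m−2} (∏_{i=0}^{2m} (8m + 1 − 4i)) Σ_{n=1}^∞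 |u(n)|²/n^{4m+2}. -/
/-- The first-order difference operator on `ℕ`: `Du(n) = u(n) − u(n−1)`. -/
def natD (u : ℕ → ℝ) (n : ℕ) : ℝ := u n - u (n - 1)

/-- The second-order difference operator on `ℕ`:
`Δu(n) = 2u(n) − u(n−1) − u(n+1)` for `n ≥ 1` and `Δu(0) = u(0) − u(1)`. -/
def natDelta (u : ℕ → ℝ) (n : ℕ) : ℝ :=
  if n = 0 then u 0 - u 1 else 2 * u n - u (n - 1) - u (n + 1)

lemma weight_drop {j n : ℕ} (hj : 1 ≤ j) (hn : j < n) :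
    ((j : ℝ) + 1 / 4) / (n : ℝ) ^ (2 * j + 2) + 1 / (((n : ℝ) - j) * ((n : ℝ) + 1) ^ (2 * j)) ≤
      1 / (((n : ℝ) - j) * (n : ℝ) ^ (2 * j)) := by
  have hj' : (1 : ℝ) ≤ j := by exact_mod_cast hj
  have hn' : (j : ℝ) < n := by exact_mod_cast hn
  have hn0 : (0 : ℝ) < n := by linarith
  have hd : (0 : ℝ) < (n : ℝ) - j := by linarith
  have hW : (0 : ℝ) < (n : ℝ) ^ (2 * j) := by positivity
  have hbern : ((n : ℝ) + 2 * j) / n * (n : ℝ) ^ (2 * j) ≤ ((n : ℝ) + 1) ^ (2 * j) := by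
    have h := one_add_mul_le_pow (a := 1 / (n : ℝ))
      (by linarith [show (0 : ℝ) < 1 / n by positivity]) (2 * j)
    have e1 : ((n : ℝ) + 1) ^ (2 * j) = (1 + 1 / (n : ℝ)) ^ (2 * j) * (n : ℝ) ^ (2 * j) := by
      rw [← mul_pow]; congr 1; field_simp
    rw [e1]
    refine mul_le_mul_of_nonneg_right (le_trans (le_of_eq ?_) h) hW.le
    push_cast
    field_simp
  have hZ : 1 / (((n : ℝ) - j) * ((n : ℝ) + 1) ^ (2 * j)) ≤
      1 / (((n : ℝ) - j) * (((n : ℝ) + 2 * j) / n * (n : ℝ) ^ (2 * j))) := by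
    gcongr
  have hmain : ((j : ℝ) + 1 / 4) / (n : ℝ) ^ 2 ≤ 2 * j / (((n : ℝ) - j) * (n + 2 * j)) := by
    rw [div_le_div_iff₀ (by positivity) (by positivity)]
    nlinarith [mul_nonneg (show (0 : ℝ) ≤ j + 1 / 4 by positivity) (sq_nonneg ((n : ℝ) - 4 * j)),
      mul_nonneg (sub_nonneg.2 hj') (sq_nonneg (n : ℝ))]
  have e2 : 1 / (((n : ℝ) - j) * (n : ℝ) ^ (2 * j)) -
      1 / (((n : ℝ) - j) * (((n : ℝ) + 2 * j) / n * (n : ℝ) ^ (2 * j))) =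
      2 * j / (((n : ℝ) - j) * (n + 2 * j)) / (n : ℝ) ^ (2 * j) := by
    field_simp
    ring
  have e3 : ((j : ℝ) + 1 / 4) / (n : ℝ) ^ (2 * j + 2) =
      ((j : ℝ) + 1 / 4) / (n : ℝ) ^ 2 / (n : ℝ) ^ (2 * j) := by
    rw [div_div, ← pow_add, add_comm 2]
  have h4 := div_le_div_of_nonneg_right hmain hW.le
  linarith

lemma sq_div_sub_sq_div_le {d : ℝ} (hd : 0 < d) (a b : ℝ) :
    b ^ 2 / (d + 1) - a ^ 2 / d ≤ (b - a) ^ 2 := by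
  have h : (b - a) ^ 2 - (b ^ 2 / (d + 1) - a ^ 2 / d) =
      (d * b - (d + 1) * a) ^ 2 / (d * (d + 1)) := by
    field_simp
    ring
  have : 0 ≤ (d * b - (d + 1) * a) ^ 2 / (d * (d + 1)) := by positivity
  linarith

/-- The unweighted Hardy inequality over an initial segment, with a boundary term. -/
lemma hardy_partial (v : ℕ → ℝ) (hv : v 0 = 0) (N : ℕ) :
    1 / 4 * ∑ n ∈ Finset.range N, v (n + 1) ^ 2 / ((n : ℝ) + 1) ^ 2 + v N ^ 2 / (2 * N) ≤
      ∑ n ∈ Finset.range N, natD v (n + 1) ^ 2 := by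
  induction N with
  | zero => simp [hv]
  | succ N ih =>
    rw [Finset.sum_range_succ, Finset.sum_range_succ]
    suffices h : 1 / 4 * (v (N + 1) ^ 2 / ((N : ℝ) + 1) ^ 2) + v (N + 1) ^ 2 / (2 * ((N : ℝ) + 1))
        - v N ^ 2 / (2 * N) ≤ (v (N + 1) - v N) ^ 2 by
      simp only [natD, Nat.add_sub_cancel] at ih ⊢
      push_cast
      linarith
    generalize v (N + 1) = b
    rcases Nat.eq_zero_or_pos N with rfl | hN
    · simp only [hv]
      norm_num
      nlinarith [sq_nonneg b]
    · generalize v N = a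
      have hN' : (1 : ℝ) ≤ N := by exact_mod_cast hN
      have h1 := sq_div_sub_sq_div_le (d := 2 * N) (by positivity) a b
      have h2 : 1 / 4 * (b ^ 2 / ((N : ℝ) + 1) ^ 2) + b ^ 2 / (2 * ((N : ℝ) + 1)) ≤
          b ^ 2 / (2 * N + 1) := by
        have e : b ^ 2 / (2 * (N : ℝ) + 1) -
            (1 / 4 * (b ^ 2 / ((N : ℝ) + 1) ^ 2) + b ^ 2 / (2 * ((N : ℝ) + 1))) =
            b ^ 2 / (4 * (2 * N + 1) * (N + 1) ^ 2) := by
          field_simp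
          ring
        have : 0 ≤ b ^ 2 / (4 * (2 * (N : ℝ) + 1) * (N + 1) ^ 2) := by positivity
        linarith
      linarith

/-- The Hardy inequality with weight `n ^ (-2 * j)` over an initial segment, with a boundary
term. -/
lemma weighted_hardy_partial {j : ℕ} (hj : 1 ≤ j) (v : ℕ → ℝ) (hv : ∀ i ≤ j, v i = 0) (N : ℕ) :
    ((j : ℝ) + 1 / 4) * ∑ n ∈ Finset.range N, v (n + 1) ^ 2 / ((n : ℝ) + 1) ^ (2 * j + 2) +
        v N ^ 2 * (1 / (((N : ℝ) - j) * ((N : ℝ) + 1) ^ (2 * j))) ≤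
      ∑ n ∈ Finset.range N, natD v (n + 1) ^ 2 / ((n : ℝ) + 1) ^ (2 * j) := by
  induction N with
  | zero => simp [hv]
  | succ N ih =>
    rw [Finset.sum_range_succ, Finset.sum_range_succ]
    suffices h : ((j : ℝ) + 1 / 4) * (v (N + 1) ^ 2 / ((N : ℝ) + 1) ^ (2 * j + 2)) +
        v (N + 1) ^ 2 * (1 / (((N : ℝ) + 1 - j) * ((N : ℝ) + 1 + 1) ^ (2 * j))) -
        v N ^ 2 * (1 / (((N : ℝ) - j) * ((N : ℝ) + 1) ^ (2 * j))) ≤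
        (v (N + 1) - v N) ^ 2 / ((N : ℝ) + 1) ^ (2 * j) by
      simp only [natD, Nat.add_sub_cancel] at ih ⊢
      push_cast
      linarith
    rcases lt_or_ge N j with hN | hN
    · simp [hv N hN.le, hv (N + 1) hN]
    · have hk := weight_drop hj (Nat.lt_succ_of_le hN)
      push_cast at hk
      have hb := mul_le_mul_of_nonneg_left hk (sq_nonneg (v (N + 1)))
      have hW : (0 : ℝ) < ((N : ℝ) + 1) ^ (2 * j) := by positivity
      have hsq : v (N + 1) ^ 2 / ((N : ℝ) + 1 - j) - v N ^ 2 / ((N : ℝ) - j) ≤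
          (v (N + 1) - v N) ^ 2 := by
        rcases hN.eq_or_lt with rfl | hN'
        · simp [hv j le_rfl]
        · have hd : (0 : ℝ) < (N : ℝ) - j := sub_pos.2 (by exact_mod_cast hN')
          have := sq_div_sub_sq_div_le hd (v N) (v (N + 1))
          rwa [show (N : ℝ) - j + 1 = N + 1 - j by ring] at this
      have h5 := div_le_div_of_nonneg_right hsq hW.le
      rw [sub_div, div_div, div_div] at h5
      rw [mul_add, mul_one_div (v (N + 1) ^ 2) (((N : ℝ) + 1 - j) * ((N : ℝ) + 1) ^ (2 * j))] at hb
      rw [mul_one_div (v N ^ 2)]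
      have e : ((j : ℝ) + 1 / 4) * (v (N + 1) ^ 2 / ((N : ℝ) + 1) ^ (2 * j + 2)) =
          v (N + 1) ^ 2 * (((j : ℝ) + 1 / 4) / ((N : ℝ) + 1) ^ (2 * j + 2)) := by ring
      linarith

lemma weighted_hardy (j : ℕ) (v : ℕ → ℝ) (hv : ∀ i ≤ j, v i = 0) (N : ℕ) :
    ((j : ℝ) + 1 / 4) * ∑ n ∈ Finset.range N, v (n + 1) ^ 2 / ((n : ℝ) + 1) ^ (2 * j + 2) ≤
      ∑ n ∈ Finset.range N, natD v (n + 1) ^ 2 / ((n : ℝ) + 1) ^ (2 * j) := by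
  rcases Nat.eq_zero_or_pos j with rfl | hj
  · have h := hardy_partial v (hv 0 le_rfl) N
    have : 0 ≤ v N ^ 2 / (2 * (N : ℝ)) := by positivity
    simp only [mul_zero, zero_add, pow_zero, div_one, Nat.cast_zero]
    linarith
  · have h := weighted_hardy_partial hj v hv N
    have : 0 ≤ v N ^ 2 * (1 / (((N : ℝ) - j) * ((N : ℝ) + 1) ^ (2 * j))) := by
      rcases le_or_gt N j with hN | hN
      · simp [hv N hN]
      · have hd : (0 : ℝ) < (N : ℝ) - j := sub_pos.2 (by exact_mod_cast hN)
        positivity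
    linarith

lemma natD_iterate_eq_zero {u : ℕ → ℝ} {M : ℕ} (hu : ∀ i < M, u i = 0) (k : ℕ) :
    ∀ i < M, natD^[k] u i = 0 := by
  induction k with
  | zero => simpa using hu
  | succ k ih =>
    intro i hi
    rw [Function.iterate_succ_apply', natD, ih i hi, ih (i - 1) (by omega), sub_zero]

lemma natD_iterate_eventually_zero {u : ℕ → ℝ} {K : ℕ} (hu : ∀ n ≥ K, u n = 0) (k : ℕ) :
    ∀ n ≥ K + k, natD^[k] u n = 0 := by
  induction k with
  | zero => simpa using hu
  | succ k ih =>
    intro i hi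
    rw [Function.iterate_succ_apply', natD, ih i (by omega), ih (i - 1) (by omega), sub_zero]

lemma hardy_iterate {u : ℕ → ℝ} {M : ℕ} (hu : ∀ i < M, u i = 0) (N : ℕ) {j : ℕ} (hj : j ≤ M) :
    (∏ i ∈ Finset.range j, ((i : ℝ) + 1 / 4)) *
        ∑ n ∈ Finset.range N, natD^[M - j] u (n + 1) ^ 2 / ((n : ℝ) + 1) ^ (2 * j) ≤
      ∑ n ∈ Finset.range N, natD^[M] u (n + 1) ^ 2 := by
  induction j with
  | zero => simp
  | succ j ih =>
    refine le_trans ?_ (ih (by omega))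
    rw [Finset.prod_range_succ, mul_assoc]
    refine mul_le_mul_of_nonneg_left ?_ (Finset.prod_nonneg fun i _ => by positivity)
    have h := weighted_hardy j (natD^[M - (j + 1)] u)
      (fun i hi => natD_iterate_eq_zero hu _ i (by omega)) N
    rw [← Function.iterate_succ_apply' natD, show (M - (j + 1)).succ = M - j by omega] at h
    exact h

lemma natDelta_iterate_eq {u : ℕ → ℝ} {m : ℕ} (hu : ∀ i < 2 * m, u i = 0) {k : ℕ} (hk : k ≤ m)
    (n : ℕ) : natDelta^[k] u n = (-1) ^ k * natD^[2 * k] u (n + k) := by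
  induction k generalizing n with
  | zero => simp
  | succ k ih =>
    have hz := natD_iterate_eq_zero hu (2 * k)
    rw [Function.iterate_succ_apply', show 2 * (k + 1) = 2 * k + 1 + 1 by ring,
      Function.iterate_succ_apply', Function.iterate_succ_apply']
    simp only [natDelta, ih (by omega)]
    generalize natD^[2 * k] u = w at *
    rcases n with _ | n
    · have h1 := hz k (by omega)
      have h2 := hz (k - 1) (by omega)
      simp only [natD, if_true, zero_add, Nat.add_sub_cancel, h1, h2, pow_succ, add_comm 1 k]
      ring
    · have e1 : n + 1 + (k + 1) - 1 = n + 1 + k := by omega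
      have e2 : n + 1 + k - 1 = n + k := by omega
      have e3 : n + 1 + 1 + k = n + 1 + (k + 1) := by omega
      simp only [natD, e1, e2, e3, Nat.add_sub_cancel, Nat.add_eq_zero_iff, one_ne_zero, and_false,
        if_false, pow_succ]
      ring

lemma prod_reflect_eq (M : ℕ) :
    ((2 : ℝ) ^ (2 * M))⁻¹ * ∏ i ∈ Finset.range M, (4 * (M : ℝ) - 3 - 4 * i) =
      ∏ i ∈ Finset.range M, ((i : ℝ) + 1 / 4) := by
  rw [← Finset.prod_range_reflect (fun i : ℕ => (i : ℝ) + 1 / 4), pow_mul, ← inv_pow]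
  conv_lhs => rw [← Finset.card_range M, ← Finset.prod_const, Finset.card_range]
  rw [← Finset.prod_mul_distrib]
  refine Finset.prod_congr rfl fun i hi => ?_
  have hi' : i + 1 ≤ M := Finset.mem_range.1 hi
  rw [Nat.sub_sub, add_comm 1 i, Nat.cast_sub hi']
  push_cast
  ring

/-- The Hardy inequality for `natD^[M]`; the right-hand sum may start at any index `p ≤ M`. -/
lemma tsum_hardy_natD {u : ℕ → ℝ} {M : ℕ} (hfin : (Function.support u).Finite)
    (hu : ∀ i < M, u i = 0) {p : ℕ} (hp : p ≤ M) :
    ((2 : ℝ) ^ (2 * M))⁻¹ * (∏ i ∈ Finset.range M, (4 * (M : ℝ) - 3 - 4 * i)) *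
        ∑' n : ℕ, |u (n + 1)| ^ 2 / ((n : ℝ) + 1) ^ (2 * M) ≤
      ∑' n : ℕ, natD^[M] u (n + p) ^ 2 := by
  obtain ⟨B, hB⟩ := hfin.bddAbove
  have hK : ∀ n ≥ B + 1, u n = 0 := fun n hn => by
    by_contra h
    have := hB (Function.mem_support.2 h)
    omega
  have hDK := natD_iterate_eventually_zero hK M
  have hD0 := natD_iterate_eq_zero hu M
  set N := B + 1 + M with hN
  have hL : ∑' n : ℕ, |u (n + 1)| ^ 2 / ((n : ℝ) + 1) ^ (2 * M) =
      ∑ n ∈ Finset.range N, u (n + 1) ^ 2 / ((n : ℝ) + 1) ^ (2 * M) := by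
    rw [tsum_eq_sum (s := Finset.range N)]
    · simp only [sq_abs]
    · intro n hn
      rw [Finset.mem_range, not_lt] at hn
      simp [hK (n + 1) (by omega)]
  have hR : ∑' n : ℕ, natD^[M] u (n + p) ^ 2 = ∑ n ∈ Finset.range N, natD^[M] u (n + p) ^ 2 := by
    refine tsum_eq_sum fun n hn => ?_
    rw [Finset.mem_range, not_lt] at hn
    simp [hDK (n + p) (by omega)]
  have hshift : ∑ n ∈ Finset.range N, natD^[M] u (n + 1) ^ 2 ≤
      ∑ n ∈ Finset.range N, natD^[M] u (n + p) ^ 2 := by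
    have h1 : ∑ n ∈ Finset.range N, natD^[M] u (n + 1) ^ 2 ≤
        ∑ n ∈ Finset.range (p + N), natD^[M] u n ^ 2 := by
      have h := Finset.sum_range_succ' (fun n => natD^[M] u n ^ 2) N
      have h' : ∑ n ∈ Finset.range (N + 1), natD^[M] u n ^ 2 =
          ∑ n ∈ Finset.range N, natD^[M] u n ^ 2 := by
        rw [Finset.sum_range_succ, hDK N le_rfl]
        simp
      have h2 : ∑ n ∈ Finset.range N, natD^[M] u n ^ 2 ≤
          ∑ n ∈ Finset.range (p + N), natD^[M] u n ^ 2 :=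
        Finset.sum_le_sum_of_subset_of_nonneg (Finset.range_mono (Nat.le_add_left N p))
          fun _ _ _ => sq_nonneg _
      have := sq_nonneg (natD^[M] u 0)
      linarith
    rw [Finset.sum_range_add _ p N, Finset.sum_eq_zero (s := Finset.range p), zero_add] at h1
    · simpa only [add_comm p] using h1
    · intro i hi
      rw [hD0 i (by have := Finset.mem_range.1 hi; omega)]
      simp
  have h := hardy_iterate hu N le_rfl
  rw [Nat.sub_self, Function.iterate_zero_apply] at h
  rw [prod_reflect_eq, hL, hR]
  exact h.trans hshift

/-- Higher-order discrete Hardy (Rellich-type) inequalities on `ℕ` for the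
operators `Δ^m` and `D Δ^m`. -/
theorem discrete_higher_order_hardy (m : ℕ) (hm : 1 ≤ m) :
    (∀ u : ℕ → ℝ, (Function.support u).Finite → (∀ i : ℕ, i ≤ 2 * m - 1 → u i = 0) →
      ((2 : ℝ) ^ (4 * m))⁻¹ *
          (∏ i ∈ Finset.range (2 * m), (8 * (m : ℝ) - 3 - 4 * (i : ℝ))) *
          ∑' n : ℕ, |u (n + 1)| ^ 2 / ((n : ℝ) + 1) ^ (4 * m) ≤
        ∑' n : ℕ, |(natDelta^[m] u) n| ^ 2) ∧
    (∀ u : ℕ → ℝ, (Function.support u).Finite → (∀ i : ℕ, i ≤ 2 * m → u i = 0) →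
      ((2 : ℝ) ^ (4 * m + 2))⁻¹ *
          (∏ i ∈ Finset.range (2 * m + 1), (8 * (m : ℝ) + 1 - 4 * (i : ℝ))) *
          ∑' n : ℕ, |u (n + 1)| ^ 2 / ((n : ℝ) + 1) ^ (4 * m + 2) ≤
        ∑' n : ℕ, |natD (natDelta^[m] u) (n + 1)| ^ 2) := by
  constructor
  · intro u hfin hu
    have hu' : ∀ i < 2 * m, u i = 0 := fun i hi => hu i (by omega)
    have h := tsum_hardy_natD hfin hu' (p := m) (by omega)
    have e : ∀ n, |(natDelta^[m] u) n| ^ 2 = natD^[2 * m] u (n + m) ^ 2 := fun n => by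
      rw [natDelta_iterate_eq hu' le_rfl, sq_abs, mul_pow, ← pow_mul, mul_comm m 2, pow_mul]
      simp
    simp only [e]
    have e8 : (4 : ℝ) * ((2 * m : ℕ) : ℝ) - 3 = 8 * m - 3 := by
      push_cast
      ring
    rwa [e8, show 2 * (2 * m) = 4 * m by ring] at h
  · intro u hfin hu
    have hu' : ∀ i < 2 * m, u i = 0 := fun i hi => hu i (by omega)
    have h := tsum_hardy_natD hfin (M := 2 * m + 1) (fun i hi => hu i (by omega)) (p := m + 1)
      (by omega)
    have e : ∀ n, |natD (natDelta^[m] u) (n + 1)| ^ 2 =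
        natD^[2 * m + 1] u (n + (m + 1)) ^ 2 := fun n => by
      rw [Function.iterate_succ_apply', natD, natD, natDelta_iterate_eq hu' le_rfl,
        natDelta_iterate_eq hu' le_rfl, ← mul_sub, sq_abs, mul_pow, ← pow_mul, mul_comm m 2,
        pow_mul, show n + 1 + m = n + (m + 1) by ring, Nat.add_sub_cancel,
        show n + (m + 1) - 1 = n + m by omega]
      simp
    simp only [e]
    have e8 : (4 : ℝ) * ((2 * m + 1 : ℕ) : ℝ) - 3 = 8 * m + 1 := by
      push_cast
      ring
    rwa [e8, show 2 * (2 * m + 1) = 4 * m + 2 by ring] at h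
end

section
/- Let m ≥ 1 be an integer. Define, for u : ℤ → ℝ, Du(n) := u(n) − u(n−1) and Δu(n) := 2u(n) − u(n−1) − u(n+1), and set C(k) := k(k−1)(k − 3/2)² for k ∈ ℝ. Then for every finitely supported u : ℤ → ℝ with u(0) = 0: (i) for every integer k ≥ 2m, Σ_{n∈ℤ} |Δ^m u(n)|² n^{2k} ≥ (∏_{i=0}^{m−1} C(k − 2i)) Σ_{n∈ℤ} |u(n)|² n^{2k−4m}; and (ii) for every integer k ≥ 2m+1, Σ_{n∈ℤ} |D(Δ^m u)(n)|² (n − 1/2)^{2k} ≥ ((2k−1)²/4) (∏_{i=0}^{m−1} C(k − 1 − 2i)) Σ_{n∈ℤ} |u(n)|² n^{2k−4m−2}. -/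
/-- The first-order difference operator on `ℤ`: `Du(n) = u(n) − u(n−1)`. -/
def intD (u : ℤ → ℝ) (n : ℤ) : ℝ := u n - u (n - 1)

/-- The second-order difference operator on `ℤ`: `Δu(n) = 2u(n) − u(n−1) − u(n+1)`. -/
def intDelta (u : ℤ → ℝ) (n : ℤ) : ℝ := 2 * u n - u (n - 1) - u (n + 1)

/-- The constant `C(k) = k(k−1)(k−3/2)²`. -/
noncomputable def Cconst (x : ℝ) : ℝ := x * (x - 1) * (x - 3 / 2) ^ 2

/-- A second-order lower bound for the even part of `x ↦ (M + x) ^ (j + 1)`, together with the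
corresponding first-order bounds. -/
lemma add_pow_add_sub_pow_bounds {M x : ℝ} (h : x ^ 2 ≤ M) (j : ℕ) :
    2 * M ^ (j + 1) + (j + 1) * j * (x ^ 2) ^ j ≤ (M + x) ^ (j + 1) + (M - x) ^ (j + 1) ∧
    2 * (j + 1) * M ^ j * x ^ 2 ≤ x * ((M + x) ^ (j + 1) - (M - x) ^ (j + 1)) := by
  have hx : 0 ≤ x ^ 2 := sq_nonneg x
  have hM : 0 ≤ M := hx.trans h
  induction j with
  | zero => constructor <;> simp <;> nlinarith
  | succ j ih =>
    obtain ⟨h₁, h₂⟩ := ih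
    have hp : (x ^ 2) ^ j ≤ M ^ j := pow_le_pow_left₀ hx h j
    have hq : 0 ≤ (x ^ 2) ^ j := pow_nonneg hx j
    have hj : (0 : ℝ) ≤ j := Nat.cast_nonneg j
    have e₁ : (M + x) ^ (j + 1 + 1) + (M - x) ^ (j + 1 + 1) =
        M * ((M + x) ^ (j + 1) + (M - x) ^ (j + 1)) +
          x * ((M + x) ^ (j + 1) - (M - x) ^ (j + 1)) := by ring
    have e₂ : x * ((M + x) ^ (j + 1 + 1) - (M - x) ^ (j + 1 + 1)) =
        M * (x * ((M + x) ^ (j + 1) - (M - x) ^ (j + 1))) +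
          x ^ 2 * ((M + x) ^ (j + 1) + (M - x) ^ (j + 1)) := by ring
    rw [e₁, e₂]
    push_cast
    have a₁ := mul_le_mul_of_nonneg_left h₁ hM
    have a₂ := mul_le_mul_of_nonneg_left h₂ hM
    have a₃ := mul_le_mul_of_nonneg_left h₁ hx
    have b₁ : ((j : ℝ) + 1) * j * (x ^ 2) ^ j * x ^ 2 ≤ (j + 1) * j * (x ^ 2) ^ j * M :=
      mul_le_mul_of_nonneg_left h (by positivity)
    have b₂ : 2 * ((j : ℝ) + 1) * x ^ 2 * (x ^ 2) ^ j ≤ 2 * (j + 1) * x ^ 2 * M ^ j :=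
      mul_le_mul_of_nonneg_left hp (by positivity)
    have b₃ : 0 ≤ x ^ 2 * (((j : ℝ) + 1) * j * (x ^ 2) ^ j) := by positivity
    constructor
    · calc _ = 2 * M ^ (j + 1 + 1) + (((j : ℝ) + 1) * j * (x ^ 2) ^ j * x ^ 2 +
            2 * (j + 1) * x ^ 2 * (x ^ 2) ^ j) := by ring
        _ ≤ 2 * M ^ (j + 1 + 1) + ((j + 1) * j * (x ^ 2) ^ j * M +
            2 * (j + 1) * x ^ 2 * M ^ j) := by gcongr
        _ = M * (2 * M ^ (j + 1) + (j + 1) * j * (x ^ 2) ^ j) +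
            2 * (j + 1) * M ^ j * x ^ 2 := by ring
        _ ≤ _ := add_le_add a₁ h₂
    · calc _ = M * (2 * (j + 1) * M ^ j * x ^ 2) + x ^ 2 * (2 * M ^ (j + 1)) := by ring
        _ ≤ _ := by linarith

/-- The second central difference of `x ↦ x ^ (2 * (j + 1))` dominates its leading term,
even after replacing `2 * x ^ (2 * (j + 1))` by `2 * (x ^ 2 + 1 / 4) ^ (j + 1)`. -/
lemma half_shift_pow_bound (x : ℝ) (j : ℕ) :
    (j + 1) * j * x ^ (2 * j) ≤
      ((x - 1 / 2) ^ (2 * (j + 1)) - (x ^ 2 + 1 / 4) ^ (j + 1)) +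
      ((x + 1 / 2) ^ (2 * (j + 1)) - (x ^ 2 + 1 / 4) ^ (j + 1)) := by
  have h := (add_pow_add_sub_pow_bounds (M := x ^ 2 + 1 / 4) (x := x) (by linarith) j).1
  rw [pow_mul, pow_mul, pow_mul, show (x - 1 / 2) ^ 2 = x ^ 2 + 1 / 4 - x by ring,
    show (x + 1 / 2) ^ 2 = x ^ 2 + 1 / 4 + x by ring]
  linarith

/-- Lower bound for the energy of an edge joining `x` and `x'` with weight `(x * x' + 1 / 4) ^ k`. -/
lemma edge_energy_bound (x x' a b : ℝ) (k : ℕ) :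
    ((x * x' + 1 / 4) ^ k - (x ^ 2 + 1 / 4) ^ k) * a ^ 2 +
      ((x * x' + 1 / 4) ^ k - (x' ^ 2 + 1 / 4) ^ k) * b ^ 2 +
      (x ^ k * a - x' ^ k * b) ^ 2 ≤ (x * x' + 1 / 4) ^ k * (a - b) ^ 2 := by
  have key : ∀ j, 0 ≤ (x ^ j * a - x' ^ j * b) ^ 2 * (1 / 4) ^ (k - j) * (k.choose j : ℝ) :=
    fun j => by positivity
  have hs : ∑ j ∈ Finset.range (k + 1),
        (x ^ j * a - x' ^ j * b) ^ 2 * (1 / 4) ^ (k - j) * (k.choose j : ℝ) =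
      (x ^ 2 + 1 / 4) ^ k * a ^ 2 + (x' ^ 2 + 1 / 4) ^ k * b ^ 2 -
        2 * (x * x' + 1 / 4) ^ k * (a * b) := by
    simp only [add_pow, Finset.sum_mul, Finset.mul_sum, ← Finset.sum_add_distrib,
      ← Finset.sum_sub_distrib]
    refine Finset.sum_congr rfl fun j _ => ?_
    ring
  rw [Finset.sum_range_succ] at hs
  have h₀ := Finset.sum_nonneg fun j (_ : j ∈ Finset.range k) => key j
  simp only [Nat.sub_self, pow_zero, mul_one, Nat.choose_self, Nat.cast_one] at hs
  nlinarith

lemma tsum_le_tsum_of_edge_bound {u f : ℤ → ℝ} {A B W : ℤ → ℝ} (e : ℤ ≃ ℤ)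
    (hu : (Function.support u).Finite) (hf : (Function.support f).Finite)
    (hedge : ∀ n, A n * u n ^ 2 + B (e n) * u (e n) ^ 2 ≤ f n)
    (hvertex : ∀ n, W n * u n ^ 2 ≤ A n * u n ^ 2 + B n * u n ^ 2) :
    ∑' n, W n * u n ^ 2 ≤ ∑' n, f n := by
  have hs : ∀ V : ℤ → ℝ, Summable fun n => V n * u n ^ 2 := fun V =>
    summable_of_hasFiniteSupport <| hu.subset fun n hn h => hn (by simp [h])
  have hB : Summable fun n => B (e n) * u (e n) ^ 2 := e.summable_iff.2 (hs B)
  calc ∑' n, W n * u n ^ 2 ≤ ∑' n, (A n * u n ^ 2 + B n * u n ^ 2) :=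
        (hs W).tsum_le_tsum hvertex ((hs A).add (hs B))
    _ = ∑' n, A n * u n ^ 2 + ∑' n, B n * u n ^ 2 := (hs A).tsum_add (hs B)
    _ = ∑' n, A n * u n ^ 2 + ∑' n, B (e n) * u (e n) ^ 2 := by
        rw [e.tsum_eq fun n => B n * u n ^ 2]
    _ = ∑' n, (A n * u n ^ 2 + B (e n) * u (e n) ^ 2) := ((hs A).tsum_add hB).symm
    _ ≤ ∑' n, f n := ((hs A).add hB).tsum_le_tsum hedge (summable_of_hasFiniteSupport hf)

/-- Pointwise form of the classical Hardy inequality on `ℤ`. -/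
lemma hardy_edge_bound (g : ℤ → ℝ) (n : ℤ) :
    ((if 0 < n then 1 / 4 else 0) + (n : ℝ) / 2) * g n ^ 2 +
      ((if n - 1 < 0 then 1 / 4 else 0) - ((n - 1 : ℤ) : ℝ) / 2) * g (n - 1) ^ 2 ≤
      (n * g n - ((n - 1 : ℤ) : ℝ) * g (n - 1)) ^ 2 := by
  push_cast
  rcases le_or_gt n 0 with h | h
  · have h' : (n : ℝ) ≤ 0 := by exact_mod_cast h
    rw [if_neg (by omega), if_pos (by omega)]
    nlinarith [sq_nonneg ((n * g n - ((n : ℝ) - 1) * g (n - 1)) - g (n - 1) / 2),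
      mul_nonneg (neg_nonneg.2 h') (sq_nonneg (g n - g (n - 1)))]
  · have h' : (1 : ℝ) ≤ n := by exact_mod_cast h
    rw [if_pos h, if_neg (by omega)]
    nlinarith [sq_nonneg ((n * g n - ((n : ℝ) - 1) * g (n - 1)) - g n / 2),
      mul_nonneg (sub_nonneg.2 h') (sq_nonneg (g n - g (n - 1)))]

lemma support_intD_finite {u : ℤ → ℝ} (hu : (Function.support u).Finite) :
    (Function.support (intD u)).Finite := by
  refine (hu.union (hu.preimage (f := fun n => n - 1) (sub_left_injective.injOn))).subset ?_
  intro n hn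
  by_contra h
  simp only [Set.mem_union, Set.mem_preimage, Function.mem_support, not_or, not_not] at h
  exact hn (by simp [intD, h.1, h.2])

lemma intDelta_eq_intD_sub (u : ℤ → ℝ) (n : ℤ) :
    intDelta u n = intD u n - intD u (n + 1) := by
  simp only [intDelta, intD, add_sub_cancel_right]
  ring

lemma support_intDelta_finite {u : ℤ → ℝ} (hu : (Function.support u).Finite) :
    (Function.support (intDelta u)).Finite := by
  have h := support_intD_finite hu
  refine (h.union (h.preimage (f := fun n => n + 1) (add_left_injective 1).injOn)).subset ?_
  intro n hn
  by_contra h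
  simp only [Set.mem_union, Set.mem_preimage, Function.mem_support, not_or, not_not] at h
  exact hn (by simp [intDelta_eq_intD_sub, h.1, h.2])

lemma support_intDelta_iterate_finite {u : ℤ → ℝ} (hu : (Function.support u).Finite) (m : ℕ) :
    (Function.support (intDelta^[m] u)).Finite := by
  induction m with
  | zero => exact hu
  | succ m ih =>
    rw [Function.iterate_succ_apply']
    exact support_intDelta_finite ih

/-- First-order discrete Hardy inequality with the sharp constant. -/
lemma tsum_intD_hardy {u : ℤ → ℝ} (hu : (Function.support u).Finite) (j : ℕ)
    (h0 : (0 : ℝ) ^ j * u 0 = 0) :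
    ((j : ℝ) + 1 / 2) ^ 2 * ∑' n : ℤ, |u n| ^ 2 * (n : ℝ) ^ (2 * j) ≤
      ∑' n : ℤ, |intD u n| ^ 2 * ((n : ℝ) - 1 / 2) ^ (2 * (j + 1)) := by
  have H := tsum_le_tsum_of_edge_bound (u := u)
    (f := fun n => |intD u n| ^ 2 * ((n : ℝ) - 1 / 2) ^ (2 * (j + 1)))
    (A := fun n => ((n : ℝ) - 1 / 2) ^ (2 * (j + 1)) - ((n : ℝ) ^ 2 + 1 / 4) ^ (j + 1) +
      ((if 0 < n then 1 / 4 else 0) + (n : ℝ) / 2) * (n : ℝ) ^ (2 * j))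
    (B := fun n => ((n : ℝ) + 1 / 2) ^ (2 * (j + 1)) - ((n : ℝ) ^ 2 + 1 / 4) ^ (j + 1) +
      ((if n < 0 then 1 / 4 else 0) - (n : ℝ) / 2) * (n : ℝ) ^ (2 * j))
    (W := fun n => ((j : ℝ) + 1 / 2) ^ 2 * (n : ℝ) ^ (2 * j)) (Equiv.subRight 1) hu
    ((support_intD_finite hu).subset fun n hn h => hn (by simp [h])) ?_ ?_
  · rw [← tsum_mul_left]
    refine le_of_eq_of_le (tsum_congr fun n => ?_) H
    rw [sq_abs]
    ring
  · intro n
    simp only [Equiv.subRight_apply]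
    have h₁ := edge_energy_bound n ((n - 1 : ℤ) : ℝ) (u n) (u (n - 1)) (j + 1)
    have h₂ := hardy_edge_bound (fun n => (n : ℝ) ^ j * u n) n
    have e : (n : ℝ) * ((n - 1 : ℤ) : ℝ) + 1 / 4 = (n - 1 / 2) ^ 2 := by push_cast; ring
    have e' : ((n - 1 : ℤ) : ℝ) + 1 / 2 = n - 1 / 2 := by push_cast; ring
    rw [e, ← pow_mul] at h₁
    rw [e', sq_abs, intD]
    have h₃ := h₂.trans_eq (show _ = ((n : ℝ) ^ (j + 1) * u n -
      ((n - 1 : ℤ) : ℝ) ^ (j + 1) * u (n - 1)) ^ 2 by ring)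
    rw [mul_comm (_ ^ 2) (_ ^ (2 * (j + 1)))]
    refine (le_of_eq ?_).trans ((add_le_add le_rfl h₃).trans h₁)
    ring
  · intro n
    have h := mul_le_mul_of_nonneg_right (half_shift_pow_bound n j) (sq_nonneg (u n))
    have hg : (n : ℝ) ^ (2 * j) * u n ^ 2 * (1 / 4) =
        ((if 0 < n then 1 / 4 else 0) + (if n < 0 then 1 / 4 else 0)) *
          ((n : ℝ) ^ (2 * j) * u n ^ 2) := by
      rcases lt_trichotomy n 0 with hn | rfl | hn
      · rw [if_neg hn.le.not_gt, if_pos hn]; ring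
      · have : ((0 : ℤ) : ℝ) ^ (2 * j) * u 0 ^ 2 = (0 ^ j * u 0) ^ 2 := by push_cast; ring
        rw [this, h0]; simp
      · rw [if_pos hn, if_neg hn.le.not_gt]; ring
    linarith

/-- First-order discrete Hardy inequality for functions living on the half-integers. -/
lemma tsum_intDelta_hardy {u : ℤ → ℝ} (hu : (Function.support u).Finite) (j : ℕ) :
    ((j : ℝ) + 1) * j * ∑' n : ℤ, |intD u n| ^ 2 * ((n : ℝ) - 1 / 2) ^ (2 * j) ≤
      ∑' n : ℤ, |intDelta u n| ^ 2 * (n : ℝ) ^ (2 * (j + 1)) := by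
  have H := tsum_le_tsum_of_edge_bound (u := intD u)
    (f := fun n => |intDelta u n| ^ 2 * (n : ℝ) ^ (2 * (j + 1)))
    (A := fun n => (n : ℝ) ^ (2 * (j + 1)) - (((n : ℝ) - 1 / 2) ^ 2 + 1 / 4) ^ (j + 1))
    (B := fun n => ((n : ℝ) - 1) ^ (2 * (j + 1)) - (((n : ℝ) - 1 / 2) ^ 2 + 1 / 4) ^ (j + 1))
    (W := fun n => ((j : ℝ) + 1) * j * ((n : ℝ) - 1 / 2) ^ (2 * j)) (Equiv.addRight 1)
    (support_intD_finite hu)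
    ((support_intDelta_finite hu).subset fun n hn h => hn (by simp [h])) ?_ ?_
  · rw [← tsum_mul_left]
    refine le_of_eq_of_le (tsum_congr fun n => ?_) H
    rw [sq_abs]
    ring
  · intro n
    simp only [Equiv.coe_addRight]
    have h := edge_energy_bound ((n : ℝ) - 1 / 2) (((n + 1 : ℤ) : ℝ) - 1 / 2) (intD u n)
      (intD u (n + 1)) (j + 1)
    have e : ((n : ℝ) - 1 / 2) * (((n + 1 : ℤ) : ℝ) - 1 / 2) + 1 / 4 = (n : ℝ) ^ 2 := by
      push_cast; ring
    have e' : ((n + 1 : ℤ) : ℝ) - 1 = n := by push_cast; ring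
    rw [e, ← pow_mul] at h
    rw [e', sq_abs, intDelta_eq_intD_sub, mul_comm _ ((n : ℝ) ^ _)]
    exact (le_add_of_nonneg_right (sq_nonneg _)).trans h
  · intro n
    have h := mul_le_mul_of_nonneg_right (half_shift_pow_bound ((n : ℝ) - 1 / 2) j)
      (sq_nonneg (intD u n))
    rw [show (n : ℝ) - 1 / 2 - 1 / 2 = n - 1 by ring, sub_add_cancel] at h
    linarith

/-- Discrete Rellich inequality with power weights. -/
lemma tsum_intDelta_rellich {u : ℤ → ℝ} (hu : (Function.support u).Finite) (j : ℕ)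
    (h0 : (0 : ℝ) ^ j * u 0 = 0) :
    Cconst ((j : ℝ) + 2) * ∑' n : ℤ, |u n| ^ 2 * (n : ℝ) ^ (2 * j) ≤
      ∑' n : ℤ, |intDelta u n| ^ 2 * (n : ℝ) ^ (2 * (j + 2)) := by
  have h₁ := tsum_intD_hardy hu j h0
  have h₂ := tsum_intDelta_hardy hu (j + 1)
  push_cast at h₂
  calc _ = ((j : ℝ) + 1 + 1) * (j + 1) *
        (((j : ℝ) + 1 / 2) ^ 2 * ∑' n : ℤ, |u n| ^ 2 * (n : ℝ) ^ (2 * j)) := by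
        rw [Cconst]; ring
    _ ≤ _ := (mul_le_mul_of_nonneg_left h₁ (by positivity)).trans h₂

lemma Cconst_nonneg_of_one_le {x : ℝ} (hx : 1 ≤ x) : 0 ≤ Cconst x :=
  mul_nonneg (mul_nonneg (by linarith) (by linarith)) (sq_nonneg _)

lemma tsum_intDelta_iterate_rellich {u : ℤ → ℝ} (hu : (Function.support u).Finite)
    (h0 : u 0 = 0) (m j : ℕ) :
    (∏ i ∈ Finset.range m, Cconst (((j + 2 * m : ℕ) : ℝ) - 2 * (i : ℝ))) *
        ∑' n : ℤ, |u n| ^ 2 * (n : ℝ) ^ (2 * j) ≤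
      ∑' n : ℤ, |(intDelta^[m] u) n| ^ 2 * (n : ℝ) ^ (2 * (j + 2 * m)) := by
  induction m with
  | zero => simp
  | succ m ih =>
    have hw : (0 : ℝ) ^ (j + 2 * m) * (intDelta^[m] u) 0 = 0 := by
      rcases m with _ | m
      · simp [h0]
      · simp
    have h := tsum_intDelta_rellich (support_intDelta_iterate_finite hu m) (j + 2 * m) hw
    have hC : 0 ≤ Cconst (((j + 2 * m : ℕ) : ℝ) + 2) :=
      Cconst_nonneg_of_one_le (by linarith [(j + 2 * m).cast_nonneg (α := ℝ)])
    rw [Function.iterate_succ_apply', Finset.prod_range_succ']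
    refine le_trans (le_of_eq ?_) ((mul_le_mul_of_nonneg_left ih hC).trans h)
    have e : ∀ i : ℕ, ((j + 2 * (m + 1) : ℕ) : ℝ) - 2 * ((i + 1 : ℕ) : ℝ) =
        ((j + 2 * m : ℕ) : ℝ) - 2 * i := fun i => by push_cast; ring
    have e₀ : ((j + 2 * (m + 1) : ℕ) : ℝ) - 2 * ((0 : ℕ) : ℝ) = ((j + 2 * m : ℕ) : ℝ) + 2 := by
      push_cast; ring
    simp only [e, e₀]
    ring

/-- Power-weight higher-order discrete Hardy inequalities on `ℤ` for the
operators `Δ^m` and `D Δ^m`. -/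
theorem discrete_power_weight_higher_order_hardy (m : ℕ) (hm : 1 ≤ m) (u : ℤ → ℝ)
    (hu : (Function.support u).Finite) (h0 : u 0 = 0) :
    (∀ k : ℕ, 2 * m ≤ k →
      (∏ i ∈ Finset.range m, Cconst ((k : ℝ) - 2 * (i : ℝ))) *
          ∑' n : ℤ, |u n| ^ 2 * (n : ℝ) ^ (2 * k - 4 * m) ≤
        ∑' n : ℤ, |(intDelta^[m] u) n| ^ 2 * (n : ℝ) ^ (2 * k)) ∧
    (∀ k : ℕ, 2 * m + 1 ≤ k →
      (2 * (k : ℝ) - 1) ^ 2 / 4 *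
          (∏ i ∈ Finset.range m, Cconst ((k : ℝ) - 1 - 2 * (i : ℝ))) *
          ∑' n : ℤ, |u n| ^ 2 * (n : ℝ) ^ (2 * k - 4 * m - 2) ≤
        ∑' n : ℤ, |intD (intDelta^[m] u) n| ^ 2 * ((n : ℝ) - 1 / 2) ^ (2 * k)) := by
  constructor
  · intro k hk
    obtain ⟨j, rfl⟩ := Nat.exists_eq_add_of_le' hk
    rw [show 2 * (j + 2 * m) - 4 * m = 2 * j by omega]
    exact tsum_intDelta_iterate_rellich hu h0 m j
  · intro k hk
    obtain ⟨j, rfl⟩ := Nat.exists_eq_add_of_le' hk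
    rw [show 2 * (j + (2 * m + 1)) - 4 * m - 2 = 2 * j by omega, ← add_assoc]
    have h₁ := tsum_intD_hardy (support_intDelta_iterate_finite hu m) (j + 2 * m)
      (by rw [zero_pow (by omega), zero_mul])
    have h₂ := mul_le_mul_of_nonneg_left (tsum_intDelta_iterate_rellich hu h0 m j)
      (sq_nonneg (((j + 2 * m : ℕ) : ℝ) + 1 / 2))
    refine le_trans (le_of_eq ?_) (h₂.trans h₁)
    rw [Nat.cast_succ, add_sub_cancel_right]
    ring
end

section
/- Let u : ℝ → ℂ be a smooth function that is 2π-periodic and has zero average over a period, i.e. ∫_{−π}^{π} u(x) dx = 0. Then ∫_{−π}^{π} |u'(x)|² sin²(x/2) dx ≥ (1/16) ∫_{−π}^{π} |u(x)|² dx. -/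
open Real

/-- If `n` vanishes to second order at `a` and `d` has a simple zero there, then `n / d` (with the
convention `0 / 0 = 0`) is continuous at `a`. -/
lemma continuousAt_div_of_hasDerivAt_zero {n d : ℝ → ℝ} {a d' : ℝ} (hn : HasDerivAt n 0 a)
    (hd : HasDerivAt d d' a) (hd' : d' ≠ 0) (hna : n a = 0) (hda : d a = 0) :
    ContinuousAt (fun x => n x / d x) a := by
  rw [continuousAt_iff_punctured_nhds]
  have h := (hasDerivAt_iff_tendsto_slope.1 hn).div (hasDerivAt_iff_tendsto_slope.1 hd) hd'
  simp only [hna, zero_div] at h ⊢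
  refine h.congr' ?_
  filter_upwards [self_mem_nhdsWithin] with x hx
  have hxa : x - a ≠ 0 := sub_ne_zero.2 hx
  simp only [Pi.div_apply, slope_def_field, hna, hda, sub_zero]
  exact div_div_div_cancel_right₀ hxa _ _

/-- A mean-zero function minimizes the mean-square distance to the constants at zero. -/
lemma integral_norm_sq_le_integral_norm_sub_sq {u : ℝ → ℂ} (hu : Continuous u) {a b : ℝ}
    (hab : a ≤ b) (havg : (∫ x in a..b, u x) = 0) (c : ℂ) :
    ∫ x in a..b, ‖u x‖ ^ 2 ≤ ∫ x in a..b, ‖u x - c‖ ^ 2 := by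
  have hinner : ∫ x in a..b, inner ℝ c (u x) = 0 := by
    have h := (innerSL ℝ c).intervalIntegral_comp_comm (hu.intervalIntegrable (μ := MeasureTheory.volume) a b)
    rw [havg, map_zero] at h
    simpa using h
  have hci : Continuous fun x => 2 * inner ℝ c (u x) := by fun_prop
  have hu2 : Continuous fun x => ‖u x‖ ^ 2 := by fun_prop
  calc ∫ x in a..b, ‖u x‖ ^ 2 = ∫ x in a..b, (‖u x‖ ^ 2 - 2 * inner ℝ c (u x)) := by
        rw [intervalIntegral.integral_sub (hu2.intervalIntegrable a b)
          (hci.intervalIntegrable a b), intervalIntegral.integral_const_mul, hinner]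
        simp
    _ ≤ ∫ x in a..b, ‖u x - c‖ ^ 2 := by
        refine intervalIntegral.integral_mono_on hab
          ((hu2.sub hci).intervalIntegrable a b)
          (((hu.sub continuous_const).norm.pow 2).intervalIntegrable a b) fun x _ => ?_
        rw [norm_sub_sq_real, real_inner_comm]
        nlinarith [sq_nonneg ‖c‖]

/-- Weighted Hardy inequality on `(-π, π)` for functions vanishing at both endpoints. -/
lemma hardy_sin_sq {v : ℝ → ℂ} (hv : ContDiff ℝ 1 v) (h_neg : v (-π) = 0) (h_pos : v π = 0) :
    (1 / 16) * ∫ x in (-π)..π, ‖v x‖ ^ 2 ≤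
      ∫ x in (-π)..π, ‖deriv v x‖ ^ 2 * Real.sin (x / 2) ^ 2 := by
  have hc : Continuous v := hv.continuous
  have hc' : Continuous (deriv v) := hv.continuous_deriv le_rfl
  have hvd : ∀ x, HasDerivAt (fun y => ‖v y‖ ^ 2) (2 * inner ℝ (v x) (deriv v x)) x := fun x =>
    ((hv.differentiable one_ne_zero) x).hasDerivAt.norm_sq
  have hcosd : ∀ x, HasDerivAt (fun y => cos (y / 2)) (-sin (x / 2) * (1 / 2)) x := fun x =>
    ((hasDerivAt_id x).div_const 2).cos
  have hsind : ∀ x, HasDerivAt (fun y => sin (y / 2)) (cos (x / 2) * (1 / 2)) x := fun x =>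
    ((hasDerivAt_id x).div_const 2).sin
  have hcos : ∀ x ∈ Set.Ioo (-π) π, 0 < cos (x / 2) := fun x hx =>
    cos_pos_of_mem_Ioo ⟨by linarith [hx.1], by linarith [hx.2]⟩
  have hend : ∀ a, v a = 0 → cos (a / 2) = 0 →
      ContinuousAt (fun x => ‖v x‖ ^ 2 / cos (x / 2)) a := by
    intro a hva hca
    refine continuousAt_div_of_hasDerivAt_zero (by simpa [hva] using hvd a) (hcosd a) ?_
      (by simp [hva]) hca
    intro h
    have := sin_sq_add_cos_sq (a / 2)
    rw [hca, show sin (a / 2) = 0 by linarith] at this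
    norm_num at this
  set G : ℝ → ℝ := fun x => -(sin (x / 2) / 4) * (‖v x‖ ^ 2 / cos (x / 2)) with hG
  have hGc : ContinuousOn G (Set.Icc (-π) π) := by
    intro x hx
    refine ContinuousAt.continuousWithinAt (ContinuousAt.mul (by fun_prop) ?_)
    rcases eq_or_ne x (-π) with rfl | h1
    · exact hend _ h_neg (by rw [neg_div, cos_neg, cos_pi_div_two])
    rcases eq_or_ne x π with rfl | h2
    · exact hend _ h_pos cos_pi_div_two
    exact (hvd x).continuousAt.div (hcosd x).continuousAt
      (hcos x ⟨lt_of_le_of_ne hx.1 h1.symm, lt_of_le_of_ne hx.2 h2⟩).ne'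
  have hφ1 : Continuous fun x => ‖deriv v x‖ ^ 2 * sin (x / 2) ^ 2 := by fun_prop
  have hφ2 : Continuous fun x => (1 / 16) * ‖v x‖ ^ 2 := by fun_prop
  have key := intervalIntegral.sub_le_integral_of_hasDeriv_right_of_le
    (φ := fun x => ‖deriv v x‖ ^ 2 * sin (x / 2) ^ 2 - (1 / 16) * ‖v x‖ ^ 2)
    (by linarith [pi_pos] : -π ≤ π) hGc
    (fun x hx => ((((hsind x).div_const 4).neg.mul
      ((hvd x).div (hcosd x) (hcos x hx).ne')).hasDerivWithinAt))
    ((hφ1.sub hφ2).integrableOn_Icc) ?_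
  · rw [intervalIntegral.integral_sub (hφ1.intervalIntegrable _ _) (hφ2.intervalIntegrable _ _),
      intervalIntegral.integral_const_mul] at key
    simp only [hG, h_neg, h_pos] at key
    norm_num at key
    linarith
  · intro x hx
    simp only [Pi.neg_apply, Pi.div_apply]
    have hcx := hcos x hx
    have hs : sin (x / 2) ^ 2 = 1 - cos (x / 2) ^ 2 := sin_sq _
    have hsq : 0 ≤ ‖(sin (x / 2)) • deriv v x + (1 / (4 * cos (x / 2))) • v x‖ ^ 2 := sq_nonneg _
    rw [norm_add_sq_real, norm_smul, norm_smul, real_inner_smul_left, real_inner_smul_right,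
      real_inner_comm, mul_pow, mul_pow, norm_eq_abs, norm_eq_abs, sq_abs, sq_abs] at hsq
    have hone : ‖v x‖ ^ 2 ≤ ‖v x‖ ^ 2 / cos (x / 2) ^ 2 :=
      le_div_self (sq_nonneg _) (by positivity) (by nlinarith [sq_nonneg (sin (x / 2))])
    generalize inner ℝ (v x) (deriv v x) = i at *
    generalize sin (x / 2) = s at *
    generalize cos (x / 2) = c at *
    have hG' : -(c * (1 / 2) / 4) * (‖v x‖ ^ 2 / c) + -(s / 4) *
        ((2 * i * c - ‖v x‖ ^ 2 * (-s * (1 / 2))) / c ^ 2) =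
        -(‖v x‖ ^ 2 / c ^ 2) / 8 - s * i / (2 * c) := by
      field_simp
      linear_combination (-8 * ‖v x‖ ^ 2) * hs
    have hsq' : s ^ 2 * ‖deriv v x‖ ^ 2 + 2 * (s * (1 / (4 * c) * i)) +
        (1 / (4 * c)) ^ 2 * ‖v x‖ ^ 2 =
        ‖deriv v x‖ ^ 2 * s ^ 2 + s * i / (2 * c) + (‖v x‖ ^ 2 / c ^ 2) / 16 := by
      field_simp
      ring
    linarith

/-- An improved Poincaré-type inequality on the interval `(−π, π)`: for every
smooth `2π`-periodic function `u` with zero average,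
`∫ |u'|² sin²(x/2) ≥ (1/16) ∫ |u|²`. -/
theorem improved_poincare_sin (u : ℝ → ℂ) (hsmooth : ContDiff ℝ (⊤ : ℕ∞) u)
    (hper : ∀ x : ℝ, u (x + 2 * π) = u x)
    (havg : (∫ x in (-π)..π, u x) = 0) :
    (1 / 16) * ∫ x in (-π)..π, ‖u x‖ ^ 2 ≤
      ∫ x in (-π)..π, ‖deriv u x‖ ^ 2 * Real.sin (x / 2) ^ 2 := by
  have hu : u (-π) = u π := by
    rw [← hper (-π)]
    congr 1
    ring
  have h1 := integral_norm_sq_le_integral_norm_sub_sq hsmooth.continuous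
    (by linarith [pi_pos] : -π ≤ π) havg (u π)
  have h2 := hardy_sin_sq (v := fun x => u x - u π)
    ((hsmooth.of_le (by exact_mod_cast le_top)).sub contDiff_const) (by simp [hu]) (by simp)
  simp only [deriv_sub_const] at h2
  linarith
end

section
/- Let k ≥ 1 be an integer and let u : ℝ → ℂ be a smooth 2π-periodic function satisfying ∫_{−π}^{π} u(x) sin^{2k−2}(x/2) dx = 0. Then ∫_{−π}^{π} |u'(x)|² sin^{2k}(x/2) dx ≥ ((4k−3)/16) ∫_{−π}^{π} |u(x)|² sin^{2k−2}(x/2) dx. -/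
open Real

lemma hardy_sin_half_pointwise (n : ℕ) {s c N I D : ℝ} (hs : 0 < s) (hc : 0 < c)
    (hsc : s ^ 2 + c ^ 2 = 1) (hN : 0 ≤ N)
    (hD : 0 ≤ D + 2 * (c / s / 4 + s / c / 2) * I + (c / s / 4 + s / c / 2) ^ 2 * N) :
    -(1 / 4) * (((2 * n + 1) * s ^ (2 * n) * (c / 2) * c + s ^ (2 * n + 1) * (-s / 2)) * N
        + s ^ (2 * n + 1) * c * (2 * I))
      - 1 / 2 * ((2 * n + 3) * s ^ (2 * n + 2) * (c / 2) * (N / c)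
        + s ^ (2 * n + 3) * ((2 * I * c - N * (-s / 2)) / c ^ 2))
      ≤ D * s ^ (2 * n + 2) - (4 * n + 1) / 16 * (N * s ^ (2 * n)) := by
  have key : 0 ≤ s ^ (2 * n) * (s ^ 2 * (D + 2 * (c / s / 4 + s / c / 2) * I
      + (c / s / 4 + s / c / 2) ^ 2 * N) + (4 * n + 5) / 16 * s ^ 2 * N) := by positivity
  rw [← sub_nonneg]
  refine key.trans_eq ?_
  have hn : (4 * (n : ℝ) + 1) / 16 * (N * s ^ (2 * n))
      = (4 * n + 1) / 16 * (N * s ^ (2 * n)) * (s ^ 2 + c ^ 2) := by rw [hsc, mul_one]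
  rw [hn]
  have e1 : s ^ (2 * n + 1) = s ^ (2 * n) * s := pow_succ ..
  have e2 : s ^ (2 * n + 2) = s ^ (2 * n) * s ^ 2 := pow_add ..
  have e3 : s ^ (2 * n + 3) = s ^ (2 * n) * s ^ 3 := pow_add ..
  rw [e1, e2, e3]
  generalize s ^ (2 * n) = A
  field_simp
  ring

lemma hasDerivAt_sin_half (x : ℝ) :
    HasDerivAt (fun y : ℝ => Real.sin (y / 2)) (Real.cos (x / 2) / 2) x := by
  simpa [div_eq_mul_inv] using ((hasDerivAt_id x).div_const 2).sin

lemma hasDerivAt_cos_half (x : ℝ) :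
    HasDerivAt (fun y : ℝ => Real.cos (y / 2)) (-Real.sin (x / 2) / 2) x := by
  simpa [div_eq_mul_inv] using ((hasDerivAt_id x).div_const 2).cos

lemma tendsto_norm_sq_div_cos_half {f : ℝ → ℂ} {f' : ℂ} (hf : HasDerivAt f f' π)
    (h0 : f π = 0) :
    Filter.Tendsto (fun x => ‖f x‖ ^ 2 / Real.cos (x / 2)) (nhds π) (nhds 0) := by
  have h1 : f =O[nhds π] (fun x => x - π) := by simpa [h0] using hf.isBigO_sub
  have h2 : (fun x : ℝ => x - π) =O[nhds π] (fun x => Real.cos (x / 2)) := by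
    simpa [Function.comp_def] using
      ((hasDerivAt_cos_half π).isTheta_sub (by simp)).isBigO_symm
  have h3 : f =o[nhds π] (fun _ => (1 : ℝ)) := by
    rw [Asymptotics.isLittleO_one_iff]
    simpa [h0] using hf.continuousAt.tendsto
  have h4 := (h3.norm_left.mul_isBigO (h1.trans h2).norm_left)
  refine Filter.Tendsto.congr (fun x => ?_) h4.tendsto_div_nhds_zero
  simp [sq]

lemma hardy_sin_half (n : ℕ) {f f' : ℝ → ℂ} (hf : ∀ x, HasDerivAt f (f' x) x)
    (hf' : Continuous f') (h0 : f π = 0) :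
    (4 * (n : ℝ) + 1) / 16 * ∫ x in (0 : ℝ)..π, ‖f x‖ ^ 2 * Real.sin (x / 2) ^ (2 * n) ≤
      ∫ x in (0 : ℝ)..π, ‖f' x‖ ^ 2 * Real.sin (x / 2) ^ (2 * n + 2) := by
  have hfc : Continuous f := continuous_iff_continuousAt.2 fun x => (hf x).continuousAt
  have hcpos : ∀ x : ℝ, 0 ≤ x → x < π → 0 < Real.cos (x / 2) := fun x h h' =>
    Real.cos_pos_of_mem_Ioo ⟨by linarith [pi_pos], by linarith⟩
  have hq : ContinuousOn (fun x => ‖f x‖ ^ 2 / Real.cos (x / 2)) (Set.Icc 0 π) := by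
    intro x hx
    rcases hx.2.eq_or_lt with rfl | hlt
    · refine ContinuousAt.continuousWithinAt ?_
      simpa [ContinuousAt, h0] using tendsto_norm_sq_div_cos_half (hf π) h0
    · refine ContinuousAt.continuousWithinAt (ContinuousAt.div ?_ ?_ (hcpos x hx.1 hlt).ne') <;>
        fun_prop
  let g : ℝ → ℝ := fun x =>
    -(1 / 4) * ((Real.sin (x / 2) ^ (2 * n + 1) * Real.cos (x / 2)) * ‖f x‖ ^ 2)
      - 1 / 2 * (Real.sin (x / 2) ^ (2 * n + 3) * (‖f x‖ ^ 2 / Real.cos (x / 2)))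
  have hg : ContinuousOn g (Set.Icc 0 π) := by
    refine ContinuousOn.sub (by fun_prop) (ContinuousOn.mul (by fun_prop) (.mul (by fun_prop) hq))
  have main := intervalIntegral.sub_le_integral_of_hasDeriv_right_of_le pi_pos.le hg
    (g' := fun x => -(1 / 4) * (((2 * n + 1) * Real.sin (x / 2) ^ (2 * n) * (Real.cos (x / 2) / 2)
          * Real.cos (x / 2) + Real.sin (x / 2) ^ (2 * n + 1) * (-Real.sin (x / 2) / 2)) * ‖f x‖ ^ 2
        + Real.sin (x / 2) ^ (2 * n + 1) * Real.cos (x / 2) * (2 * inner ℝ (f x) (f' x)))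
      - 1 / 2 * ((2 * n + 3) * Real.sin (x / 2) ^ (2 * n + 2) * (Real.cos (x / 2) / 2)
          * (‖f x‖ ^ 2 / Real.cos (x / 2))
        + Real.sin (x / 2) ^ (2 * n + 3) * ((2 * inner ℝ (f x) (f' x) * Real.cos (x / 2)
          - ‖f x‖ ^ 2 * (-Real.sin (x / 2) / 2)) / Real.cos (x / 2) ^ 2)))
    (φ := fun x => ‖f' x‖ ^ 2 * Real.sin (x / 2) ^ (2 * n + 2)
      - (4 * n + 1) / 16 * (‖f x‖ ^ 2 * Real.sin (x / 2) ^ (2 * n)))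
    (fun x hx => ?_) (Continuous.integrableOn_Icc (by fun_prop)) (fun x hx => ?_)
  · have hg0 : g 0 = 0 := by simp [g]
    have hgπ : g π = 0 := by simp [g, h0]
    rw [hg0, hgπ, intervalIntegral.integral_sub, intervalIntegral.integral_const_mul] at main
    · linarith
    all_goals exact Continuous.intervalIntegrable (by fun_prop) _ _
  · have hs := hasDerivAt_sin_half x
    have hc := hasDerivAt_cos_half x
    have hn := (hf x).norm_sq
    have hcne := (hcpos x hx.1.le hx.2).ne'
    have := (((((hs.fun_pow (2 * n + 1)).fun_mul hc).fun_mul hn).const_mul (-(1 / 4) : ℝ)).fun_sub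
      (((hs.fun_pow (2 * n + 3)).fun_mul (hn.fun_div hc hcne)).const_mul (1 / 2 : ℝ)))
    refine (this.congr_deriv ?_).hasDerivWithinAt
    push_cast
    rfl
  · refine hardy_sin_half_pointwise n
      (Real.sin_pos_of_pos_of_lt_pi (by linarith [hx.1]) (by linarith [hx.1, hx.2]))
      (hcpos x hx.1.le hx.2) (Real.sin_sq_add_cos_sq _) (by positivity) ?_
    generalize Real.cos (x / 2) / Real.sin (x / 2) / 4
      + Real.sin (x / 2) / Real.cos (x / 2) / 2 = H
    have h := norm_add_sq_real (f' x) (H • f x)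
    rw [real_inner_smul_right, norm_smul, mul_pow, Real.norm_eq_abs, sq_abs,
      real_inner_comm] at h
    have := sq_nonneg ‖f' x + H • f x‖
    linarith

lemma hardy_sin_half_symm (n : ℕ) {f f' : ℝ → ℂ} (hf : ∀ x, HasDerivAt f (f' x) x)
    (hf' : Continuous f') (h0 : f π = 0) (h1 : f (-π) = 0) :
    (4 * (n : ℝ) + 1) / 16 * ∫ x in (-π)..π, ‖f x‖ ^ 2 * Real.sin (x / 2) ^ (2 * n) ≤
      ∫ x in (-π)..π, ‖f' x‖ ^ 2 * Real.sin (x / 2) ^ (2 * n + 2) := by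
  have hfc : Continuous f := continuous_iff_continuousAt.2 fun x => (hf x).continuousAt
  have hsplit : ∀ (F : ℝ → ℂ) (m : ℕ), Continuous F →
      ∫ x in (-π)..π, ‖F x‖ ^ 2 * Real.sin (x / 2) ^ (2 * m)
        = (∫ x in (0 : ℝ)..π, ‖F (-x)‖ ^ 2 * Real.sin (x / 2) ^ (2 * m))
          + ∫ x in (0 : ℝ)..π, ‖F x‖ ^ 2 * Real.sin (x / 2) ^ (2 * m) := by
    intro F m hF
    rw [← intervalIntegral.integral_add_adjacent_intervals (b := 0)
      (Continuous.intervalIntegrable (by fun_prop) _ _)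
      (Continuous.intervalIntegrable (by fun_prop) _ _)]
    congr 1
    have := intervalIntegral.integral_comp_neg (a := 0) (b := π)
      (fun x => ‖F x‖ ^ 2 * Real.sin (x / 2) ^ (2 * m))
    simpa [neg_div, pow_mul] using this.symm
  have hneg : ∀ x, HasDerivAt (fun y => f (-y)) (-f' (-x)) x := fun x => by
    simpa [Function.comp_def] using (hf (-x)).scomp x (hasDerivAt_neg x)
  have hR := hardy_sin_half n hf hf' h0
  have hL := hardy_sin_half n hneg (by fun_prop) h1
  simp only [norm_neg] at hL
  have e : 2 * n + 2 = 2 * (n + 1) := by ring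
  rw [e] at hR hL ⊢
  rw [hsplit f n hfc, hsplit f' (n + 1) hf']
  linarith

lemma integral_norm_sq_mul_le_of_integral_eq_zero {a b : ℝ} (hab : a ≤ b) {u : ℝ → ℂ} {w : ℝ → ℝ}
    (hu : Continuous u) (hw : Continuous w) (hw0 : ∀ x, 0 ≤ w x)
    (havg : ∫ x in a..b, u x * (w x : ℂ) = 0) (c : ℂ) :
    ∫ x in a..b, ‖u x‖ ^ 2 * w x ≤ ∫ x in a..b, ‖u x - c‖ ^ 2 * w x := by
  have hre : ∫ x in a..b, ((starRingEnd ℂ c) * (u x * (w x : ℂ))).re = 0 := by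
    have h := intervalIntegral.intervalIntegral_re (𝕜 := ℂ) (μ := MeasureTheory.volume)
      (f := fun x => (starRingEnd ℂ c) * (u x * (w x : ℂ))) (a := a) (b := b)
      (Continuous.intervalIntegrable (by fun_prop) _ _)
    rw [intervalIntegral.integral_const_mul, havg] at h
    simpa using h
  have hle : ∫ x in a..b, (‖u x‖ ^ 2 * w x - 2 * ((starRingEnd ℂ c) * (u x * (w x : ℂ))).re)
      ≤ ∫ x in a..b, ‖u x - c‖ ^ 2 * w x := by
    refine intervalIntegral.integral_mono_on hab (Continuous.intervalIntegrable (by fun_prop) _ _)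
      (Continuous.intervalIntegrable (by fun_prop) _ _) fun x _ => ?_
    have h := mul_nonneg (sq_nonneg ‖c‖) (hw0 x)
    simp only [Complex.sq_norm, Complex.normSq_apply, Complex.sub_re, Complex.sub_im,
      Complex.mul_re, Complex.mul_im, Complex.conj_re, Complex.conj_im, Complex.ofReal_re,
      Complex.ofReal_im] at h ⊢
    linarith
  rw [intervalIntegral.integral_sub (Continuous.intervalIntegrable (by fun_prop) _ _)
    (Continuous.intervalIntegrable (by fun_prop) _ _), intervalIntegral.integral_const_mul,
    hre] at hle
  linarith

open Real

/-- Weighted Poincaré-type inequality on `(−π, π)`: for every smooth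
`2π`-periodic function `u` with `∫ u sin^{2k−2}(x/2) = 0`,
`∫ |u'|² sin^{2k}(x/2) ≥ ((4k−3)/16) ∫ |u|² sin^{2k−2}(x/2)`. -/
theorem weighted_poincare_sin (k : ℕ) (hk : 1 ≤ k) (u : ℝ → ℂ)
    (hsmooth : ContDiff ℝ (⊤ : ℕ∞) u)
    (hper : ∀ x : ℝ, u (x + 2 * π) = u x)
    (havg : (∫ x in (-π)..π, u x * ((Real.sin (x / 2) ^ (2 * k - 2) : ℝ) : ℂ)) = 0) :
    (4 * (k : ℝ) - 3) / 16 * ∫ x in (-π)..π, ‖u x‖ ^ 2 * Real.sin (x / 2) ^ (2 * k - 2) ≤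
      ∫ x in (-π)..π, ‖deriv u x‖ ^ 2 * Real.sin (x / 2) ^ (2 * k) := by
  obtain ⟨n, rfl⟩ : ∃ n, k = n + 1 := ⟨k - 1, by omega⟩
  have e1 : 2 * (n + 1) - 2 = 2 * n := by omega
  have e2 : 2 * (n + 1) = 2 * n + 2 := by ring
  rw [e1] at havg ⊢
  rw [e2]
  have hper' : u (-π) = u π := by
    rw [← hper (-π)]
    congr 1
    ring
  have hd : ∀ x, HasDerivAt (fun y => u y - u π) (deriv u x) x := fun x =>
    ((hsmooth.differentiable (by simp)) x).hasDerivAt.sub_const _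
  have hardy := hardy_sin_half_symm n hd (hsmooth.continuous_deriv (by simp)) (sub_self _)
    (by simp [hper'])
  have hvar := integral_norm_sq_mul_le_of_integral_eq_zero (by linarith [pi_pos])
    hsmooth.continuous (w := fun x => Real.sin (x / 2) ^ (2 * n)) (by fun_prop)
    (fun x => by rw [pow_mul]; positivity) havg (u π)
  have hlam : (4 * ((n + 1 : ℕ) : ℝ) - 3) / 16 = (4 * n + 1) / 16 := by
    push_cast
    ring
  rw [hlam]
  exact (mul_le_mul_of_nonneg_left hvar (by positivity)).trans hardy
end

section
/- Let k ≥ 1 be an integer and let 0 ≤ i ≤ k. Then, as an identity of rational numbers, Σ_{m,n} (−1)^n 2^{n−m} C(k+1, i−m) C(k, i+n) C(n−1, m) = (−1)^{k−i} C(k, i) − C(k, i)², where the sum ranges over integers m with 0 ≤ m ≤ min(i, k−i) and integers n with 1 ≤ n ≤ k−i. -/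
open Finset

theorem sum_choose_mul_two_pow_mul_choose (K i n : ℕ) :
    ∑ m ∈ range (i + 1), ((K.choose (i - m) : ℚ) * (2 ^ (n - m) * n.choose m)) =
      ∑ j ∈ range (n + 1), ((n.choose j : ℚ) * (K + j).choose i) := by
  have h : ((Polynomial.X + 1) ^ K * (Polynomial.X + Polynomial.C 2) ^ n : Polynomial ℚ) =
      ∑ j ∈ range (n + 1), Polynomial.C (n.choose j : ℚ) * (Polynomial.X + 1) ^ (K + j) := by
    have h2 : (Polynomial.X + Polynomial.C 2 : Polynomial ℚ) = (Polynomial.X + 1) + 1 := by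
      rw [show (2 : ℚ) = 1 + 1 by norm_num, Polynomial.C_add, Polynomial.C_1]; ring
    rw [h2, add_pow (Polynomial.X + 1 : Polynomial ℚ) 1 n, mul_sum]
    refine sum_congr rfl fun j _ => ?_
    rw [map_natCast, pow_add]
    ring
  have := congrArg (fun p => p.coeff i) h
  rw [mul_comm, Polynomial.coeff_mul,
    Finset.Nat.sum_antidiagonal_eq_sum_range_succ_mk] at this
  simpa [Polynomial.coeff_X_add_C_pow, Polynomial.coeff_X_add_one_pow,
    Polynomial.finsetSum_coeff, mul_comm] using this

theorem alternating_sum_choose_mul_choose (k j M : ℕ) (hj : j < k) (hM : k < M) :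
    ∑ n ∈ range M, ((-1 : ℚ) ^ n * k.choose n * n.choose j) = 0 := by
  have h : ∑ n ∈ range (k + 1), ((-1 : ℚ) ^ n * k.choose n * n.choose j) = 0 := by
    obtain ⟨d, rfl⟩ := Nat.exists_eq_add_of_lt hj
    rw [show j + d + 1 + 1 = j + (d + 1 + 1) by ring, sum_range_add]
    rw [sum_eq_zero (fun n hn => by
      rw [Nat.choose_eq_zero_of_lt (mem_range.1 hn)]; simp), zero_add]
    have h1 : ∀ x, ((-1 : ℚ) ^ (j + x) * (j + d + 1).choose (j + x) * (j + x).choose j) =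
        (-1) ^ j * (j + d + 1).choose j * ((-1) ^ x * (d + 1).choose x) := by
      intro x
      by_cases hx : x ≤ d + 1
      · have := Nat.choose_mul (n := j + d + 1) (k := j + x) (s := j) (by omega)
        rw [show j + d + 1 - j = d + 1 by omega, Nat.add_sub_cancel_left] at this
        rw [mul_assoc, ← Nat.cast_mul, this, pow_add]
        push_cast; ring
      · rw [Nat.choose_eq_zero_of_lt (show j + d + 1 < j + x by omega),
          Nat.choose_eq_zero_of_lt (show d + 1 < x by omega)]
        simp
    simp_rw [h1, ← mul_sum]
    have := Int.alternating_sum_range_choose_of_ne (n := d + 1) (by omega)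
    have h3 : ∑ x ∈ range (d + 1 + 1), ((-1 : ℚ) ^ x * (d + 1).choose x) = 0 := by
      exact_mod_cast this
    rw [h3, mul_zero]
  rw [← h]
  symm
  apply sum_subset (range_subset_range.2 hM)
  intro n _ hn
  rw [Nat.choose_eq_zero_of_lt (show k < n by simpa using hn)]
  simp

theorem alternating_sum_choose_add_mul_choose (k i j M : ℕ) (hj : j ≤ k) (hM : k + 1 < M) :
    ∑ n ∈ range M, ((-1 : ℚ) ^ n * (k + 1).choose (i + 1 + n) * n.choose j) =
      (-1) ^ j * (k - j).choose i := by
  induction k generalizing i with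
  | zero =>
    obtain rfl : j = 0 := by omega
    rw [sum_eq_single 0]
    · cases i <;> simp [Nat.choose_eq_zero_of_lt]
    · intro n _ hn
      rw [Nat.choose_eq_zero_of_lt (by omega)]; simp
    · intro h; simp at h; omega
  | succ k ih =>
    rcases hj.lt_or_eq with hj | rfl
    · have hs : ∑ n ∈ range M, ((-1 : ℚ) ^ n * (k + 1 + 1).choose (i + 1 + n) * n.choose j) =
          ∑ n ∈ range M, ((-1 : ℚ) ^ n * (k + 1).choose (i + n) * n.choose j) +
          ∑ n ∈ range M, ((-1 : ℚ) ^ n * (k + 1).choose (i + 1 + n) * n.choose j) := by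
        rw [← sum_add_distrib]
        refine sum_congr rfl fun n _ => ?_
        rw [show i + 1 + n = (i + n) + 1 by ring, Nat.choose_succ_succ' (k + 1)]
        push_cast; ring
      rw [hs, ih i (by omega) (by omega)]
      cases i with
      | zero =>
        simp_rw [zero_add]
        rw [alternating_sum_choose_mul_choose _ _ _ hj (by omega)]
        simp
      | succ i =>
        rw [ih i (by omega) (by omega), show k + 1 - j = (k - j) + 1 by omega,
          Nat.choose_succ_succ' (k - j)]
        push_cast; ring
    · rw [sum_eq_single (k + 1)]
      · cases i with
        | zero => simp [Nat.add_comm 1]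
        | succ i => rw [Nat.choose_eq_zero_of_lt (by omega)]; simp
      · intro n _ hn
        rcases lt_or_gt_of_ne hn with hn | hn
        · rw [Nat.choose_eq_zero_of_lt hn]; simp
        · rw [Nat.choose_eq_zero_of_lt (show k + 1 + 1 < i + 1 + n by omega)]; simp
      · intro h; simp at h; omega

theorem alternating_sum_choose_add_mul_choose_add (d N : ℕ) :
    ∑ p ∈ range (2 * N + 1),
      ((-1 : ℚ) ^ p * (d + p).choose d * (d + (2 * N - p)).choose d) = (d + N).choose d := by
  have hA : (PowerSeries.mk 1 : PowerSeries ℚ) * (1 - PowerSeries.X) = 1 :=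
    PowerSeries.mk_one_mul_one_sub_eq_one ℚ
  have hB : PowerSeries.evalNegHom (PowerSeries.mk 1 : PowerSeries ℚ) *
      (1 + PowerSeries.X) = 1 := by
    simpa using congrArg PowerSeries.evalNegHom hA
  have hE : PowerSeries.expand 2 two_ne_zero (PowerSeries.mk 1 : PowerSeries ℚ) *
      (1 - PowerSeries.X ^ 2) = 1 := by
    simpa using congrArg (PowerSeries.expand 2 two_ne_zero) hA
  have h : PowerSeries.evalNegHom (PowerSeries.mk 1 : PowerSeries ℚ) * PowerSeries.mk 1 =
      PowerSeries.expand 2 two_ne_zero (PowerSeries.mk 1 : PowerSeries ℚ) := by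
    linear_combination
      (PowerSeries.expand 2 two_ne_zero (PowerSeries.mk 1 : PowerSeries ℚ)) *
        (hA * (PowerSeries.evalNegHom (PowerSeries.mk 1 : PowerSeries ℚ) *
          (1 + PowerSeries.X)) + hB) -
      PowerSeries.evalNegHom (PowerSeries.mk 1 : PowerSeries ℚ) * PowerSeries.mk 1 * hE
  have h2 := congrArg (fun f => PowerSeries.coeff (2 * N) (f ^ (d + 1))) h
  simp only [mul_pow, ← map_pow, PowerSeries.mk_one_pow_eq_mk_choose_add,
    PowerSeries.coeff_expand_mul, PowerSeries.coeff_mk, PowerSeries.coeff_mul,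
    Finset.Nat.sum_antidiagonal_eq_sum_range_succ_mk, PowerSeries.evalNegHom,
    PowerSeries.coeff_rescale] at h2
  exact h2

/-- The combinatorial identity
`Σ_{m,n} (−1)^n 2^{n−m} C(k+1, i−m) C(k, i+n) C(n−1, m)
  = (−1)^{k−i} C(k, i) − C(k, i)²`,
where `0 ≤ m ≤ min(i, k−i)` and `1 ≤ n ≤ k−i`. -/
theorem combinatorial_identity (k i : ℕ) (hk : 1 ≤ k) (hi : i ≤ k) :
    ∑ m ∈ Finset.range (min i (k - i) + 1), ∑ n ∈ Finset.Icc 1 (k - i),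
        (-1 : ℚ) ^ n * (2 : ℚ) ^ ((n : ℤ) - (m : ℤ)) *
          (Nat.choose (k + 1) (i - m) : ℚ) * (Nat.choose k (i + n) : ℚ) *
          (Nat.choose (n - 1) m : ℚ) =
      (-1 : ℚ) ^ (k - i) * (Nat.choose k i : ℚ) - (Nat.choose k i : ℚ) ^ 2 := by
  obtain ⟨N, rfl⟩ := Nat.exists_eq_add_of_le hi
  rw [Nat.add_sub_cancel_left]
  have hterm : ∀ m n : ℕ, (-1 : ℚ) ^ (n + 1) * (2 : ℚ) ^ (((n + 1 : ℕ) : ℤ) - (m : ℤ)) *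
      ((i + N + 1).choose (i - m) : ℚ) * ((i + N).choose (i + (n + 1)) : ℚ) *
      ((n + 1 - 1).choose m : ℚ) = -2 * ((-1) ^ n * (i + N).choose (i + 1 + n) *
        ((i + N + 1).choose (i - m) * (2 ^ (n - m) * n.choose m))) := by
    intro m n
    rw [Nat.add_sub_cancel, show i + (n + 1) = i + 1 + n by ring]
    rcases lt_or_ge n m with h | h
    · simp [Nat.choose_eq_zero_of_lt h]
    · rw [show ((n + 1 : ℕ) : ℤ) - (m : ℤ) = ((n - m + 1 : ℕ) : ℤ) by omega, zpow_natCast]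
      ring
  have hIcc : ∀ f : ℕ → ℚ, ∑ n ∈ Icc 1 N, f n = ∑ n ∈ range N, f (n + 1) := fun f => by
    rw [Finset.range_eq_Ico, Finset.sum_Ico_add' f 0 N 1]; rfl
  have hsum : ∑ m ∈ range (min i N + 1), ∑ n ∈ Icc 1 N,
      (-1 : ℚ) ^ n * (2 : ℚ) ^ ((n : ℤ) - (m : ℤ)) *
        ((i + N + 1).choose (i - m) : ℚ) * ((i + N).choose (i + n) : ℚ) *
        ((n - 1).choose m : ℚ) =
      -2 * ∑ j ∈ range N, ((-1 : ℚ) ^ j * (i + N - 1 - j).choose i * (i + N + 1 + j).choose i) := by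
    simp_rw [hIcc, hterm, ← mul_sum]
    congr 1
    rw [sum_comm]
    have hinner : ∀ n ∈ range N, ∑ m ∈ range (min i N + 1),
        ((-1 : ℚ) ^ n * (i + N).choose (i + 1 + n) *
          ((i + N + 1).choose (i - m) * (2 ^ (n - m) * n.choose m))) =
        ∑ j ∈ range N, ((-1 : ℚ) ^ n * (i + N).choose (i + 1 + n) * n.choose j) *
          (i + N + 1 + j).choose i := by
      intro n hn
      rw [mem_range] at hn
      have h1 : ∑ m ∈ range (min i N + 1),
          (((i + N + 1).choose (i - m) : ℚ) * (2 ^ (n - m) * n.choose m)) =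
          ∑ m ∈ range (i + 1),
          (((i + N + 1).choose (i - m) : ℚ) * (2 ^ (n - m) * n.choose m)) := by
        apply sum_subset (range_subset_range.2 (by omega))
        intro m hm hm'
        rw [mem_range] at hm hm'
        simp [Nat.choose_eq_zero_of_lt (show n < m by omega)]
      have h2 : ∑ j ∈ range (n + 1), ((n.choose j : ℚ) * (i + N + 1 + j).choose i) =
          ∑ j ∈ range N, ((n.choose j : ℚ) * (i + N + 1 + j).choose i) := by
        apply sum_subset (range_subset_range.2 (by omega))
        intro j hj hj'
        rw [mem_range] at hj hj'
        simp [Nat.choose_eq_zero_of_lt (show n < j by omega)]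
      rw [← mul_sum, h1, sum_choose_mul_two_pow_mul_choose, h2, mul_sum]
      exact sum_congr rfl fun j _ => by ring
    rw [sum_congr rfl hinner, sum_comm]
    refine sum_congr rfl fun j hj => ?_
    rw [mem_range] at hj
    rw [← sum_mul]
    congr 1
    have h3 := alternating_sum_choose_add_mul_choose (i + N - 1) i j (i + N + 1)
      (by omega) (by omega)
    rw [show i + N - 1 + 1 = i + N by omega] at h3
    rw [← h3]
    apply sum_subset (range_subset_range.2 (by omega))
    intro n hn hn'
    rw [mem_range] at hn hn'
    simp [Nat.choose_eq_zero_of_lt (show i + N < i + 1 + n by omega)]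
  rw [hsum]
  have hV := alternating_sum_choose_add_mul_choose_add i N
  rw [show 2 * N + 1 = N + 1 + N by ring, sum_range_add, sum_range_succ,
    ← sum_range_reflect] at hV
  have hsq : ((-1 : ℚ) ^ N) * (-1) ^ N = 1 := by rw [← mul_pow]; simp
  have hleft : ∀ j ∈ range N, (-1 : ℚ) ^ (N - 1 - j) * (i + (N - 1 - j)).choose i *
      (i + (2 * N - (N - 1 - j))).choose i = -(-1) ^ N *
        ((-1) ^ j * (i + N - 1 - j).choose i * (i + N + 1 + j).choose i) := by
    intro j hj
    rw [mem_range] at hj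
    obtain ⟨r, rfl⟩ := Nat.exists_eq_add_of_lt hj
    rw [show j + r + 1 - 1 - j = r by omega, show i + (j + r + 1) - 1 - j = i + r by omega,
      show i + (2 * (j + r + 1) - r) = i + (j + r + 1) + 1 + j by omega]
    have hj2 : ((-1 : ℚ) ^ j) * (-1) ^ j = 1 := by rw [← mul_pow]; simp
    rw [pow_succ, pow_add]
    linear_combination (-(-1 : ℚ) ^ r * (i + r).choose i *
      (i + (j + r + 1) + 1 + j).choose i) * hj2
  have hright : ∀ j ∈ range N, (-1 : ℚ) ^ (N + 1 + j) * (i + (N + 1 + j)).choose i *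
      (i + (2 * N - (N + 1 + j))).choose i = -(-1) ^ N *
        ((-1) ^ j * (i + N - 1 - j).choose i * (i + N + 1 + j).choose i) := by
    intro j hj
    rw [mem_range] at hj
    rw [show i + (2 * N - (N + 1 + j)) = i + N - 1 - j by omega,
      show i + (N + 1 + j) = i + N + 1 + j by ring]
    ring
  rw [sum_congr rfl hleft, sum_congr rfl hright, ← mul_sum,
    show 2 * N - N = N by omega] at hV
  linear_combination (-1 : ℚ) ^ N * hV +
    (2 * (∑ j ∈ range N, ((-1 : ℚ) ^ j * (i + N - 1 - j).choose i * (i + N + 1 + j).choose i)) -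
      ((i + N).choose i : ℚ) ^ 2) * hsq
end
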